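/- Let X be an irreducible closed subvariety of the torus G_m^n defined over a number field K, and let L ⊇ K be a subfield of the algebraic numbers with the Bogomolov property. Then there are at most finitely many points in X^{oa}(L) that are contained in some connected algebraic subgroup of G_m^n of codimension at least dim X. -/

import Mathlib

noncomputable section

abbrev Qbar : Type := AlgebraicClosure ℚ

/-- The absolute logarithmic Weil height of an algebraic number, via the
Mahler-measure formula applied to its (integer-scaled) minimal polynomial. -/
noncomputable def weilHeight (α : Qbar) : ℝ :=
  (Real.log (((minpoly ℚ α).support.lcm fun i => ((minpoly ℚ α).coeff i).den : ℕ) : ℝ) +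
      (((minpoly ℚ α).aroots ℂ).map fun z => Real.log (max 1 ‖z‖)).sum) /
    ((minpoly ℚ α).natDegree : ℝ)

/-- Points of the torus `G_m^n` over the algebraic numbers. -/
abbrev TorusPt (n : ℕ) : Type := Fin n → Qbarˣ

/-- Zariski-closed subsets of the torus: zero sets of families of polynomials. -/
def ZClosed {n : ℕ} (S : Set (TorusPt n)) : Prop :=
  ∃ I : Set (MvPolynomial (Fin n) Qbar),
    S = {x : TorusPt n | ∀ f ∈ I, MvPolynomial.eval (fun i => (x i : Qbar)) f = 0}

/-- Irreducibility (of a subset of the torus) for the Zariski topology. -/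
def ZIrred {n : ℕ} (S : Set (TorusPt n)) : Prop :=
  S.Nonempty ∧ ∀ Z₁ Z₂ : Set (TorusPt n), ZClosed Z₁ → ZClosed Z₂ →
    S ⊆ Z₁ ∪ Z₂ → S ⊆ Z₁ ∨ S ⊆ Z₂

/-- Dimension via lengths of chains of irreducible closed subsets. -/
def zdim {n : ℕ} (S : Set (TorusPt n)) : ℕ :=
  sSup {d : ℕ | ∃ Z : Fin (d + 1) → Set (TorusPt n),
    (∀ i, ZClosed (Z i) ∧ ZIrred (Z i) ∧ Z i ⊆ S) ∧
    ∀ i j : Fin (d + 1), i < j → Z i ⊂ Z j}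

/-- An algebraic subgroup of the torus: a Zariski-closed subgroup. -/
def IsAlgSubgroup {n : ℕ} (H : Set (TorusPt n)) : Prop :=
  ZClosed H ∧ (1 : TorusPt n) ∈ H ∧ (∀ x ∈ H, ∀ y ∈ H, x * y ∈ H) ∧ ∀ x ∈ H, x⁻¹ ∈ H

/-- A coset: a translate of an algebraic subgroup. -/
def IsCoset {n : ℕ} (C : Set (TorusPt n)) : Prop :=
  ∃ (g : TorusPt n) (H : Set (TorusPt n)), IsAlgSubgroup H ∧ C = (g * ·) '' H

/-- Zariski connectedness of a subset of the torus. -/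
def ZConnected {n : ℕ} (H : Set (TorusPt n)) : Prop :=
  ∀ Z₁ Z₂ : Set (TorusPt n), ZClosed Z₁ → ZClosed Z₂ → H ⊆ Z₁ ∪ Z₂ →
    H ∩ Z₁ ∩ Z₂ = ∅ → H ⊆ Z₁ ∨ H ⊆ Z₂

/-- `Y` is an `s`-anomalous subvariety of `X`. -/
def IsAnomalous {n : ℕ} (X Y : Set (TorusPt n)) (s : ℕ) : Prop :=
  Y ⊆ X ∧ ZClosed Y ∧ ZIrred Y ∧ 1 ≤ zdim Y ∧
    ∃ H : Set (TorusPt n), IsCoset H ∧ Y ⊆ H ∧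
      (s : ℤ) + (zdim H : ℤ) - (n : ℤ) < (zdim Y : ℤ)

/-- `X^{oa,s}` : the complement in `X` of the union of all `s`-anomalous subvarieties. -/
def openAnom {n : ℕ} (X : Set (TorusPt n)) (s : ℕ) : Set (TorusPt n) :=
  X \ ⋃ (Y : Set (TorusPt n)) (_ : IsAnomalous X Y s), Y

/-- `X` is defined over (the subfield) `K`: cut out by polynomials with coefficients in `K`. -/
def DefinedOver {n : ℕ} (K : IntermediateField ℚ Qbar) (X : Set (TorusPt n)) : Prop :=
  ∃ I : Set (MvPolynomial (Fin n) Qbar),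
    (∀ f ∈ I, ∀ m, MvPolynomial.coeff m f ∈ K) ∧
    X = {x : TorusPt n | ∀ f ∈ I, MvPolynomial.eval (fun i => (x i : Qbar)) f = 0}

def IsRootOfUnity (α : Qbar) : Prop := ∃ k : ℕ, 1 ≤ k ∧ α ^ k = 1

/-- The Bogomolov property for a subfield of the algebraic numbers. -/
def HasBogomolov (L : IntermediateField ℚ Qbar) : Prop :=
  ∃ C : ℝ, 0 < C ∧ ∀ α : Qbar, α ∈ L → α ≠ 0 → ¬ IsRootOfUnity α → C ≤ weilHeight α



noncomputable section

open scoped TensorProduct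

/-- Derivations of a field over a char-zero subfield are freely determined on a transcendence basis. -/
theorem ax_der_exists {κ Ω ι : Type} [Field κ] [Field Ω] [CharZero κ] [Algebra κ Ω]
    (t : ι → Ω) (ht : IsTranscendenceBasis κ t) (v : ι → Ω) :
    ∃ D : Derivation κ Ω Ω, ∀ i, D (t i) = v i := by
  let : Algebra (MvPolynomial ι κ) Ω := (MvPolynomial.aeval t).toAlgebra
  have hmap : ∀ p, algebraMap (MvPolynomial ι κ) Ω p = MvPolynomial.aeval t p := fun p => rfl
  have : IsScalarTower κ (MvPolynomial ι κ) Ω := IsScalarTower.of_algebraMap_eq (fun x => by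
    rw [hmap, MvPolynomial.algebraMap_eq, MvPolynomial.aeval_C])
  have hinj : Function.Injective (algebraMap (MvPolynomial ι κ) Ω) := ht.1
  have : FaithfulSMul (MvPolynomial ι κ) Ω := (faithfulSMul_iff_algebraMap_injective _ _).2 hinj
  let : Algebra (FractionRing (MvPolynomial ι κ)) Ω := FractionRing.liftAlgebra _ _
  have : IsScalarTower (MvPolynomial ι κ) (FractionRing (MvPolynomial ι κ)) Ω :=
    FractionRing.isScalarTower_liftAlgebra _ _
  have halg : Algebra.IsAlgebraic (MvPolynomial ι κ) Ω := by
    have h1 : Algebra.IsAlgebraic (Algebra.adjoin κ (Set.range t)) Ω := ht.isAlgebraic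
    constructor
    intro x
    obtain ⟨p, hp0, hp⟩ := h1.isAlgebraic x
    refine ⟨p.map (ht.1.aevalEquiv.symm : _ →+* MvPolynomial ι κ), ?_, ?_⟩
    · rwa [Ne, Polynomial.map_eq_zero_iff]
      exact ht.1.aevalEquiv.symm.injective
    · rw [Polynomial.aeval_def, Polynomial.eval₂_map]
      rw [Polynomial.aeval_def] at hp
      convert hp using 2
      ext a
      obtain ⟨b, rfl⟩ := ht.1.aevalEquiv.surjective a
      simp [hmap]
  have : Algebra.IsAlgebraic (FractionRing (MvPolynomial ι κ)) Ω :=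
    ⟨fun x => (halg.isAlgebraic x).extendScalars
      (IsFractionRing.injective (MvPolynomial ι κ) (FractionRing (MvPolynomial ι κ)))⟩
  have : CharZero (FractionRing (MvPolynomial ι κ)) :=
    charZero_of_injective_algebraMap (R := κ)
      (algebraMap κ (FractionRing (MvPolynomial ι κ))).injective
  have : Algebra.FormallyEtale (FractionRing (MvPolynomial ι κ)) Ω :=
    Algebra.FormallyEtale.of_isSeparable _ _
  have : Algebra.FormallyEtale (MvPolynomial ι κ) (FractionRing (MvPolynomial ι κ)) :=
    Algebra.FormallyEtale.of_isLocalization (nonZeroDivisors _)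
  have : Algebra.FormallyEtale (MvPolynomial ι κ) Ω :=
    Algebra.FormallyEtale.comp _ (FractionRing (MvPolynomial ι κ)) _
  let d0 : Derivation κ (MvPolynomial ι κ) Ω := MvPolynomial.mkDerivation κ v
  let f0 : (Ω ⊗[MvPolynomial ι κ] (KaehlerDifferential κ (MvPolynomial ι κ))) →ₗ[Ω] Ω :=
    LinearMap.liftBaseChange Ω d0.liftKaehlerDifferential
  let e := KaehlerDifferential.tensorKaehlerEquivOfFormallyEtale κ (MvPolynomial ι κ) Ω
  refine ⟨(f0.comp e.symm.toLinearMap).compDer (KaehlerDifferential.D κ Ω), fun i => ?_⟩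
  have h1 : t i = algebraMap (MvPolynomial ι κ) Ω (MvPolynomial.X i) := by simp [hmap]
  change f0 (e.symm (KaehlerDifferential.D κ Ω (t i))) = v i
  conv_lhs => rw [h1]
  rw [KaehlerDifferential.tensorKaehlerEquivOfFormallyEtale_symm_D_algebraMap]
  simp [f0, d0]

/-- A derivation vanishing on a subfield vanishes on algebraic elements. -/
theorem ax_der_zero_of_algebraic {κ Ω : Type} [Field κ] [Field Ω] [CharZero κ] [Algebra κ Ω]
    (D : Derivation κ Ω Ω) (C : Subfield Ω) (hC : ∀ c ∈ C, D c = 0) (x : Ω)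
    (hx : IsAlgebraic C x) : D x = 0 := by
  have : CharZero Ω := charZero_of_injective_algebraMap (algebraMap κ Ω).injective
  have hsep : (minpoly C x).Separable := (minpoly.irreducible hx.isIntegral).separable
  have hne : Polynomial.aeval x (Polynomial.derivative (minpoly C x)) ≠ 0 :=
    hsep.aeval_derivative_ne_zero (minpoly.aeval C x)
  have key : ∀ p : Polynomial C, D (Polynomial.aeval x p)
      = Polynomial.aeval x (Polynomial.derivative p) * D x := by
    intro p
    induction p using Polynomial.induction_on' with
    | add p q hp hq => simp [hp, hq, add_mul]
    | monomial k a =>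
      have : D (a : Ω) = 0 := hC a a.2
      simp [Polynomial.aeval_monomial, Polynomial.derivative_monomial, Derivation.leibniz_pow]
      rw [show (algebraMap C Ω a) = (a : Ω) from rfl, this]
      ring
  have h := key (minpoly C x)
  rw [minpoly.aeval, map_zero] at h
  rcases mul_eq_zero.1 h.symm with h | h
  · exact absurd h hne
  · exact h

theorem ax_der_ext {κ Ω ι : Type} [Field κ] [Field Ω] [CharZero κ] [Algebra κ Ω]
    (t : ι → Ω) (ht : IsTranscendenceBasis κ t) (D : Derivation κ Ω Ω)
    (h : ∀ i, D (t i) = 0) : D = 0 := by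
  ext x
  have h1 : Algebra.IsAlgebraic (IntermediateField.adjoin κ (Set.range t)) Ω := ht.isAlgebraic_field
  have h2 := h1.isAlgebraic x
  refine ax_der_zero_of_algebraic D (IntermediateField.adjoin κ (Set.range t)).toSubfield ?_ x h2
  intro c hc
  change c ∈ IntermediateField.adjoin κ (Set.range t) at hc
  induction hc using IntermediateField.adjoin_induction with
  | mem y hy => obtain ⟨i, rfl⟩ := hy; exact h i
  | algebraMap y => simp
  | add y z _ _ hy hz => simp [hy, hz]
  | inv y _ hy => simp [Derivation.leibniz_inv, hy]
  | mul y z _ _ hy hz => simp [Derivation.leibniz, hy, hz]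

end

noncomputable section

open Polynomial

/-- `y` is regular at `z = 0` with residue value `c`. -/
def AxRes {G Ω : Type} [Field G] [Field Ω] [Algebra G Ω] (z y : Ω) (c : G) : Prop :=
  ∃ A B : G[X], B.coeff 0 ≠ 0 ∧ y * aeval z B = aeval z A ∧ A.coeff 0 = c * B.coeff 0

theorem AxRes.add {G Ω : Type} [Field G] [Field Ω] [Algebra G Ω] {z y y' : Ω} {c c' : G}
    (h : AxRes z y c) (h' : AxRes z y' c') : AxRes z (y + y') (c + c') := by
  obtain ⟨A, B, h1, h2, h3⟩ := h
  obtain ⟨A', B', h1', h2', h3'⟩ := h'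
  refine ⟨A * B' + A' * B, B * B', ?_, ?_, ?_⟩
  · rw [mul_coeff_zero]; exact mul_ne_zero h1 h1'
  · simp only [map_mul, map_add]; rw [← h2, ← h2']; ring
  · simp only [mul_coeff_zero, coeff_add, h3, h3']; ring

theorem AxRes.smul {G Ω : Type} [Field G] [Field Ω] [Algebra G Ω] {z y : Ω} {c : G} (g : G)
    (h : AxRes z y c) : AxRes z (algebraMap G Ω g * y) (g * c) := by
  obtain ⟨A, B, h1, h2, h3⟩ := h
  refine ⟨C g * A, B, h1, ?_, ?_⟩
  · simp only [map_mul, aeval_C, ← h2]; ring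
  · simp only [mul_coeff_zero, coeff_C_zero, h3]; ring

theorem AxRes.zero {G Ω : Type} [Field G] [Field Ω] [Algebra G Ω] {z : Ω} :
    AxRes z 0 (0 : G) := ⟨0, 1, by simp, by simp, by simp⟩

theorem AxRes.sum {G Ω ι : Type} [Field G] [Field Ω] [Algebra G Ω] {z : Ω} (s : Finset ι)
    (y : ι → Ω) (c : ι → G) (h : ∀ i, AxRes z (y i) (c i)) :
    AxRes z (∑ i ∈ s, y i) (∑ i ∈ s, c i) := by
  classical
  induction s using Finset.induction_on with
  | empty => simpa using AxRes.zero
  | insert a s ha ih => rw [Finset.sum_insert ha, Finset.sum_insert ha]; exact (h a).add ih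

theorem AxRes.eq_zero {G Ω : Type} [Field G] [Field Ω] [Algebra G Ω] {z : Ω}
    (hz : Transcendental G z) {c : G} (h : AxRes z 0 c) : c = 0 := by
  obtain ⟨A, B, h1, h2, h3⟩ := h
  rw [zero_mul] at h2
  have : A = 0 := by
    by_contra hA
    exact hz ⟨A, hA, h2.symm⟩
  rw [this, coeff_zero] at h3
  rcases mul_eq_zero.1 h3.symm with h | h
  · exact h
  · exact absurd h h1

theorem AxRes.unique {G Ω : Type} [Field G] [Field Ω] [Algebra G Ω] {z y : Ω}
    (hz : Transcendental G z) {c c' : G} (h : AxRes z y c) (h' : AxRes z y c') : c = c' := by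
  have := h.add (h'.smul (-1))
  simp only [map_neg, map_one, neg_mul, one_mul, add_neg_cancel] at this
  have := this.eq_zero hz
  exact add_neg_eq_zero.1 this

theorem AxRes.logderiv_poly {G Ω : Type} [Field G] [Field Ω] [Algebra G Ω] {z : Ω}
    (hz : Transcendental G z) (D : Derivation G Ω Ω) (hD : D z = 1) (r : G[X]) (hr : r ≠ 0) :
    ∃ k : ℕ, AxRes z (z * (D (aeval z r) / aeval z r)) (k : G) := by
  obtain ⟨p, hp1, hp2⟩ := r.exists_eq_pow_rootMultiplicity_mul_and_not_dvd hr 0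
  rw [map_zero, sub_zero] at hp1 hp2
  set k := rootMultiplicity 0 r
  have hz0 : z ≠ 0 := fun h => hz (h ▸ isAlgebraic_zero)
  have hp0 : p.coeff 0 ≠ 0 := fun h => hp2 (X_dvd_iff.2 h)
  have hpz : aeval z p ≠ 0 := by
    intro h
    exact hz ⟨p, fun h' => hp0 (by simp [h']), h⟩
  have hDp : ∀ q : G[X], D (aeval z q) = aeval z (derivative q) := by
    intro q
    rw [Derivation.map_aeval, hD, smul_eq_mul, mul_one]
  refine ⟨k, C (k : G) * p + X * derivative p, p, hp0, ?_, ?_⟩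
  · rw [hp1, map_mul, map_pow, aeval_X, Derivation.leibniz, Derivation.leibniz_pow, hDp, hD]
    simp only [map_add, map_mul, aeval_C, aeval_X, map_natCast, smul_eq_mul, nsmul_eq_mul, mul_one]
    rcases Nat.eq_zero_or_pos k with hk | hk
    · rw [hk]; simp; field_simp
    · obtain ⟨j, hj⟩ : ∃ j, k = j + 1 := ⟨k - 1, by omega⟩
      rw [hj]; simp only [Nat.add_sub_cancel]; field_simp; ring
  · simp

theorem AxRes.logderiv {G Ω : Type} [Field G] [Field Ω] [Algebra G Ω] {z : Ω}
    (hz : Transcendental G z) (D : Derivation G Ω Ω) (hD : D z = 1) (y : Ω) (hy : y ≠ 0)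
    (hy' : y ∈ IntermediateField.adjoin G {z}) :
    ∃ k : ℤ, AxRes z (z * (D y / y)) (k : G) := by
  obtain ⟨r, s, rfl⟩ := (IntermediateField.mem_adjoin_simple_iff G _).1 hy'
  have hr0 : aeval z r ≠ 0 := fun h => hy (by rw [h, zero_div])
  have hs0 : aeval z s ≠ 0 := fun h => hy (by rw [h, div_zero])
  obtain ⟨k, hk⟩ := AxRes.logderiv_poly hz D hD r (fun h => hr0 (by simp [h]))
  obtain ⟨l, hl⟩ := AxRes.logderiv_poly hz D hD s (fun h => hs0 (by simp [h]))
  refine ⟨k - l, ?_⟩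
  have := hk.add (hl.smul (-1))
  convert this using 1
  · rw [Derivation.leibniz_div]
    simp only [smul_eq_mul, map_neg, map_one]
    field_simp
    ring
  · push_cast; ring

/-- If `Σ β_b dlog N_b = 0` with `N_b ∈ G(z)` and `β` in the field of constants linearly independent
over `ℤ`, then no `N_b` is a positive power of `z`. -/
theorem ax_residue {G Ω ι : Type} [Field G] [Field Ω] [Algebra G Ω] [Fintype ι] [CharZero G] {z : Ω}
    (hz : Transcendental G z) (D : Derivation G Ω Ω) (hD : D z = 1) (β : ι → G)
    (hβ : LinearIndependent ℤ β)
    (N : ι → Ω) (hN : ∀ b, N b ≠ 0) (hN' : ∀ b, N b ∈ IntermediateField.adjoin G {z})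
    (hsum : ∑ b, algebraMap G Ω (β b) * (D (N b) / N b) = 0) (b₀ : ι) (m : ℕ) (hm : 0 < m)
    (hb : N b₀ = z ^ m) : False := by
  choose k hk using fun b => AxRes.logderiv hz D hD (N b) (hN b) (hN' b)
  have h1 := AxRes.sum Finset.univ _ _ (fun b => (hk b).smul (β b))
  have h2 : ∑ b, algebraMap G Ω (β b) * (z * (D (N b) / N b)) = 0 := by
    have : ∑ b, algebraMap G Ω (β b) * (z * (D (N b) / N b)) =
      z * ∑ b, algebraMap G Ω (β b) * (D (N b) / N b) := by
      rw [Finset.mul_sum]; exact Finset.sum_congr rfl (fun b _ => by ring)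
    rw [this, hsum, mul_zero]
  rw [h2] at h1
  have h3 := h1.eq_zero hz
  have hz0 : z ≠ 0 := fun h => hz (h ▸ isAlgebraic_zero)
  have h4 : k b₀ = 0 := by
    refine Fintype.linearIndependent_iff.1 hβ k ?_ b₀
    rw [← h3]
    exact Finset.sum_congr rfl (fun b _ => by rw [zsmul_eq_mul, mul_comm])
  have h5 := hk b₀
  rw [h4, hb] at h5
  have h6 : AxRes z (z * (D (z ^ m) / z ^ m)) (m : G) := by
    refine ⟨C (m : G), 1, by simp, ?_, by simp⟩
    obtain ⟨j, rfl⟩ : ∃ j, m = j + 1 := ⟨m - 1, by omega⟩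
    rw [Derivation.leibniz_pow, hD]
    simp
    field_simp
    ring
  have := h6.unique hz h5
  simp at this
  omega

end

noncomputable section

/-- Extend scalars of a derivation killing an intermediate field. -/
def axDerOver {κ Ω : Type} [Field κ] [Field Ω] [Algebra κ Ω] (D : Derivation κ Ω Ω)
    (G : IntermediateField κ Ω) (hG : ∀ g ∈ G, D g = 0) : Derivation G Ω Ω :=
  Derivation.mk' { toFun := D, map_add' := map_add D, map_smul' := by
                    intro g x
                    rw [IntermediateField.smul_def, smul_eq_mul, Derivation.leibniz, hG g g.2]
                    simp [IntermediateField.smul_def] } (fun a b => by simp)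

theorem axDerOver_apply {κ Ω : Type} [Field κ] [Field Ω] [Algebra κ Ω] (D : Derivation κ Ω Ω)
    (G : IntermediateField κ Ω) (hG : ∀ g ∈ G, D g = 0) (x : Ω) : axDerOver D G hG x = D x := rfl

/-- Derivations commute with automorphisms fixing a transcendence basis. -/
theorem ax_der_comm {κ Ω ι : Type} [Field κ] [Field Ω] [CharZero κ] [Algebra κ Ω]
    (t : ι → Ω) (ht : IsTranscendenceBasis κ t) (D : Derivation κ Ω Ω) (s : Ω ≃ₐ[κ] Ω)
    (hs : ∀ i, s (t i) = t i) (hs' : ∀ i, s (D (t i)) = D (t i)) (x : Ω) : D (s x) = s (D x) := by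
  let D' : Derivation κ Ω Ω := Derivation.mk' (s.symm.toLinearMap ∘ₗ (D : Ω →ₗ[κ] Ω) ∘ₗ s.toLinearMap)
    (fun a b => by simp [Derivation.leibniz])
  have hD' : ∀ x, D' x = s.symm (D (s x)) := fun x => rfl
  have h0 : D' - D = 0 := by
    refine ax_der_ext t ht _ (fun i => ?_)
    rw [Derivation.sub_apply, hD', hs, sub_eq_zero, AlgEquiv.symm_apply_eq, hs']
  have h1 : D' x = D x := by
    rw [sub_eq_zero] at h0; rw [h0]
  rw [hD', AlgEquiv.symm_apply_eq] at h1
  exact h1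

theorem ax_der_div_prod {κ Ω ι : Type} [Field κ] [Field Ω] [Algebra κ Ω] (D : Derivation κ Ω Ω)
    (s : Finset ι) (f : ι → Ω) (hf : ∀ i ∈ s, f i ≠ 0) :
    D (∏ i ∈ s, f i) / ∏ i ∈ s, f i = ∑ i ∈ s, D (f i) / f i := by
  classical
  induction s using Finset.induction_on with
  | empty => simp
  | insert a s ha ih =>
    have h1 : f a ≠ 0 := hf a (Finset.mem_insert_self _ _)
    have h2 : ∏ i ∈ s, f i ≠ 0 := Finset.prod_ne_zero_iff.2 (fun i hi => hf i (Finset.mem_insert_of_mem hi))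
    rw [Finset.prod_insert ha, Finset.sum_insert ha, ← ih (fun i hi => hf i (Finset.mem_insert_of_mem hi))]
    rw [Derivation.leibniz]
    simp only [smul_eq_mul]
    field_simp
    ring

/-- Rosenlicht: if `Σ β_b dlog Q_b = 0` over `κ` with `β` independent over `ℤ`, all `Q_b` are
algebraic over `κ`. -/
theorem ax_rosenlicht {κ Ω ι : Type} [Field κ] [Field Ω] [CharZero κ] [Algebra κ Ω] [IsAlgClosed Ω]
    [Fintype ι] (β : ι → κ) (hβ : LinearIndependent ℤ β) (Q : ι → Ω) (hQ : ∀ b, Q b ≠ 0)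
    (h : ∀ D : Derivation κ Ω Ω, ∑ b, algebraMap κ Ω (β b) * (D (Q b) / Q b) = 0) (b₀ : ι) :
    IsAlgebraic κ (Q b₀) := by
  classical
  by_contra hz
  have hcz : CharZero Ω := charZero_of_injective_algebraMap (algebraMap κ Ω).injective
  set z := Q b₀ with hzdef
  obtain ⟨s, hs1, hs2⟩ := exists_isTranscendenceBasis_superset (R := κ) (s := {z})
    ((algebraicIndependent_singleton_iff (⟨z, rfl⟩ : ({z} : Set Ω))).2 hz)
  have hzs : z ∈ s := hs1 rfl
  obtain ⟨D, hD⟩ := ax_der_exists (κ := κ) (fun i : s => (i : Ω)) hs2 (fun i => if (i : Ω) = z then 1 else 0)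
  have hDz : D z = 1 := by simpa using hD ⟨z, hzs⟩
  let G : IntermediateField κ Ω := IntermediateField.adjoin κ (s \ {z})
  have hG : ∀ g ∈ G, D g = 0 := by
    intro c hc
    induction hc using IntermediateField.adjoin_induction with
    | mem y hy =>
      have h1 : y ≠ z := hy.2
      have h2 := hD ⟨y, hy.1⟩
      simp only [h1, if_false] at h2
      exact h2
    | algebraMap y => simp
    | add y z _ _ hy hz => simp [hy, hz]
    | inv y _ hy => simp [Derivation.leibniz_inv, hy]
    | mul y z _ _ hy hz => simp [Derivation.leibniz, hy, hz]
  have hGz : Transcendental G z := by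
    rw [IntermediateField.transcendental_adjoin_iff]
    have := AlgebraicIndependent.transcendental_adjoin hs2.1 (s := {i | (i : Ω) ≠ z}) (i := ⟨z, hzs⟩)
      (by simp)
    have he : ((fun i : s => (i : Ω)) '' {i | (i : Ω) ≠ z}) = s \ {z} := by
      ext x; simp [and_comm]
    rw [he] at this
    exact this
  let E : IntermediateField G Ω := IntermediateField.adjoin G {z}
  have hsE : ∀ x ∈ s, x ∈ E := by
    intro x hx
    by_cases hxz : x = z
    · rw [hxz]; exact IntermediateField.mem_adjoin_simple_self G z
    · have : x ∈ G := IntermediateField.subset_adjoin κ _ ⟨hx, hxz⟩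
      exact E.algebraMap_mem ⟨x, this⟩
  have hEalg : Algebra.IsAlgebraic E Ω := by
    constructor
    intro x
    have h1 : Algebra.IsAlgebraic (Algebra.adjoin κ (Set.range (fun i : s => (i : Ω)))) Ω := hs2.isAlgebraic
    have hle : Algebra.adjoin κ (Set.range (fun i : s => (i : Ω))) ≤ (E.restrictScalars κ).toSubalgebra := by
      rw [Algebra.adjoin_le_iff]
      rintro _ ⟨i, rfl⟩
      exact hsE _ i.2
    exact (h1.isAlgebraic x).tower_top_of_subalgebra_le hle
  let M : IntermediateField E Ω := IntermediateField.adjoin E (Set.range Q)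
  have hMfin : FiniteDimensional E M :=
    IntermediateField.finiteDimensional_adjoin (fun x _ => (hEalg.isAlgebraic x).isIntegral)
  have hQM : ∀ b, Q b ∈ M := fun b => IntermediateField.subset_adjoin E _ ⟨b, rfl⟩
  have hlift : ∀ σ : M →ₐ[E] Ω, ∃ τ : Ω ≃ₐ[κ] Ω, (∀ y ∈ E, τ y = y) ∧ ∀ y : M, τ y = σ y := by
    intro σ
    have hnorm : Normal E Ω := normal_iff.2 fun x => ⟨(hEalg.isAlgebraic x).isIntegral, IsAlgClosed.splits _⟩
    obtain ⟨φ, hφ⟩ := IntermediateField.exists_algHom_of_splits (F := E) (E := Ω) (K := Ω) (L := M)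
      (fun x => ⟨(hEalg.isAlgebraic x).isIntegral, IsAlgClosed.splits _⟩) σ
    have hbij := AlgHom.normal_bijective E Ω Ω φ
    have : IsScalarTower κ E Ω := IsScalarTower.of_algebraMap_eq fun x => rfl
    refine ⟨(AlgEquiv.ofBijective φ hbij).restrictScalars κ, ?_, ?_⟩
    · intro y hy
      exact φ.commutes ⟨y, hy⟩
    · intro y
      exact DFunLike.congr_fun hφ y
  -- sum over the embeddings
  let D' := axDerOver D G hG
  let N : ι → Ω := fun b => ∏ σ : M →ₐ[E] Ω, σ ⟨Q b, hQM b⟩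
  have hne : ∀ (σ : M →ₐ[E] Ω) b, σ ⟨Q b, hQM b⟩ ≠ 0 := by
    intro σ b h0
    rw [map_eq_zero] at h0
    exact hQ b (congrArg Subtype.val h0)
  have hN0 : ∀ b, N b ≠ 0 := fun b => Finset.prod_ne_zero_iff.2 (fun σ _ => hne σ b)
  have hNE : ∀ b, N b ∈ E := by
    intro b
    have := Algebra.norm_eq_prod_embeddings E Ω (⟨Q b, hQM b⟩ : M)
    change N b ∈ E
    have h2 : N b = algebraMap E Ω (Algebra.norm E (⟨Q b, hQM b⟩ : M)) := this.symm
    rw [h2]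
    exact (Algebra.norm E (⟨Q b, hQM b⟩ : M)).2
  have hβ' : LinearIndependent ℤ (fun b => algebraMap κ G (β b)) := by
    have := hβ.map' ((algebraMap κ G).toIntAlgHom.toLinearMap) (LinearMap.ker_eq_bot.2 (algebraMap κ G).injective)
    exact this
  refine ax_residue hGz D' hDz (fun b => algebraMap κ G (β b)) hβ' N hN0 hNE ?_ b₀
    (Fintype.card (M →ₐ[E] Ω)) (Fintype.card_pos_iff.2 ⟨M.val⟩) ?_
  · have h1 : ∀ σ : M →ₐ[E] Ω, ∑ b, algebraMap κ Ω (β b) *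
        (D (σ ⟨Q b, hQM b⟩) / σ ⟨Q b, hQM b⟩) = 0 := by
      intro σ
      obtain ⟨τ, hτ1, hτ2⟩ := hlift σ
      have h2 := congrArg τ (h D)
      rw [map_zero, map_sum] at h2
      rw [← h2]
      refine Finset.sum_congr rfl (fun b _ => ?_)
      rw [map_mul, map_div₀, AlgEquiv.commutes, ← hτ2]
      rw [ax_der_comm (fun i : s => (i : Ω)) hs2 D τ (fun i => hτ1 _ (hsE _ i.2))]
      intro i
      rw [hD]
      split_ifs <;> simp
    have h3 : ∀ b, D' (N b) / N b = ∑ σ : M →ₐ[E] Ω, D (σ ⟨Q b, hQM b⟩) / σ ⟨Q b, hQM b⟩ := by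
      intro b
      exact ax_der_div_prod D Finset.univ _ (fun σ _ => hne σ b)
    simp only [h3, Finset.mul_sum]
    rw [Finset.sum_comm]
    exact Finset.sum_eq_zero (fun σ _ => h1 σ)
  · have h1 : ∀ σ : M →ₐ[E] Ω, σ ⟨Q b₀, hQM b₀⟩ = z := by
      intro σ
      obtain ⟨τ, hτ1, hτ2⟩ := hlift σ
      rw [← hτ2]
      exact hτ1 z (hsE z hzs)
    change ∏ σ : M →ₐ[E] Ω, σ ⟨Q b₀, hQM b₀⟩ = _
    simp [h1, Finset.card_univ]

end

noncomputable section

theorem ax_der_div_zpow {κ Ω : Type} [Field κ] [Field Ω] [Algebra κ Ω] (D : Derivation κ Ω Ω)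
    (x : Ω) (hx : x ≠ 0) (k : ℤ) : D (x ^ k) / x ^ k = k * (D x / x) := by
  rw [Derivation.leibniz_zpow]
  simp only [zsmul_eq_mul, smul_eq_mul]
  rw [zpow_sub₀ hx, zpow_one]
  have : x ^ k ≠ 0 := zpow_ne_zero _ hx
  field_simp

theorem ax_der_div_monomial {κ Ω : Type} [Field κ] [Field Ω] [Algebra κ Ω] {n : ℕ}
    (D : Derivation κ Ω Ω) (P : Fin n → Ω) (hP : ∀ j, P j ≠ 0) (a : Fin n → ℤ) :
    D (∏ j, P j ^ a j) / ∏ j, P j ^ a j = ∑ j, (a j : Ω) * (D (P j) / P j) := by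
  rw [ax_der_div_prod D Finset.univ _ (fun j _ => zpow_ne_zero _ (hP j))]
  exact Finset.sum_congr rfl (fun j _ => ax_der_div_zpow D _ (hP j) _)

/-- Vector form of Rosenlicht. -/
theorem ax_rosenlicht_vec {κ Ω : Type} [Field κ] [Field Ω] [CharZero κ] [Algebra κ Ω] [IsAlgClosed Ω]
    {n : ℕ} (P : Fin n → Ω) (hP : ∀ j, P j ≠ 0) (w : Fin n → κ)
    (h : ∀ D : Derivation κ Ω Ω, ∑ j, algebraMap κ Ω (w j) * (D (P j) / P j) = 0) :
    w ∈ Submodule.span κ {v : Fin n → κ | ∃ a : Fin n → ℤ, (∀ j, v j = a j) ∧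
      IsAlgebraic κ (∏ j, P j ^ a j)} := by
  classical
  let S : Submodule ℤ κ := Submodule.span ℤ (Set.range w)
  have hfin : Module.Finite ℤ S := Module.Finite.span_of_finite ℤ (Set.finite_range w)
  have hfree : Module.Free ℤ S := Module.free_of_finite_type_torsion_free'
  let b := Module.Free.chooseBasis ℤ S
  let β : _ → κ := fun i => (b i : κ)
  have hβ : LinearIndependent ℤ β :=
    b.linearIndependent.map' S.subtype (Submodule.ker_subtype S)
  let ws : Fin n → S := fun j => ⟨w j, Submodule.subset_span ⟨j, rfl⟩⟩
  let q : _ → Fin n → ℤ := fun i j => b.repr (ws j) i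
  have hw : ∀ j, w j = ∑ i, (q i j : κ) * β i := by
    intro j
    have := congrArg S.subtype (b.sum_repr (ws j))
    rw [map_sum] at this
    rw [show w j = S.subtype (ws j) from rfl, ← this]
    refine Finset.sum_congr rfl (fun i _ => ?_)
    rw [map_smul, zsmul_eq_mul]; rfl
  have halg : ∀ i, IsAlgebraic κ (∏ j, P j ^ q i j) := by
    refine ax_rosenlicht β hβ (fun i => ∏ j, P j ^ q i j)
      (fun i => Finset.prod_ne_zero_iff.2 (fun j _ => zpow_ne_zero _ (hP j))) ?_
    intro D
    rw [← h D]
    simp only [ax_der_div_monomial D P hP, Finset.mul_sum]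
    rw [Finset.sum_comm]
    refine Finset.sum_congr rfl (fun j _ => ?_)
    rw [hw j, map_sum, Finset.sum_mul]
    refine Finset.sum_congr rfl (fun i _ => ?_)
    rw [map_mul, map_intCast]
    ring
  have : w = ∑ i, β i • (fun j => (q i j : κ)) := by
    ext j
    rw [hw j, Finset.sum_apply]
    exact Finset.sum_congr rfl (fun i _ => by simp [mul_comm])
  rw [this]
  exact Submodule.sum_mem _ (fun i _ => Submodule.smul_mem _ _
    (Submodule.subset_span ⟨q i, fun j => rfl, halg i⟩))

end

noncomputable section

theorem ax_omega_comm {κ Ω : Type} [Field κ] [Field Ω] [Algebra κ Ω] {n : ℕ}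
    (P : Fin n → Ω) (hP : ∀ j, P j ≠ 0) (u : Fin n → κ) (D E : Derivation κ Ω Ω)
    (hD : ∑ j, algebraMap κ Ω (u j) * (D (P j) / P j) = 0) :
    D (∑ j, algebraMap κ Ω (u j) * (E (P j) / P j)) =
      ∑ j, algebraMap κ Ω (u j) * (⁅D, E⁆ (P j) / P j) := by
  have h1 : E (∑ j, algebraMap κ Ω (u j) * (D (P j) / P j)) = 0 := by rw [hD, map_zero]
  rw [← sub_zero (D _), ← h1, map_sum, map_sum, ← Finset.sum_sub_distrib]
  refine Finset.sum_congr rfl (fun j _ => ?_)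
  have hj := hP j
  rw [Derivation.leibniz, Derivation.leibniz, Derivation.map_algebraMap, Derivation.map_algebraMap,
    Derivation.leibniz_div, Derivation.leibniz_div, Derivation.commutator_apply]
  simp only [smul_eq_mul]
  field_simp
  ring

theorem ax_core {κ Ω : Type} [Field κ] [Field Ω] [CharZero κ] [Algebra κ Ω] [IsAlgClosed Ω]
    {n r N : ℕ} (y : Fin N → Ω) (hy : IsTranscendenceBasis κ y) (P : Fin n → Ω)
    (hP : ∀ j, P j ≠ 0) (u : Fin r → Fin n → κ) (hu : LinearIndependent κ u)
    (hC : ∀ x : Ω, (∀ D : Derivation κ Ω Ω,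
      (∀ i, ∑ j, algebraMap κ Ω (u i j) * (D (P j) / P j) = 0) → D x = 0) →
      x ∈ Set.range (algebraMap κ Ω))
    (D₀ : Derivation κ Ω Ω) (hD₀ : ∀ i, ∑ j, algebraMap κ Ω (u i j) * (D₀ (P j) / P j) = 0)
    (hne : D₀ ≠ 0) :
    ∃ (l e : ℕ) (a : Fin e → Fin n → ℤ), l + 1 ≤ N ∧ r ≤ l + e ∧ LinearIndependent ℤ a ∧
      ∀ i, ∏ j, P j ^ a i j ∈ Set.range (algebraMap κ Ω) := by
  classical
  have hdual : ∀ k : Fin N, ∃ D : Derivation κ Ω Ω, ∀ i, D (y i) = if i = k then 1 else 0 := fun k =>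
    ax_der_exists y hy _
  choose E hE using hdual
  have hexp : ∀ D : Derivation κ Ω Ω, ∀ x, D x = ∑ k, D (y k) * E k x := by
    intro D x
    have : D - ∑ k, D (y k) • E k = 0 := by
      refine ax_der_ext y hy _ (fun i => ?_)
      rw [Derivation.sub_apply, ← Derivation.coeFnAddMonoidHom_apply (∑ k, D (y k) • E k), map_sum,
        Finset.sum_apply]
      simp [hE]
    have h2 := congrArg (fun F => F x) this
    simp only [Derivation.sub_apply] at h2
    rw [← Derivation.coeFnAddMonoidHom_apply (∑ k, D (y k) • E k), map_sum, Finset.sum_apply] at h2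
    simp at h2
    exact sub_eq_zero.1 h2
  let w : Fin r → Fin N → Ω := fun i k => ∑ j, algebraMap κ Ω (u i j) * (E k (P j) / P j)
  have hw : ∀ (i) (D : Derivation κ Ω Ω), ∑ j, algebraMap κ Ω (u i j) * (D (P j) / P j) =
      ∑ k, D (y k) * w i k := by
    intro i D
    simp only [w, Finset.mul_sum]
    rw [Finset.sum_comm]
    refine Finset.sum_congr rfl (fun j _ => ?_)
    rw [hexp D (P j), Finset.sum_div, Finset.mul_sum]
    exact Finset.sum_congr rfl (fun k _ => by ring)
  let W : Submodule Ω (Fin N → Ω) := Submodule.span Ω (Set.range w)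
  have hWlt : Module.finrank Ω W < N := by
    have h1 : W < ⊤ := by
      rw [lt_top_iff_ne_top]
      intro htop
      apply hne
      refine ax_der_ext y hy _ (fun k => ?_)
      let φ : (Fin N → Ω) →ₗ[Ω] Ω := ∑ k, D₀ (y k) • LinearMap.proj k
      have hφ : ∀ x, φ x = ∑ k, D₀ (y k) * x k := by
        intro x; simp [φ]
      have hWφ : W ≤ LinearMap.ker φ := by
        rw [Submodule.span_le]
        rintro _ ⟨i, rfl⟩
        simp only [SetLike.mem_coe, LinearMap.mem_ker]
        rw [hφ, ← hw, hD₀]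
      have h3 : φ (Pi.single k 1) = 0 := by
        have : Pi.single k (1 : Ω) ∈ W := by rw [htop]; trivial
        exact hWφ this
      rw [hφ] at h3
      simpa [Pi.single_apply] using h3
    have := Submodule.finrank_lt h1.ne
    simpa using this
  obtain ⟨J, s, hs, hspan, hLI⟩ := exists_linearIndependent' Ω w
  have hJfin : Finite J := Finite.of_injective s hs
  have : Fintype J := Fintype.ofFinite J
  have hJcard : Fintype.card J = Module.finrank Ω W := by
    rw [← finrank_span_eq_card hLI, hspan]
  have hf : ∀ i, ∃ f : J → Ω, ∑ c, f c • w (s c) = w i := by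
    intro i
    have : w i ∈ Submodule.span Ω (Set.range (w ∘ s)) := by
      rw [hspan]; exact Submodule.subset_span ⟨i, rfl⟩
    exact (Submodule.mem_span_range_iff_exists_fun Ω).1 this
  choose f hf using hf
  have hfk : ∀ i c, f i c ∈ Set.range (algebraMap κ Ω) := by
    intro i
    have key : ∀ D : Derivation κ Ω Ω,
        (∀ i, ∑ j, algebraMap κ Ω (u i j) * (D (P j) / P j) = 0) → ∀ c, D (f i c) = 0 := by
      intro D hD
      have hDw : ∀ i k, D (w i k) = ∑ k', ⁅D, E k⁆ (y k') * w i k' := by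
        intro i k
        rw [← hw, ← ax_omega_comm P hP (u i) D (E k) (hD i)]
      refine Fintype.linearIndependent_iff.1 hLI (fun c => D (f i c)) ?_
      ext k
      have h1 : D (w i k) = ∑ c, (D (f i c) * w (s c) k + f i c * D (w (s c) k)) := by
        conv_lhs => rw [← hf i]
        rw [Finset.sum_apply, map_sum]
        refine Finset.sum_congr rfl (fun c _ => ?_)
        rw [Pi.smul_apply, smul_eq_mul, Derivation.leibniz]
        simp only [smul_eq_mul]; ring
      have h2 : ∑ c, f i c * D (w (s c) k) = D (w i k) := by
        rw [hDw i k]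
        conv_rhs => rw [← hf i]
        simp only [hDw, Finset.sum_apply, Pi.smul_apply, smul_eq_mul, Finset.mul_sum]
        rw [Finset.sum_comm]
        exact Finset.sum_congr rfl (fun _ _ => Finset.sum_congr rfl (fun _ _ => by ring))
      rw [Finset.sum_add_distrib, h2] at h1
      simp only [Finset.sum_apply, Pi.smul_apply, smul_eq_mul, Function.comp, Pi.zero_apply]
      simpa using h1
    intro c
    exact hC _ (fun D hD => key D hD c)
  choose g hg using hfk
  let S : Set (Fin n → κ) := {v : Fin n → κ | ∃ a : Fin n → ℤ, (∀ j, v j = a j) ∧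
      IsAlgebraic κ (∏ j, P j ^ a j)}
  have hmem : ∀ i, u i - ∑ c, g i c • u (s c) ∈ Submodule.span κ S := by
    intro i
    refine ax_rosenlicht_vec P hP _ (fun D => ?_)
    have h1 : ∀ c, algebraMap κ Ω (g i c) = f i c := fun c => hg i c
    have : ∑ j, algebraMap κ Ω ((u i - ∑ c, g i c • u (s c)) j) * (D (P j) / P j) =
        ∑ j, algebraMap κ Ω (u i j) * (D (P j) / P j) -
          ∑ c, f i c * ∑ j, algebraMap κ Ω (u (s c) j) * (D (P j) / P j) := by
      simp only [Pi.sub_apply, Finset.sum_apply, Pi.smul_apply, smul_eq_mul, map_sub, map_sum, map_mul,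
        sub_mul, Finset.sum_sub_distrib, h1, Finset.mul_sum, Finset.sum_mul]
      congr 1
      rw [Finset.sum_comm]
      exact Finset.sum_congr rfl (fun _ _ => Finset.sum_congr rfl (fun _ _ => by ring))
    rw [this, hw]
    simp only [hw]
    rw [← hf i, sub_eq_zero]
    simp only [Finset.sum_apply, Pi.smul_apply, smul_eq_mul, Finset.mul_sum]
    rw [Finset.sum_comm]
    exact Finset.sum_congr rfl (fun _ _ => Finset.sum_congr rfl (fun _ _ => by ring))
  obtain ⟨b, hbS, hbspan, hbLI⟩ := exists_linearIndependent κ S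
  have hbfin : Finite b := hbLI.finite
  have : Fintype b := Fintype.ofFinite b
  have hr : r ≤ Fintype.card J + Fintype.card b := by
    have h1 : Submodule.span κ (Set.range u) ≤
        Submodule.span κ (Set.range (u ∘ s)) ⊔ Submodule.span κ S := by
      rw [Submodule.span_le]
      rintro _ ⟨i, rfl⟩
      have : u i = ∑ c, g i c • u (s c) + (u i - ∑ c, g i c • u (s c)) := by abel
      rw [SetLike.mem_coe, this]
      refine Submodule.add_mem_sup (Submodule.sum_mem _ fun c _ => Submodule.smul_mem _ _
        (Submodule.subset_span ⟨c, rfl⟩)) (hmem i)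
    have h2 := Submodule.finrank_mono h1
    rw [finrank_span_eq_card hu, Fintype.card_fin] at h2
    refine h2.trans ((Submodule.finrank_add_le_finrank_add_finrank _ _).trans ?_)
    refine add_le_add (finrank_range_le_card _) ?_
    rw [← hbspan]
    have := finrank_span_eq_card hbLI
    rw [Subtype.range_coe] at this
    exact this.le
  let eqv := (Fintype.equivFin b).symm
  have hb : ∀ i : b, ∃ a : Fin n → ℤ, (∀ j, (i : Fin n → κ) j = a j) ∧
      IsAlgebraic κ (∏ j, P j ^ a j) := fun i => hbS i.2
  choose A hA hAalg using hb
  refine ⟨Fintype.card J, Fintype.card b, fun i => A (eqv i), by omega, hr, ?_, ?_⟩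
  · have h1 : LinearIndependent ℤ A := by
      rw [Fintype.linearIndependent_iff]
      intro c hc i
      have h2 := Fintype.linearIndependent_iff.1 hbLI (fun i => (c i : κ)) (by
        ext j
        have := congrArg (fun v => ((v j : ℤ) : κ)) hc
        simp only [Finset.sum_apply, Pi.smul_apply, smul_eq_mul, Pi.zero_apply] at this ⊢
        push_cast at this
        simpa only [hA] using this) i
      exact_mod_cast h2
    exact h1.comp eqv eqv.injective
  · intro i
    refine hC _ (fun D hD => ?_)
    refine ax_der_zero_of_algebraic D (⊥ : IntermediateField κ Ω).toSubfield ?_ _ ?_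
    · rintro c ⟨x, rfl⟩
      exact D.map_algebraMap x
    · exact (hAalg (eqv i)).tower_top (K := κ) (⊥ : IntermediateField κ Ω)

theorem ax_main {κ Ω : Type} [Field κ] [Field Ω] [CharZero κ] [Algebra κ Ω] [IsAlgClosed Ω]
    {n r d : ℕ} (t : Fin d → Ω) (ht : IsTranscendenceBasis κ t) (P : Fin n → Ω)
    (hP : ∀ j, P j ≠ 0) (u : Fin r → Fin n → κ) (hu : LinearIndependent κ u)
    (hna : ∀ (e : ℕ) (a : Fin e → Fin n → ℤ), LinearIndependent ℤ a →
      ∃ (ρ : ℕ) (f : Fin ρ → Fin e), AlgebraicIndependent κ (fun i => ∏ j, P j ^ (a (f i) j)) ∧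
        (d ≤ ρ ∨ d + e ≤ r + ρ))
    (D : Derivation κ Ω Ω)
    (hD : ∀ i, ∑ j, algebraMap κ Ω (u i j) * (D (P j) / P j) = 0) : D = 0 := by
  classical
  by_contra hne
  let Δ : Derivation κ Ω Ω → Prop := fun D =>
    ∀ i, ∑ j, algebraMap κ Ω (u i j) * (D (P j) / P j) = 0
  let C : IntermediateField κ Ω :=
    { carrier := {x | ∀ D, Δ D → D x = 0}
      mul_mem' := fun {a b} ha hb D hD => by
        rw [Derivation.leibniz, ha D hD, hb D hD]; simp
      add_mem' := fun {a b} ha hb D hD => by rw [map_add, ha D hD, hb D hD, add_zero]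
      algebraMap_mem' := fun r D hD => D.map_algebraMap r
      inv_mem' := fun x hx D hD => by rw [Derivation.leibniz_inv, hx D hD]; simp }
  have hmem : ∀ x, x ∈ C ↔ ∀ D, Δ D → D x = 0 := fun x => Iff.rfl
  have htr : Algebra.trdeg κ C + Algebra.trdeg C Ω = d := by
    rw [_root_.trdeg_add_eq, ← ht.cardinalMk_eq_trdeg]; simp
  have hfin1 : Algebra.trdeg C Ω < Cardinal.aleph0 := 
    lt_of_le_of_lt (self_le_add_left _ _) (htr ▸ Cardinal.natCast_lt_aleph0)
  have hfin2 : Algebra.trdeg κ C < Cardinal.aleph0 := 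
    lt_of_le_of_lt (self_le_add_right _ _) (htr ▸ Cardinal.natCast_lt_aleph0)
  obtain ⟨N, hN⟩ := Cardinal.lt_aleph0.1 hfin1
  obtain ⟨m, hm⟩ := Cardinal.lt_aleph0.1 hfin2
  have hmN : m + N = d := by
    rw [hN, hm] at htr; exact_mod_cast htr
  obtain ⟨S, hS⟩ := exists_isTranscendenceBasis C Ω
  have hScard : Cardinal.mk S = N := by rw [← hN, hS.cardinalMk_eq_trdeg]
  obtain ⟨eqv⟩ := Cardinal.eq.1 (hScard.trans (Cardinal.mk_fin N).symm)
  have hy := hS.comp_equiv eqv.symm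
  have hu' : LinearIndependent C (fun i j => algebraMap κ C (u i j)) :=
    (linearIndependent_algebraMap_comp_iff).2 hu
  obtain ⟨l, e, a, hl, hr, ha, haC⟩ := ax_core (κ := C) _ hy P hP (fun i j => algebraMap κ C (u i j)) hu'
    (by
      intro x hx
      have : x ∈ C := by
        rw [hmem]
        intro D hD
        exact hx (axDerOver D C (fun g hg => hg D hD)) hD
      exact ⟨⟨x, this⟩, rfl⟩)
    (axDerOver D C (fun g hg => hg D hD)) hD
    (by
      intro h
      apply hne
      ext x
      exact congrArg (fun F : Derivation C Ω Ω => F x) h)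
  obtain ⟨ρ, f, hf, hρ⟩ := hna e a ha
  choose c hc using haC
  have hf2 : AlgebraicIndependent κ (fun i => c (f i)) := by
    have : (fun i => ∏ j, P j ^ (a (f i) j)) = (IsScalarTower.toAlgHom κ C Ω) ∘ (fun i => c (f i)) := by
      ext i; exact (hc (f i)).symm
    rw [this] at hf
    exact hf.of_comp
  have := hf2.cardinalMk_le_trdeg
  rw [hm, Cardinal.mk_fin] at this
  have : ρ ≤ m := by exact_mod_cast this
  omega

end

noncomputable section

theorem dft_bessel {E ι : Type} [NormedAddCommGroup E] [InnerProductSpace ℂ E] [FiniteDimensional ℂ E]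
    [Fintype ι] (e : ι → E) (he : Orthonormal ℂ e) (V : Submodule ℂ E)
    (h : ∀ l, ∃ m ∈ V, ‖e l - m‖ ≤ 1 / 2) :
    (3 / 4 : ℝ) * Fintype.card ι ≤ Module.finrank ℂ V := by
  classical
  let b := stdOrthonormalBasis ℂ V
  have h1 : ∀ l, (3 / 4 : ℝ) ≤ ∑ k, ‖inner ℂ (b k : E) (e l)‖ ^ 2 := by
    intro l
    have hb : ∀ k, inner ℂ (b k : E) (e l) = inner ℂ (b k) (V.orthogonalProjection (e l)) := by
      intro k
      rw [Submodule.inner_orthogonalProjection_eq_of_mem_left]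
    simp only [hb]
    rw [b.sum_sq_norm_inner_right]
    obtain ⟨m, hm, hd⟩ := h l
    have h2 := Submodule.norm_sq_eq_add_norm_sq_projection (e l) V
    have h3 : ‖Vᗮ.orthogonalProjection (e l)‖ ≤ 1 / 2 := by
      refine le_trans ?_ hd
      have : Vᗮ.orthogonalProjection (e l) = Vᗮ.orthogonalProjection (e l - m) := by
        rw [map_sub, Submodule.orthogonalProjection_orthogonal_apply_eq_zero hm, sub_zero]
      rw [this]
      exact Submodule.norm_orthogonalProjection_apply_le _ _
    rw [he.1 l] at h2
    nlinarith [norm_nonneg (Vᗮ.orthogonalProjection (e l))]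
  have h2 : ∀ k, ∑ l, ‖inner ℂ (b k : E) (e l)‖ ^ 2 ≤ 1 := by
    intro k
    have := he.sum_inner_products_le (b k : E) (s := Finset.univ)
    have hn : ‖(b k : E)‖ = 1 := b.orthonormal.1 k
    rw [hn] at this
    simp only [norm_inner_symm] at this ⊢
    simpa [norm_inner_symm] using this
  calc (3 / 4 : ℝ) * Fintype.card ι = ∑ l : ι, (3 / 4 : ℝ) := by simp [mul_comm]
    _ ≤ ∑ l, ∑ k, ‖inner ℂ (b k : E) (e l)‖ ^ 2 := Finset.sum_le_sum (fun l _ => h1 l)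
    _ = ∑ k, ∑ l, ‖inner ℂ (b k : E) (e l)‖ ^ 2 := Finset.sum_comm
    _ ≤ ∑ k : Fin (Module.finrank ℂ V), (1 : ℝ) := Finset.sum_le_sum (fun k _ => h2 k)
    _ = _ := by simp

def dftVec (d B : ℕ) (l : Fin d → ℕ) : EuclideanSpace ℂ (Fin d → Fin B) :=
  WithLp.toLp 2 fun s => ∏ i, Complex.exp (2 * Real.pi * Complex.I * ((l i : ℂ) * (s i : ℕ) / B))

theorem dft_geom (B : ℕ) (hB : 0 < B) (x y : ℕ) (hx : x < B) (hy : y < B) :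
    ∑ s : Fin B, (starRingEnd ℂ) (Complex.exp (2 * Real.pi * Complex.I * ((x : ℂ) * (s : ℕ) / B))) *
      Complex.exp (2 * Real.pi * Complex.I * ((y : ℂ) * (s : ℕ) / B)) = if x = y then (B : ℂ) else 0 := by
  have hB0 : (B : ℂ) ≠ 0 := by exact_mod_cast hB.ne'
  have h : ∀ s : Fin B, (starRingEnd ℂ) (Complex.exp (2 * Real.pi * Complex.I * ((x : ℂ) * (s : ℕ) / B))) *
      Complex.exp (2 * Real.pi * Complex.I * ((y : ℂ) * (s : ℕ) / B)) =
      (Complex.exp (2 * Real.pi * Complex.I * (((y : ℂ) - x) / B))) ^ (s : ℕ) := by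
    intro s
    rw [← Complex.exp_conj, ← Complex.exp_add, ← Complex.exp_nat_mul]
    congr 1
    simp [map_ofNat]
    field_simp
    ring
  simp only [h]
  rw [Fin.sum_univ_eq_sum_range (fun s => (Complex.exp (2 * Real.pi * Complex.I * (((y : ℂ) - x) / B))) ^ s)]
  split_ifs with hxy
  · subst hxy; simp
  · have hne : Complex.exp (2 * Real.pi * Complex.I * (((y : ℂ) - x) / B)) ≠ 1 := by
      intro h1
      rw [Complex.exp_eq_one_iff] at h1
      obtain ⟨k, hk⟩ := h1
      have hpi : (2 * Real.pi * Complex.I : ℂ) ≠ 0 := Complex.two_pi_I_ne_zero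
      have h2 : ((y : ℂ) - x) / B = k := by
        apply mul_left_cancel₀ hpi; rw [hk]; ring
      rw [div_eq_iff hB0] at h2
      have h3 : (y : ℤ) - x = k * B := by exact_mod_cast h2
      have h4 : k = 0 := by
        by_contra hk0
        have : (B : ℤ) ≤ |k * B| := by
          rw [abs_mul, Nat.abs_cast]
          nlinarith [Int.one_le_abs hk0]
        rw [← h3, le_abs] at this
        omega
      rw [h4] at h3; omega
    rw [geom_sum_eq hne, ← Complex.exp_nat_mul]
    have : Complex.exp ((B : ℂ) * (2 * Real.pi * Complex.I * (((y : ℂ) - x) / B))) = 1 := by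
      rw [Complex.exp_eq_one_iff]
      refine ⟨(y : ℤ) - x, ?_⟩
      push_cast; field_simp
    rw [this]; simp

theorem dft_inner (d B : ℕ) (hB : 0 < B) (l l' : Fin d → ℕ) (hl : ∀ i, l i < B) (hl' : ∀ i, l' i < B) :
    inner ℂ (dftVec d B l) (dftVec d B l') = if l = l' then (B : ℂ) ^ d else 0 := by
  classical
  simp only [PiLp.inner_apply, dftVec, RCLike.inner_apply, map_prod]
  have : ∀ s : Fin d → Fin B, 
    (∏ i, Complex.exp (2 * Real.pi * Complex.I * ((l' i : ℂ) * (s i : ℕ) / B))) *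
    (∏ i, (starRingEnd ℂ) (Complex.exp (2 * Real.pi * Complex.I * ((l i : ℂ) * (s i : ℕ) / B)))) 
     = ∏ i, ((starRingEnd ℂ) (Complex.exp (2 * Real.pi * Complex.I * ((l i : ℂ) * (s i : ℕ) / B))) *
      Complex.exp (2 * Real.pi * Complex.I * ((l' i : ℂ) * (s i : ℕ) / B))) := by
    intro s
    rw [mul_comm, Finset.prod_mul_distrib]
  simp only [this]
  rw [← Fintype.prod_sum (fun i (k : Fin B) => ((starRingEnd ℂ) (Complex.exp (2 * Real.pi * Complex.I * ((l i : ℂ) * (k : ℕ) / B))) *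
      Complex.exp (2 * Real.pi * Complex.I * ((l' i : ℂ) * (k : ℕ) / B))))]
  simp only [dft_geom B hB _ _ (hl _) (hl' _)]
  split_ifs with h
  · subst h; simp
  · obtain ⟨i, hi⟩ := Function.ne_iff.1 h
    exact Finset.prod_eq_zero (Finset.mem_univ i) (if_neg hi)


/-- rounded combination vector -/
def dftRound {d n : ℕ} (u : Fin d → Fin n → ℝ) (s : Fin d → ℕ) : Fin n → ℤ :=
  fun j => round (∑ i, (s i : ℝ) * u i j)

theorem dft_main {d n : ℕ} (u : Fin d → Fin n → ℝ) (y0 : Fin n → ℂ) (hy0 : ∀ j, y0 j ≠ 0)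
    (Y : Set (Fin n → ℂ))
    (hpts : ∀ δ' : ℝ, 0 < δ' → ∃ δ : ℝ, 0 < δ ∧ ∀ ζ : Fin d → ℂ, (∀ i, ‖ζ i‖ < δ) →
      ∃ η : Fin n → ℂ, (∀ j, ‖η j‖ < δ') ∧ (∀ i, ∑ j, (u i j : ℂ) * η j = ζ i) ∧
        (fun j => y0 j * Complex.exp (η j)) ∈ Y) :
    ∃ c : ℝ, 0 < c ∧ ∀ (B : ℕ) (V : Submodule ℂ ((Fin d → Fin B) → ℂ)), 0 < B →
      (∀ y ∈ Y, (fun s : Fin d → Fin B => ∏ j, y j ^ dftRound u (fun i => (s i : ℕ)) j) ∈ V) →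
      c * (B : ℝ) ^ d ≤ Module.finrank ℂ V := by
  classical
  obtain ⟨δ, hδ, hpt⟩ := hpts (1 / (2 * ((n : ℝ) + 1))) (by positivity)
  let c0 : ℝ := min 1 (δ / (2 * Real.pi))
  have hc0 : 0 < c0 := lt_min one_pos (by positivity)
  refine ⟨3 / 4 * c0 ^ d, by positivity, ?_⟩
  intro B V hB hV
  have hBR : (0 : ℝ) < B := by exact_mod_cast hB
  let m : ℕ := ⌈c0 * B⌉₊
  have hmB : m ≤ B := by
    refine Nat.ceil_le.2 ?_
    have : c0 ≤ 1 := min_le_left _ _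
    nlinarith
  have hm : c0 * B ≤ m := Nat.le_ceil _
  have hml : ∀ l : ℕ, l < m → (l : ℝ) < c0 * B := fun l hl => Nat.lt_ceil.1 hl
  have hex : ∀ l : Fin d → Fin m, ∃ η : Fin n → ℂ, (∀ j, ‖η j‖ < 1 / (2 * ((n : ℝ) + 1))) ∧
      (∀ i, ∑ j, (u i j : ℂ) * η j = 2 * Real.pi * Complex.I * (((l i : ℕ) : ℂ) / B)) ∧
        (fun j => y0 j * Complex.exp (η j)) ∈ Y := by
    intro l
    refine hpt _ (fun i => ?_)
    have h1 := hml _ (l i).2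
    have h2 : c0 ≤ δ / (2 * Real.pi) := min_le_right _ _
    have hpi := Real.pi_pos
    rw [norm_mul, norm_mul, norm_mul, norm_div]
    simp only [Complex.norm_ofNat, Complex.norm_real, Real.norm_eq_abs, abs_of_pos hpi,
      Complex.norm_I, mul_one, Complex.norm_natCast]
    calc 2 * Real.pi * (((l i : ℕ) : ℝ) / B) < 2 * Real.pi * c0 := by
            gcongr
            rw [div_lt_iff₀ hBR]; exact h1
      _ ≤ 2 * Real.pi * (δ / (2 * Real.pi)) := by gcongr
      _ = δ := by field_simp
  choose η hη1 hη2 hη3 using hex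
  let ys : (Fin d → Fin B) → ℂ := fun s => ∏ j, y0 j ^ dftRound u (fun i => (s i : ℕ)) j
  have hys : ∀ s, ys s ≠ 0 := fun s => Finset.prod_ne_zero_iff.2 (fun j _ => zpow_ne_zero _ (hy0 j))
  -- rescaling
  let Φ : ((Fin d → Fin B) → ℂ) →ₗ[ℂ] EuclideanSpace ℂ (Fin d → Fin B) :=
    (WithLp.linearEquiv 2 ℂ ((Fin d → Fin B) → ℂ)).symm.toLinearMap ∘ₗ
      (LinearMap.pi fun s => ((ys s)⁻¹ * ((Real.sqrt ((B : ℝ) ^ d) : ℝ) : ℂ)⁻¹) • LinearMap.proj s)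
  have hΦ : ∀ v s, (Φ v) s = (ys s)⁻¹ * ((Real.sqrt ((B : ℝ) ^ d) : ℝ) : ℂ)⁻¹ * v s := by
    intro v s; rfl
  have hsq : 0 < Real.sqrt ((B : ℝ) ^ d) := Real.sqrt_pos.2 (by positivity)
  let e : (Fin d → Fin m) → EuclideanSpace ℂ (Fin d → Fin B) := fun l =>
    ((Real.sqrt ((B : ℝ) ^ d) : ℝ) : ℂ)⁻¹ • dftVec d B (fun i => (l i : ℕ))
  have he : Orthonormal ℂ e := by
    rw [orthonormal_iff_ite]
    intro l l'
    simp only [e, inner_smul_left, inner_smul_right]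
    rw [dft_inner d B hB _ _ (fun i => (l i).2.trans_le hmB) (fun i => (l' i).2.trans_le hmB)]
    have h1 : ((fun i => (l i : ℕ)) = fun i => (l' i : ℕ)) ↔ l = l' := by
      constructor
      · intro h; ext i; exact congrFun h i
      · rintro rfl; rfl
    simp only [h1]
    split_ifs with h
    · have h2 : ((Real.sqrt ((B : ℝ) ^ d) : ℝ) : ℂ) * ((Real.sqrt ((B : ℝ) ^ d) : ℝ) : ℂ) = (B : ℂ) ^ d := by
        rw [← Complex.ofReal_mul, Real.mul_self_sqrt (by positivity)]; push_cast; rfl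
      rw [← h2]
      simp only [map_inv₀, Complex.conj_ofReal]
      have : ((Real.sqrt ((B : ℝ) ^ d) : ℝ) : ℂ) ≠ 0 := by exact_mod_cast hsq.ne'
      field_simp
    · simp
  have key := dft_bessel e he (V.map Φ) (by
    intro l
    refine ⟨Φ (fun s => ∏ j, (y0 j * Complex.exp (η l j)) ^ dftRound u (fun i => (s i : ℕ)) j),
      Submodule.mem_map_of_mem (hV _ (hη3 l)), ?_⟩
    have hval : ∀ s, ∏ j, (y0 j * Complex.exp (η l j)) ^ dftRound u (fun i => (s i : ℕ)) j =
        ys s * (dftVec d B (fun i => (l i : ℕ)) s *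
          Complex.exp (∑ j, ((dftRound u (fun i => (s i : ℕ)) j : ℂ) -
            (∑ i, ((s i : ℕ) : ℂ) * (u i j : ℂ))) * η l j)) := by
      intro s
      simp only [mul_zpow, Finset.prod_mul_distrib]
      congr 1
      simp only [dftVec]
      rw [← Complex.exp_sum, ← Complex.exp_add]
      simp only [← Complex.exp_int_mul]
      rw [← Complex.exp_sum]
      congr 1
      simp only [sub_mul, Finset.sum_sub_distrib]
      have : ∑ j, (∑ i, ((s i : ℕ) : ℂ) * (u i j : ℂ)) * η l j =
          ∑ i, 2 * Real.pi * Complex.I * (((l i : ℕ) : ℂ) * ((s i : ℕ) : ℂ) / B) := by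
        simp only [Finset.sum_mul]
        rw [Finset.sum_comm]
        refine Finset.sum_congr rfl (fun i _ => ?_)
        have := hη2 l i
        calc ∑ j, ((s i : ℕ) : ℂ) * (u i j : ℂ) * η l j = ((s i : ℕ) : ℂ) * ∑ j, (u i j : ℂ) * η l j := by
              rw [Finset.mul_sum]; exact Finset.sum_congr rfl (fun _ _ => by ring)
          _ = _ := by rw [this]; ring
      rw [this]; ring
    have hsmall : ∀ s, ‖1 - Complex.exp (∑ j, ((dftRound u (fun i => ((s : Fin d → Fin B) i : ℕ)) j : ℂ) -
            (∑ i, ((s i : ℕ) : ℂ) * (u i j : ℂ))) * η l j)‖ ≤ 1 / 2 := by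
      intro s
      have h1 : ‖∑ j, ((dftRound u (fun i => ((s : Fin d → Fin B) i : ℕ)) j : ℂ) -
            (∑ i, ((s i : ℕ) : ℂ) * (u i j : ℂ))) * η l j‖ ≤ 1 / 4 := by
        calc _ ≤ ∑ j : Fin n, (1 / 2 : ℝ) * (1 / (2 * ((n : ℝ) + 1))) := by
              refine norm_sum_le_of_le _ (fun j _ => ?_)
              rw [norm_mul]
              refine mul_le_mul ?_ (hη1 l j).le (norm_nonneg _) (by norm_num)
              have : ((dftRound u (fun i => (s i : ℕ)) j : ℂ) - (∑ i, ((s i : ℕ) : ℂ) * (u i j : ℂ))) =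
                  (((dftRound u (fun i => (s i : ℕ)) j : ℝ) - (∑ i, ((s i : ℕ) : ℝ) * (u i j : ℝ)) : ℝ) : ℂ) := by
                push_cast; rfl
              rw [this, Complex.norm_real, Real.norm_eq_abs, abs_sub_comm]
              exact abs_sub_round _
          _ = (n : ℝ) / ((n : ℝ) + 1) * (1 / 4) := by
              simp; field_simp; norm_num
          _ ≤ 1 / 4 := by
              have : (n : ℝ) / ((n : ℝ) + 1) ≤ 1 := by
                rw [div_le_one (by positivity)]; linarith
              linarith
      rw [norm_sub_rev]
      refine (Complex.norm_exp_sub_one_le (h1.trans (by norm_num))).trans ?_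
      linarith
    have hdn : ∀ s, ‖dftVec d B (fun i => (l i : ℕ)) s‖ = 1 := by
      intro s
      simp only [dftVec, norm_prod]
      refine Finset.prod_eq_one (fun i _ => ?_)
      have : (2 * Real.pi * Complex.I * (((l i : ℕ) : ℂ) * ((s i : ℕ) : ℂ) / B)) =
        ((2 * Real.pi * (((l i : ℕ) : ℝ) * ((s i : ℕ) : ℝ) / B) : ℝ) : ℂ) * Complex.I := by
          push_cast; ring
      rw [this, Complex.norm_exp_ofReal_mul_I]
    rw [EuclideanSpace.norm_eq]
    refine Real.sqrt_le_iff.2 ⟨by norm_num, ?_⟩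
    have hcomp : ∀ s : Fin d → Fin B, ‖(e l - Φ (fun s => ∏ j, (y0 j * Complex.exp (η l j)) ^
        dftRound u (fun i => (s i : ℕ)) j)) s‖ ^ 2 ≤ ((B : ℝ) ^ d)⁻¹ * (1 / 2) ^ 2 := by
      intro s
      rw [PiLp.sub_apply, hΦ, hval]
      have h1 : e l s = ((Real.sqrt ((B : ℝ) ^ d) : ℝ) : ℂ)⁻¹ * dftVec d B (fun i => (l i : ℕ)) s := rfl
      have h2 : ∀ E : ℂ, e l s - (ys s)⁻¹ * ((Real.sqrt ((B : ℝ) ^ d) : ℝ) : ℂ)⁻¹ *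
          (ys s * (dftVec d B (fun i => (l i : ℕ)) s * E)) =
          ((Real.sqrt ((B : ℝ) ^ d) : ℝ) : ℂ)⁻¹ * dftVec d B (fun i => (l i : ℕ)) s * (1 - E) := by
        intro E
        rw [h1]
        have := hys s
        field_simp
      rw [h2, norm_mul, norm_mul, hdn, mul_one, mul_pow, norm_inv, Complex.norm_real, Real.norm_eq_abs,
        abs_of_pos hsq, inv_pow, Real.sq_sqrt (by positivity)]
      gcongr
      exact hsmall s
    calc _ ≤ ∑ s : Fin d → Fin B, ((B : ℝ) ^ d)⁻¹ * (1 / 2) ^ 2 := Finset.sum_le_sum (fun s _ => hcomp s)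
      _ = (1 / 2) ^ 2 := by
        simp [Finset.card_univ]
        field_simp)
  have hle := Submodule.finrank_map_le Φ V
  have hle' : (Module.finrank ℂ (V.map Φ) : ℝ) ≤ Module.finrank ℂ V := by exact_mod_cast hle
  refine le_trans ?_ (key.trans hle')
  simp only [Fintype.card_fun, Fintype.card_fin]
  push_cast
  rw [mul_assoc, ← mul_pow]
  gcongr

end

noncomputable section

/-- Laurent monomial in units -/
def lmon {A : Type} [CommRing A] {n : ℕ} (x : Fin n → Aˣ) (a : Fin n → ℤ) : Aˣ := ∏ j, x j ^ a j

theorem lmon_add {A : Type} [CommRing A] {n : ℕ} (x : Fin n → Aˣ) (a b : Fin n → ℤ) :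
    lmon x (a + b) = lmon x a * lmon x b := by
  simp [lmon, zpow_add, Finset.prod_mul_distrib]

theorem lmon_zero {A : Type} [CommRing A] {n : ℕ} (x : Fin n → Aˣ) : lmon x 0 = 1 := by
  simp [lmon]

theorem lmon_neg {A : Type} [CommRing A] {n : ℕ} (x : Fin n → Aˣ) (a : Fin n → ℤ) :
    lmon x (-a) = (lmon x a)⁻¹ := by
  simp [lmon]

theorem lmon_smul {A : Type} [CommRing A] {n : ℕ} (x : Fin n → Aˣ) (m : ℤ) (a : Fin n → ℤ) :
    lmon x (m • a) = (lmon x a) ^ m := by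
  rw [lmon, lmon, ← Finset.prod_zpow]
  refine Finset.prod_congr rfl (fun j _ => ?_)
  rw [Pi.smul_apply, smul_eq_mul, mul_comm, zpow_mul]

theorem lmon_single {A : Type} [CommRing A] {n : ℕ} (x : Fin n → Aˣ) (j : Fin n) :
    lmon x (Pi.single j 1) = x j := by
  classical
  rw [lmon, Finset.prod_eq_single j]
  · simp
  · intro b _ hb; simp [Pi.single_eq_of_ne hb]
  · simp

def hilbW {k A : Type} [Field k] [CommRing A] [Algebra k A] {d m : ℕ} (y : Fin d → A) (e : Fin m → A)
    (N : ℕ) : Submodule k A :=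
  Submodule.span k (Set.range fun p : (Fin d → Fin (N + 1)) × Fin m => (∏ i, y i ^ (p.1 i : ℕ)) * e p.2)

theorem hilbW_mem {k A : Type} [Field k] [CommRing A] [Algebra k A] {d m : ℕ} (y : Fin d → A)
    (e : Fin m → A) (N : ℕ) (c : Fin d → ℕ) (hc : ∀ i, c i ≤ N) (l : Fin m) :
    (∏ i, y i ^ c i) * e l ∈ hilbW (k := k) y e N :=
  Submodule.subset_span ⟨(fun i => ⟨c i, Nat.lt_succ_of_le (hc i)⟩, l), rfl⟩

theorem hilbW_mono {k A : Type} [Field k] [CommRing A] [Algebra k A] {d m : ℕ} (y : Fin d → A)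
    (e : Fin m → A) : Monotone (hilbW (k := k) y e) := by
  intro N N' h
  refine Submodule.span_le.2 ?_
  rintro _ ⟨p, rfl⟩
  exact hilbW_mem y e N' _ (fun i => (Nat.lt_succ_iff.1 (p.1 i).2).trans h) _

theorem hilbW_mul {k A : Type} [Field k] [CommRing A] [Algebra k A] {d m : ℕ} (y : Fin d → A)
    (e : Fin m → A) (g : A) (D : ℕ) (hg : ∀ l, g * e l ∈ hilbW (k := k) y e D) (N : ℕ) (z : A)
    (hz : z ∈ hilbW (k := k) y e N) : g * z ∈ hilbW (k := k) y e (N + D) := by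
  induction hz using Submodule.span_induction with
  | mem z hz =>
    obtain ⟨p, rfl⟩ := hz
    have key : ∀ w ∈ hilbW (k := k) y e D, (∏ i, y i ^ (p.1 i : ℕ)) * w ∈ hilbW (k := k) y e (N + D) := by
      intro w hw
      induction hw using Submodule.span_induction with
      | mem w hw =>
        obtain ⟨q, rfl⟩ := hw
        simp only
        rw [← mul_assoc, ← Finset.prod_mul_distrib]
        simp only [← pow_add]
        exact hilbW_mem y e _ _ (fun i => add_le_add (Nat.lt_succ_iff.1 (p.1 i).2)
          (Nat.lt_succ_iff.1 (q.1 i).2)) _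
      | zero => simp
      | add a b _ _ ha hb => rw [mul_add]; exact Submodule.add_mem _ ha hb
      | smul c a _ ha => rw [mul_smul_comm]; exact Submodule.smul_mem _ _ ha
    have := key _ (hg p.2)
    simp only
    rwa [mul_left_comm]
  | zero => simp
  | add a b _ _ ha hb => rw [mul_add]; exact Submodule.add_mem _ ha hb
  | smul c a _ ha => rw [mul_smul_comm]; exact Submodule.smul_mem _ _ ha

theorem hilbW_finrank {k A : Type} [Field k] [CommRing A] [Algebra k A] {d m : ℕ} (y : Fin d → A)
    (e : Fin m → A) (N : ℕ) : Module.finrank k (hilbW (k := k) y e N) ≤ (N + 1) ^ d * m := by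
  refine (finrank_range_le_card _).trans ?_
  simp

theorem hilbert_bound {k A : Type} [Field k] [CommRing A] [IsDomain A] [Algebra k A]
    [Algebra.FiniteType k A] {d n : ℕ} (htr : Algebra.trdeg k A = d) (x : Fin n → Aˣ) :
    ∃ C : ℕ, ∀ T : ℕ, 1 ≤ T →
      Module.finrank k (Submodule.span k {z : A | ∃ a : Fin n → ℤ, (∀ j, |a j| ≤ T) ∧ z = lmon x a}) ≤
        C * T ^ d := by
  classical
  obtain ⟨s, g, hg, hfin⟩ := exists_finite_inj_algHom_of_fg k A
  let : Algebra (MvPolynomial (Fin s) k) A := g.toRingHom.toAlgebra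
  have hmapg : ∀ p, algebraMap (MvPolynomial (Fin s) k) A p = g p := fun p => rfl
  have hst : IsScalarTower k (MvPolynomial (Fin s) k) A := IsScalarTower.of_algebraMap_eq (fun c => by
    rw [hmapg]; exact (g.commutes c).symm)
  have hfin' : Module.Finite (MvPolynomial (Fin s) k) A := hfin
  have hfs : FaithfulSMul (MvPolynomial (Fin s) k) A :=
    (faithfulSMul_iff_algebraMap_injective _ _).2 hg
  have hsd : s = d := by
    have h1 := trdeg_add_eq k (MvPolynomial (Fin s) k) (A := A)
    rw [htr, MvPolynomial.trdeg_of_isDomain, _root_.trdeg_eq_zero] at h1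
    simpa using h1
  subst hsd
  obtain ⟨m, e, he⟩ := Module.Finite.exists_fin (R := MvPolynomial (Fin s) k) (M := A)
  let y : Fin s → A := fun i => g (MvPolynomial.X i)
  have hgm : ∀ (p : MvPolynomial (Fin s) k) (l), g p * e l ∈ hilbW (k := k) y e p.totalDegree := by
    intro p l
    conv => enter [2, 1]; rw [p.as_sum]
    rw [map_sum, Finset.sum_mul]
    refine Submodule.sum_mem _ (fun c hc => ?_)
    have : g (MvPolynomial.monomial c (p.coeff c)) = p.coeff c • ∏ i, y i ^ c i := by
      rw [MvPolynomial.monomial_eq, map_mul, Finsupp.prod_fintype _ _ (by simp), map_prod,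
        Algebra.smul_def]
      congr 1
      · exact g.commutes _
      · simp [y]
    rw [this, smul_mul_assoc]
    refine Submodule.smul_mem _ _ (hilbW_mem y e _ _ (fun i => ?_) l)
    refine le_trans ?_ (MvPolynomial.le_totalDegree hc)
    rw [Finsupp.sum_fintype _ _ (by simp)]
    exact Finset.single_le_sum (f := fun i => c i) (fun _ _ => Nat.zero_le _) (Finset.mem_univ i)
  have hall : ∀ z : A, ∃ N, z ∈ hilbW (k := k) y e N := by
    intro z
    have hz : z ∈ Submodule.span (MvPolynomial (Fin s) k) (Set.range e) := by rw [he]; trivial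
    obtain ⟨c, hc⟩ := (Submodule.mem_span_range_iff_exists_fun _).1 hz
    refine ⟨∑ l, (c l).totalDegree, ?_⟩
    rw [← hc]
    refine Submodule.sum_mem _ (fun l _ => ?_)
    rw [Algebra.smul_def, hmapg]
    exact hilbW_mono y e (Finset.single_le_sum (f := fun l => (c l).totalDegree)
      (fun _ _ => Nat.zero_le _) (Finset.mem_univ l)) (hgm (c l) l)
  choose Nf hNf using hall
  let D : ℕ := Nf 1 + ∑ j, ∑ l, (Nf (x j * e l) + Nf (((x j)⁻¹ : Aˣ) * e l))
  have hD1 : Nf 1 ≤ D := Nat.le_add_right _ _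
  have hD : ∀ j l, Nf (x j * e l) + Nf (((x j)⁻¹ : Aˣ) * e l) ≤ D := by
    intro j l
    refine le_trans ?_ (Nat.le_add_left _ _)
    refine le_trans ?_ (Finset.single_le_sum (f := fun j => ∑ l, (Nf (x j * e l) + Nf (((x j)⁻¹ : Aˣ) * e l)))
      (fun _ _ => Nat.zero_le _) (Finset.mem_univ j))
    exact Finset.single_le_sum (f := fun l => (Nf (x j * e l) + Nf (((x j)⁻¹ : Aˣ) * e l)))
      (fun _ _ => Nat.zero_le _) (Finset.mem_univ l)
  have hpow : ∀ (j) (c : ℕ) (N : ℕ) (z : A), z ∈ hilbW (k := k) y e N →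
      (x j : A) ^ c * z ∈ hilbW (k := k) y e (N + c * D) ∧
      (((x j)⁻¹ : Aˣ) : A) ^ c * z ∈ hilbW (k := k) y e (N + c * D) := by
    intro j c
    induction c with
    | zero => intro N z hz; simpa using hz
    | succ c ih =>
      intro N z hz
      obtain ⟨h1, h2⟩ := ih N z hz
      rw [pow_succ', pow_succ', mul_assoc, mul_assoc, Nat.succ_mul, ← add_assoc]
      refine ⟨hilbW_mul y e _ D (fun l => hilbW_mono y e ?_ (hNf _)) _ _ h1,
        hilbW_mul y e _ D (fun l => hilbW_mono y e ?_ (hNf _)) _ _ h2⟩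
      · have := hD j l; omega
      · have := hD j l; omega
  have hzpow : ∀ (j) (c : ℤ) (T N : ℕ) (z : A), |c| ≤ T → z ∈ hilbW (k := k) y e N →
      ((x j ^ c : Aˣ) : A) * z ∈ hilbW (k := k) y e (N + T * D) := by
    intro j c T N z hc hz
    rcases Int.eq_nat_or_neg c with ⟨c', rfl | rfl⟩
    · have h := (hpow j c' N z hz).1
      rw [zpow_natCast, Units.val_pow_eq_pow_val]
      refine hilbW_mono y e ?_ h
      have : c' ≤ T := by simpa using hc
      gcongr
    · have h := (hpow j c' N z hz).2
      rw [zpow_neg, zpow_natCast, ← inv_pow, Units.val_pow_eq_pow_val]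
      refine hilbW_mono y e ?_ h
      have : c' ≤ T := by simpa using hc
      gcongr
  have hmon : ∀ (T : ℕ) (a : Fin n → ℤ), (∀ j, |a j| ≤ T) →
      (lmon x a : A) ∈ hilbW (k := k) y e (D + n * (T * D)) := by
    intro T a ha
    have : ∀ S : Finset (Fin n), ((∏ j ∈ S, x j ^ a j : Aˣ) : A) ∈
        hilbW (k := k) y e (D + S.card * (T * D)) := by
      intro S
      induction S using Finset.induction_on with
      | empty => simpa using hilbW_mono y e hD1 (hNf 1)
      | insert j S hj ih =>
        rw [Finset.prod_insert hj, Finset.card_insert_of_notMem hj, Nat.succ_mul, ← add_assoc,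
          Units.val_mul]
        exact hzpow j _ T _ _ (ha j) ih
    have h := this Finset.univ
    rw [Finset.card_univ, Fintype.card_fin] at h
    exact h
  refine ⟨(D + n * D + 1) ^ s * m, fun T hT => ?_⟩
  have hle : Submodule.span k {z : A | ∃ a : Fin n → ℤ, (∀ j, |a j| ≤ T) ∧ z = lmon x a} ≤
      hilbW (k := k) y e (D + n * (T * D)) := by
    rw [Submodule.span_le]
    rintro _ ⟨a, ha, rfl⟩
    exact hmon T a ha
  have hfd : Module.Finite k (hilbW (k := k) y e (D + n * (T * D))) :=
    Module.Finite.span_of_finite k (Set.finite_range _)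
  refine (Submodule.finrank_mono hle).trans ((hilbW_finrank y e _).trans ?_)
  rw [mul_right_comm, ← mul_pow]
  gcongr
  nlinarith [Nat.zero_le (n * D), Nat.zero_le D]

end

noncomputable section

theorem dftRound_bound {d n : ℕ} (u : Fin d → Fin n → ℝ) (U : ℕ) (hU : ∀ j, ∑ i, |u i j| ≤ U) (B : ℕ)
    (s : Fin d → ℕ) (hs : ∀ i, s i ≤ B) (j : Fin n) : |dftRound u s j| ≤ ((B * U + 1 : ℕ) : ℤ) := by
  have h1 : |∑ i, (s i : ℝ) * u i j| ≤ B * U := by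
    calc |∑ i, (s i : ℝ) * u i j| ≤ ∑ i, |(s i : ℝ) * u i j| := Finset.abs_sum_le_sum_abs _ _
      _ ≤ ∑ i, (B : ℝ) * |u i j| := by
          refine Finset.sum_le_sum (fun i _ => ?_)
          rw [abs_mul, Nat.abs_cast]
          gcongr
          exact_mod_cast hs i
      _ = B * ∑ i, |u i j| := by rw [Finset.mul_sum]
      _ ≤ B * U := by gcongr; exact hU j
  have h2 := abs_sub_round (∑ i, (s i : ℝ) * u i j)
  have h3 : |(dftRound u s j : ℝ)| ≤ B * U + 1 := by
    rw [abs_le] at *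
    simp only [dftRound]
    constructor <;> linarith [h1.1, h1.2, h2.1, h2.2]
  exact_mod_cast h3

theorem rel_exists {k A : Type} [Field k] [CommRing A] [IsDomain A] [Algebra k A]
    [Algebra.FiniteType k A] {d n : ℕ} (htr : Algebra.trdeg k A = d) (x : Fin n → Aˣ)
    (u : Fin d → Fin n → ℝ) (c : ℝ) (hc : 0 < c)
    (hlow : ∀ B : ℕ, 0 < B → c * (B : ℝ) ^ d ≤ Module.finrank k (Submodule.span k
      (Set.range fun s : Fin d → Fin B => (lmon x (dftRound u (fun i => (s i : ℕ))) : A)))) :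
    ∃ J : ℕ, 1 ≤ J ∧ ∀ M : ℕ, 1 ≤ M → ∀ p : Fin n, ∃ (J' : ℕ) (cc : ℕ → (Fin d → Fin (J * M)) → k),
      ∑ i ∈ Finset.range (J' + 1), (∑ s, cc i s • (lmon x (dftRound u (fun i => (s i : ℕ))) : A)) *
        (x p : A) ^ (i * M) = 0 ∧
      ∑ s, cc J' s • (lmon x (dftRound u (fun i => (s i : ℕ))) : A) ≠ 0 := by
  classical
  obtain ⟨C, hC⟩ := hilbert_bound htr x
  obtain ⟨U, hU⟩ := exists_nat_ge (∑ j, ∑ i, |u i j|)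
  have hU' : ∀ j, ∑ i, |u i j| ≤ U := fun j => le_trans
    (Finset.single_le_sum (f := fun j => ∑ i, |u i j|) (fun j _ => Finset.sum_nonneg fun _ _ => abs_nonneg _)
      (Finset.mem_univ j)) hU
  obtain ⟨J, hJ⟩ := exists_nat_gt ((C : ℝ) * ((U : ℝ) + 2) ^ d / c)
  have hJ1 : 1 ≤ J := by
    rcases Nat.eq_zero_or_pos J with h | h
    · subst h
      have : (0 : ℝ) ≤ (C : ℝ) * ((U : ℝ) + 2) ^ d / c := by positivity
      push_cast at hJ
      linarith
    · exact h
  refine ⟨J, hJ1, fun M hM p => ?_⟩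
  set B := J * M with hB
  have hB0 : 0 < B := Nat.mul_pos hJ1 hM
  let E : Submodule k A := Submodule.span k
      (Set.range fun s : Fin d → Fin B => (lmon x (dftRound u (fun i => (s i : ℕ))) : A))
  have hE : Module.Finite k E := Module.Finite.span_of_finite k (Set.finite_range _)
  let T : ℕ := B * (U + 2)
  let S : Set A := {z : A | ∃ a : Fin n → ℤ, (∀ j, |a j| ≤ T) ∧ z = lmon x a}
  have hSfin : S.Finite := by
    have : (Set.Icc (fun _ : Fin n => -(T : ℤ)) (fun _ => (T : ℤ))).Finite := Set.finite_Icc _ _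
    refine (this.image (fun a => (lmon x a : A))).subset ?_
    rintro _ ⟨a, ha, rfl⟩
    exact ⟨a, ⟨fun j => (abs_le.1 (ha j)).1, fun j => (abs_le.1 (ha j)).2⟩, rfl⟩
  let H : Submodule k A := Submodule.span k S
  have hH : Module.Finite k H := Module.Finite.span_of_finite k hSfin
  let Ψ : (Fin J → E) →ₗ[k] A :=
    ∑ i : Fin J, (LinearMap.mulRight k ((x p : A) ^ ((i : ℕ) * M))) ∘ₗ E.subtype ∘ₗ LinearMap.proj i
  have hΨ : ∀ f, Ψ f = ∑ i : Fin J, (f i : A) * (x p : A) ^ ((i : ℕ) * M) := by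
    intro f; simp [Ψ]
  have hmem : ∀ f, Ψ f ∈ H := by
    intro f
    rw [hΨ]
    refine Submodule.sum_mem _ (fun i _ => ?_)
    have : ∀ z ∈ E, z * (x p : A) ^ ((i : ℕ) * M) ∈ H := by
      intro z hz
      induction hz using Submodule.span_induction with
      | mem z hz =>
        obtain ⟨s, rfl⟩ := hz
        refine Submodule.subset_span ⟨dftRound u (fun i => (s i : ℕ)) + (((i : ℕ) * M : ℕ) : ℤ) • Pi.single p 1,
          fun j => ?_, ?_⟩
        · rw [Pi.add_apply, Pi.smul_apply]
          refine (abs_add_le _ _).trans ?_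
          have h1 := dftRound_bound u U hU' B (fun i => (s i : ℕ)) (fun i => (s i).2.le) j
          have h2 : |(((i : ℕ) * M : ℕ) : ℤ) • (Pi.single p (1 : ℤ) : Fin n → ℤ) j| ≤ (((i : ℕ) * M : ℕ) : ℤ) := by
            rw [smul_eq_mul, abs_mul, Nat.abs_cast]
            have : |(Pi.single p (1 : ℤ) : Fin n → ℤ) j| ≤ 1 := by
              rw [Pi.single_apply]; split_ifs <;> simp
            nlinarith [Nat.zero_le ((i : ℕ) * M), (Int.natCast_nonneg ((i : ℕ) * M))]
          have h3 : (i : ℕ) * M ≤ B := Nat.mul_le_mul_right _ i.2.le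
          have h4 : B * U + 1 + (i : ℕ) * M ≤ T := by
            simp only [T]; nlinarith
          have h5 : ((B * U + 1 : ℕ) : ℤ) + (((i : ℕ) * M : ℕ) : ℤ) ≤ (T : ℤ) := by exact_mod_cast h4
          linarith
        · rw [lmon_add, lmon_smul, lmon_single, zpow_natCast]; simp
      | zero => simp
      | add a b _ _ ha hb => rw [add_mul]; exact Submodule.add_mem _ ha hb
      | smul c a _ ha => rw [smul_mul_assoc]; exact Submodule.smul_mem _ _ ha
    exact this _ (f i).2
  have hninj : ¬ Function.Injective Ψ := by
    intro hinj
    have h1 : Module.finrank k (Fin J → E) ≤ Module.finrank k H := by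
      refine LinearMap.finrank_le_finrank_of_injective (f := Ψ.codRestrict H hmem) ?_
      intro f g hfg
      exact hinj (congrArg Subtype.val hfg)
    rw [Module.finrank_pi_fintype, Finset.sum_const, Finset.card_univ, Fintype.card_fin, smul_eq_mul] at h1
    have h2 : Module.finrank k H ≤ C * T ^ d := hC T (Nat.mul_pos hB0 (by omega))
    have h3 : (J : ℝ) * Module.finrank k E ≤ C * (T : ℝ) ^ d := by exact_mod_cast h1.trans h2
    have h4 : c * (B : ℝ) ^ d ≤ Module.finrank k E := hlow B hB0
    rw [div_lt_iff₀ hc] at hJ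
    have h5 : (0 : ℝ) < (B : ℝ) ^ d := by positivity
    have h6 : (T : ℝ) ^ d = (B : ℝ) ^ d * ((U : ℝ) + 2) ^ d := by
      simp only [T]; push_cast; rw [mul_pow]
    have h7 : (J : ℝ) * (c * (B : ℝ) ^ d) ≤ C * ((B : ℝ) ^ d * ((U : ℝ) + 2) ^ d) := by
      rw [← h6]; refine le_trans ?_ h3; gcongr
    nlinarith
  have : ∃ f : Fin J → E, Ψ f = 0 ∧ f ≠ 0 := by
    by_contra! hcon
    exact hninj ((injective_iff_map_eq_zero Ψ).2 hcon)
  obtain ⟨f, hf0, hfne⟩ := this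
  rw [hΨ] at hf0
  have hrep : ∀ i : ℕ, ∃ ci : (Fin d → Fin B) → k, ∑ s, ci s • (lmon x (dftRound u (fun i => (s i : ℕ))) : A) =
      if h : i < J then (f ⟨i, h⟩ : A) else 0 := by
    intro i
    split_ifs with h
    · exact (Submodule.mem_span_range_iff_exists_fun k).1 (f ⟨i, h⟩).2
    · exact ⟨0, by simp⟩
  choose cc hcc using hrep
  let g : ℕ → A := fun i => if h : i < J then (f ⟨i, h⟩ : A) else 0
  let J' := Nat.findGreatest (fun i => g i ≠ 0) J
  obtain ⟨i0, hi0⟩ := Function.ne_iff.1 hfne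
  have hgi0 : g i0 ≠ 0 := by
    simp only [g, dif_pos i0.2]
    intro h; exact hi0 (Subtype.ext h)
  have hJ' : g J' ≠ 0 := Nat.findGreatest_spec (P := fun i => g i ≠ 0) i0.2.le hgi0
  have hJlt : J' < J := by
    by_contra h
    exact hJ' (by simp only [g, dif_neg h])
  refine ⟨J', cc, ?_, by rw [hcc]; exact hJ'⟩
  have h1 : ∑ i : Fin J, (f i : A) * (x p : A) ^ ((i : ℕ) * M) = ∑ i ∈ Finset.range J, g i * (x p : A) ^ (i * M) := by
    rw [← Fin.sum_univ_eq_sum_range (fun i => g i * (x p : A) ^ (i * M))]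
    refine Finset.sum_congr rfl (fun i _ => ?_)
    simp [g]
  rw [h1] at hf0
  refine Eq.trans (b := ∑ i ∈ Finset.range (J' + 1), g i * (x p : A) ^ (i * M))
    (Finset.sum_congr rfl (fun i _ => by rw [hcc i])) ?_
  refine Eq.trans ?_ hf0
  refine Finset.sum_subset (Finset.range_mono hJlt) (fun i hi hi' => ?_)
  have : g i = 0 := by
    by_contra h
    have := Nat.le_findGreatest (P := fun i => g i ≠ 0) (Finset.mem_range.1 hi).le h
    rw [Finset.mem_range] at hi'
    simp only [J'] at hi'
    omega
  rw [this, zero_mul]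

end

noncomputable section

/-- A spanning, algebraically independent family over a bigger field is a transcendence basis. -/
theorem tb_of_mem {F E Ω ι ι' : Type} [Field F] [Field E] [Field Ω] [Algebra F E] [Algebra E Ω]
    [Algebra F Ω] [IsScalarTower F E Ω] (v : ι → Ω) (hv : IsTranscendenceBasis F v)
    (t : ι' → Ω) (h : ∀ i, v i ∈ Algebra.adjoin E (Set.range t)) :
    Algebra.IsAlgebraic (Algebra.adjoin E (Set.range t)) Ω := by
  let B := Algebra.adjoin E (Set.range t)
  have : IsScalarTower F B Ω := IsScalarTower.of_algebraMap_eq (fun x => by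
    rw [IsScalarTower.algebraMap_apply F E Ω, IsScalarTower.algebraMap_apply F E B]; rfl)
  rw [hv.isAlgebraic_iff (S := B)]
  intro s
  exact isAlgebraic_algebraMap (⟨v s, h s⟩ : B)

/-- Over a countable field, a countable set of complex numbers lies in a subfield over which `ℂ` has
a transcendence basis of any prescribed finite size. -/
theorem gen_basis {k : Type} [Field k] [Countable k] [Algebra k ℂ] (U : Set ℂ) (hU : U.Countable)
    (d : ℕ) : ∃ κ : IntermediateField k ℂ, U ⊆ κ ∧ ∃ t : Fin d → ℂ, IsTranscendenceBasis κ t := by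
  let κ0 := IntermediateField.adjoin k U
  have hc0 : Cardinal.mk κ0 ≤ Cardinal.aleph0 := by
    have : Countable U := hU
    have h := IntermediateField.lift_cardinalMk_adjoin_le k U
    simp only [Cardinal.lift_id] at h
    refine h.trans ?_
    simp only [sup_le_iff]
    refine ⟨⟨?_, ?_⟩, le_rfl⟩
    · exact Cardinal.mk_le_aleph0
    · exact Cardinal.mk_le_aleph0
  obtain ⟨S, hS⟩ := exists_isTranscendenceBasis κ0 ℂ
  have hinf : Infinite S := by
    have h1 := IsAlgClosed.cardinal_eq_cardinal_transcendence_basis_of_aleph0_lt' _ hS hc0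
      (by rw [Cardinal.mk_complex]; exact Cardinal.aleph0_lt_continuum)
    rw [Cardinal.infinite_iff, ← h1, Cardinal.mk_complex]
    exact Cardinal.aleph0_le_continuum
  let f : Fin d ↪ S := (Fin.valEmbedding).trans (Infinite.natEmbedding S)
  let W : Set ℂ := (Subtype.val) '' (Set.range f)ᶜ
  let κ1 := IntermediateField.adjoin κ0 W
  have hai : AlgebraicIndependent κ1 (fun i => (f i : ℂ)) := by
    rw [IntermediateField.algebraicIndependent_adjoin_iff]
    have h := ((AlgebraicIndependent.iff_adjoin_image_compl (Set.range f)).1 hS.1).2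
    have h2 := h.comp (fun i : Fin d => (⟨f i, Set.mem_range_self i⟩ : Set.range f))
      (fun i j hij => f.injective (by simpa using hij))
    exact h2
  have hb : IsTranscendenceBasis κ1 (fun i => (f i : ℂ)) := by
    rw [isTranscendenceBasis_iff_algebraicIndependent_isAlgebraic]
    refine ⟨hai, ?_⟩
    refine tb_of_mem (F := κ0) _ hS _ (fun s => ?_)
    let B := Algebra.adjoin κ1 (Set.range (fun i => (f i : ℂ)))
    have hs : (s : ℂ) ∈ B := by
      by_cases h : s ∈ Set.range f
      · obtain ⟨i, rfl⟩ := h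
        exact Algebra.subset_adjoin ⟨i, rfl⟩
      · have : (s : ℂ) ∈ κ1 := IntermediateField.subset_adjoin _ _ ⟨s, h, rfl⟩
        exact B.algebraMap_mem ⟨s, this⟩
    exact hs
  refine ⟨κ1.restrictScalars k, ?_, _, hb⟩
  intro x hx
  have : x ∈ κ0 := IntermediateField.subset_adjoin _ _ hx
  exact κ1.algebraMap_mem ⟨x, this⟩

/-- Embedding of a domain in an algebraically closed field with prescribed images of a transcendence
basis. -/
theorem gen_embed {k A Ω ι : Type} [Field k] [CommRing A] [IsDomain A] [Algebra k A] [Field Ω]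
    [IsAlgClosed Ω] [Algebra k Ω] (b : ι → A) (hb : IsTranscendenceBasis k b)
    (t : ι → Ω) (ht : AlgebraicIndependent k t) :
    ∃ φ : A →ₐ[k] Ω, Function.Injective φ ∧ ∀ i, φ (b i) = t i := by
  let : Algebra (MvPolynomial ι k) A := (MvPolynomial.aeval b).toAlgebra
  let : Algebra (MvPolynomial ι k) Ω := (MvPolynomial.aeval t).toAlgebra
  have hmA : ∀ p, algebraMap (MvPolynomial ι k) A p = MvPolynomial.aeval b p := fun p => rfl
  have hmO : ∀ p, algebraMap (MvPolynomial ι k) Ω p = MvPolynomial.aeval t p := fun p => rfl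
  have : IsScalarTower k (MvPolynomial ι k) A := IsScalarTower.of_algebraMap_eq (fun x => by
    rw [hmA, MvPolynomial.algebraMap_eq, MvPolynomial.aeval_C])
  have : IsScalarTower k (MvPolynomial ι k) Ω := IsScalarTower.of_algebraMap_eq (fun x => by
    rw [hmO, MvPolynomial.algebraMap_eq, MvPolynomial.aeval_C])
  have hinjA : Function.Injective (algebraMap (MvPolynomial ι k) A) := hb.1
  have hinjO : Function.Injective (algebraMap (MvPolynomial ι k) Ω) := ht
  have : FaithfulSMul (MvPolynomial ι k) A := (faithfulSMul_iff_algebraMap_injective _ _).2 hinjA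
  have : FaithfulSMul (MvPolynomial ι k) Ω := (faithfulSMul_iff_algebraMap_injective _ _).2 hinjO
  have halg : Algebra.IsAlgebraic (MvPolynomial ι k) A := by
    have h1 : Algebra.IsAlgebraic (Algebra.adjoin k (Set.range b)) A := hb.isAlgebraic
    constructor
    intro x
    obtain ⟨p, hp0, hp⟩ := h1.isAlgebraic x
    refine ⟨p.map (hb.1.aevalEquiv.symm : _ →+* MvPolynomial ι k), ?_, ?_⟩
    · rwa [Ne, Polynomial.map_eq_zero_iff]
      exact hb.1.aevalEquiv.symm.injective
    · rw [Polynomial.aeval_def, Polynomial.eval₂_map]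
      rw [Polynomial.aeval_def] at hp
      convert hp using 2
      ext a
      obtain ⟨b, rfl⟩ := hb.1.aevalEquiv.surjective a
      simp [hmA]
  let φ : A →ₐ[MvPolynomial ι k] Ω := IsAlgClosed.lift
  refine ⟨φ.restrictScalars k, ?_, ?_⟩
  · change Function.Injective φ
    rw [injective_iff_map_eq_zero]
    intro a ha
    by_contra h0
    obtain ⟨q, hq0, z, hz⟩ := (halg.isAlgebraic a).exists_nonzero_dvd
      (mem_nonZeroDivisors_of_ne_zero h0)
    have h2 : φ (algebraMap _ _ q) = 0 := by rw [hz, map_mul, ha, zero_mul]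
    rw [AlgHom.commutes] at h2
    exact hq0 (hinjO (by rw [h2, map_zero]))
  · intro i
    have h := φ.commutes (MvPolynomial.X i)
    rw [hmA, hmO, MvPolynomial.aeval_X, MvPolynomial.aeval_X] at h
    exact h

/-- Under such an embedding algebraic independence over `k` is preserved, even over a larger field
over which the basis stays a basis. -/
theorem gen_indep {k κ A Ω ι : Type} [Field k] [Field κ] [CommRing A] [IsDomain A] [Algebra k A]
    [Field Ω] [Algebra k Ω] [Algebra k κ] [Algebra κ Ω] [IsScalarTower k κ Ω] {d : ℕ}
    (b : Fin d → A) (hb : IsTranscendenceBasis k b) (φ : A →ₐ[k] Ω) (hφ : Function.Injective φ)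
    (ht : IsTranscendenceBasis κ (fun i => φ (b i)))
    (z : ι → A) (hz : AlgebraicIndependent k z) : AlgebraicIndependent κ (fun i => φ (z i)) := by
  obtain ⟨s, hzs, hs⟩ := exists_isTranscendenceBasis_superset hz.to_subtype_range
  have hcard : Cardinal.mk s = d := by
    rw [hs.cardinalMk_eq_trdeg, ← hb.cardinalMk_eq_trdeg]; simp
  have hfin : Finite s := by
    rw [← Cardinal.mk_lt_aleph0_iff, hcard]; exact Cardinal.natCast_lt_aleph0
  have htr : Algebra.trdeg κ Ω = d := by rw [← ht.cardinalMk_eq_trdeg]; simp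
  let B := Algebra.adjoin κ (Set.range (fun x : s => φ x))
  have halg : Algebra.IsAlgebraic B Ω := by
    rw [ht.isAlgebraic_iff (S := B)]
    intro i
    obtain ⟨p, hp0, hp⟩ := hs.isAlgebraic.isAlgebraic (b i)
    have hmem : ∀ x : Algebra.adjoin k (Set.range (Subtype.val : s → A)), φ x ∈ B := by
      rintro ⟨x, hx⟩
      induction hx using Algebra.adjoin_induction with
      | mem x hx => obtain ⟨y, rfl⟩ := hx; exact Algebra.subset_adjoin ⟨y, rfl⟩
      | algebraMap r =>
        change φ (algebraMap k A r) ∈ B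
        rw [φ.commutes, IsScalarTower.algebraMap_apply k κ Ω]; exact B.algebraMap_mem _
      | add x y _ _ hx hy =>
        change φ (x + y) ∈ B
        rw [map_add]; exact B.add_mem hx hy
      | mul x y _ _ hx hy =>
        change φ (x * y) ∈ B
        rw [map_mul]; exact B.mul_mem hx hy
    let g : Algebra.adjoin k (Set.range (Subtype.val : s → A)) →+* B :=
      RingHom.codRestrict ((φ : A →+* Ω).comp (algebraMap _ A)) B hmem
    have hg : Function.Injective g := by
      intro x y hxy
      have : φ x = φ y := congrArg Subtype.val hxy
      exact Subtype.ext (hφ this)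
    refine ⟨p.map g, by rwa [Ne, Polynomial.map_eq_zero_iff hg], ?_⟩
    rw [Polynomial.aeval_def, Polynomial.eval₂_map]
    have := congrArg φ hp
    rw [map_zero, Polynomial.aeval_def, ← AlgHom.coe_toRingHom, Polynomial.hom_eval₂] at this
    exact this
  have hbas : IsTranscendenceBasis κ (fun x : s => φ x) :=
    Algebra.IsAlgebraic.isTranscendenceBasis_of_le_trdeg_of_finite κ _ (by rw [hcard, htr])
  exact hbas.1.comp (fun i : ι => (⟨z i, hzs ⟨i, rfl⟩⟩ : s)) (fun i j hij => hz.injective (by simpa using hij))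

end

noncomputable section

/-- evaluation of a polynomial in `θ` with coefficients polynomials in `t` -/
def evt {k : Type} [Field k] [Algebra k ℂ] {d : ℕ} (t : Fin d → ℂ) (θ : ℂ) :
    Polynomial (MvPolynomial (Fin d) k) →+* ℂ :=
  Polynomial.eval₂RingHom (MvPolynomial.aeval t : MvPolynomial (Fin d) k →ₐ[k] ℂ).toRingHom θ

theorem evt_C {k : Type} [Field k] [Algebra k ℂ] {d : ℕ} (t : Fin d → ℂ) (θ : ℂ)
    (q : MvPolynomial (Fin d) k) : evt t θ (Polynomial.C q) = MvPolynomial.aeval t q := by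
  simp [evt]

theorem evt_X {k : Type} [Field k] [Algebra k ℂ] {d : ℕ} (t : Fin d → ℂ) (θ : ℂ) :
    evt (k := k) t θ Polynomial.X = θ := by
  simp [evt]

/-- primitive element data -/
theorem prim_data {k : Type} [Field k] [CharZero k] [Algebra k ℂ] {d : ℕ}
    (t : Fin d → ℂ) (ht : AlgebraicIndependent k t) (s : Finset ℂ)
    (hs : ∀ z ∈ s, IsAlgebraic (Algebra.adjoin k (Set.range t)) z) :
    ∃ (θ : ℂ) (G : Polynomial (MvPolynomial (Fin d) k)), evt t θ G = 0 ∧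
      evt t θ (Polynomial.derivative G) ≠ 0 ∧ (∀ H, evt t θ H = 0 → G ∣ H) ∧
      ∀ z ∈ s, ∃ (q : MvPolynomial (Fin d) k) (H : Polynomial (MvPolynomial (Fin d) k)),
        q ≠ 0 ∧ z * MvPolynomial.aeval t q = evt t θ H := by
  let R := MvPolynomial (Fin d) k
  let : Algebra R ℂ := (MvPolynomial.aeval t).toAlgebra
  have hmap : ∀ p, algebraMap R ℂ p = MvPolynomial.aeval t p := fun p => rfl
  have : IsScalarTower k R ℂ := IsScalarTower.of_algebraMap_eq (fun x => by
    rw [hmap, MvPolynomial.algebraMap_eq, MvPolynomial.aeval_C])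
  have hinj : Function.Injective (algebraMap R ℂ) := ht
  have : FaithfulSMul R ℂ := (faithfulSMul_iff_algebraMap_injective _ _).2 hinj
  have hsR : ∀ z ∈ s, IsAlgebraic R z := by
    intro x hx
    obtain ⟨p, hp0, hp⟩ := hs x hx
    refine ⟨p.map (ht.aevalEquiv.symm : _ →+* MvPolynomial (Fin d) k), ?_, ?_⟩
    · rwa [Ne, Polynomial.map_eq_zero_iff]
      exact ht.aevalEquiv.symm.injective
    · rw [Polynomial.aeval_def, Polynomial.eval₂_map]
      rw [Polynomial.aeval_def] at hp
      convert hp using 2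
      ext a
      obtain ⟨b, rfl⟩ := ht.aevalEquiv.surjective a
      simp [hmap]
  let F := FractionRing R
  let : Algebra F ℂ := FractionRing.liftAlgebra _ _
  have : IsScalarTower R F ℂ := FractionRing.isScalarTower_liftAlgebra _ _
  have : CharZero F := charZero_of_injective_algebraMap (R := k) (algebraMap k F).injective
  have hsF : ∀ z ∈ (s : Set ℂ), IsIntegral F z := fun z hz =>
    ((hsR z hz).extendScalars (IsFractionRing.injective R F)).isIntegral
  let E := IntermediateField.adjoin F (s : Set ℂ)
  have : FiniteDimensional F E := IntermediateField.finiteDimensional_adjoin hsF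
  obtain ⟨α, hα⟩ := Field.exists_primitive_element F E
  have hαF : IsAlgebraic F (α : ℂ) :=
    (Algebra.IsAlgebraic.isAlgebraic (R := F) α).algebraMap (A := ℂ)
  have hαR : IsAlgebraic R (α : ℂ) := (IsFractionRing.isAlgebraic_iff R F ℂ).2 hαF
  obtain ⟨y, hy0, hyi⟩ := hαR.exists_integral_multiple
  let θ : ℂ := y • (α : ℂ)
  have hθ : IsIntegral R θ := hyi
  have hθF : IsIntegral F θ := hθ.tower_top
  have hmem : ∀ z ∈ s, z ∈ Algebra.adjoin F {θ} := by
    intro z hz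
    have h1 : (⟨z, IntermediateField.subset_adjoin _ _ hz⟩ : E) ∈ IntermediateField.adjoin F {α} := by
      rw [hα]; trivial
    have h2 : z ∈ IntermediateField.adjoin F {(α : ℂ)} := by
      have := IntermediateField.adjoin_map F {α} E.val
      rw [Set.image_singleton] at this
      have h3 : z ∈ (IntermediateField.adjoin F {α}).map E.val := ⟨_, h1, rfl⟩
      rw [this] at h3
      exact h3
    have h3 : (α : ℂ) ∈ IntermediateField.adjoin F {θ} := by
      have hy : algebraMap R F y ≠ 0 := by
        rw [Ne, IsFractionRing.to_map_eq_zero_iff]; exact hy0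
      have : (α : ℂ) = (algebraMap R F y)⁻¹ • θ := by
        change (α : ℂ) = (algebraMap R F y)⁻¹ • y • (α : ℂ)
        rw [← IsScalarTower.algebraMap_smul F y (α : ℂ), inv_smul_smul₀ hy]
      rw [this]
      exact IntermediateField.smul_mem _ (IntermediateField.mem_adjoin_simple_self F θ)
    have h4 : z ∈ IntermediateField.adjoin F {θ} :=
      (IntermediateField.adjoin_simple_le_iff.2 h3) h2
    rw [← IntermediateField.mem_toSubalgebra,
      IntermediateField.adjoin_simple_toSubalgebra_of_isAlgebraic hθF.isAlgebraic] at h4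
    exact h4
  have hevt : ∀ H : Polynomial R, evt t θ H = Polynomial.aeval θ H := fun H => rfl
  let G : Polynomial R := minpoly R θ
  have hGm : G.Monic := minpoly.monic hθ
  have hdvd : ∀ H, evt t θ H = 0 → G ∣ H := fun H hH => by
    rw [hevt] at hH
    exact minpoly.isIntegrallyClosed_dvd hθ hH
  refine ⟨θ, G, minpoly.aeval R θ, ?_, hdvd, ?_⟩
  · intro h
    have h1 := hdvd _ h
    have hdeg : 0 < G.natDegree := minpoly.natDegree_pos hθ
    have h0 : Polynomial.derivative G ≠ 0 := by
      have : CharZero R := charZero_of_injective_algebraMap (R := k) (algebraMap k R).injective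
      intro h0
      have := Polynomial.natDegree_eq_zero_of_derivative_eq_zero h0
      omega
    have h2 := Polynomial.degree_le_of_dvd h1 h0
    have h3 := Polynomial.degree_derivative_lt hGm.ne_zero
    exact absurd (lt_of_lt_of_le h3 h2) (lt_irrefl _)
  · intro z hz
    have h1 := hmem z hz
    rw [Algebra.adjoin_singleton_eq_range_aeval] at h1
    obtain ⟨p, hp⟩ := h1
    obtain ⟨⟨q, hq⟩, hqp⟩ := IsLocalization.integerNormalization_map_to_map (nonZeroDivisors R) p
    refine ⟨q, IsLocalization.integerNormalization (nonZeroDivisors R) p,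
      nonZeroDivisors.ne_zero hq, ?_⟩
    rw [hevt, ← Polynomial.aeval_map_algebraMap F, hqp]
    change z * algebraMap R ℂ q = Polynomial.aeval θ (q • p)
    rw [← IsScalarTower.algebraMap_smul F q p, map_smul,
      IsScalarTower.algebraMap_smul F q, Algebra.smul_def, mul_comm, ← hp]
    rfl

/-- points of `A` near a generic one, parametrised by an etale cover of affine space -/
theorem etale_data {k A : Type} [Field k] [CharZero k] [Algebra k ℂ] [CommRing A] [Algebra k A]
    [Algebra.FiniteType k A] {d : ℕ}
    (t : Fin d → ℂ) (ht : AlgebraicIndependent k t) (φ : A →ₐ[k] ℂ)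
    (hs : ∀ a, IsAlgebraic (Algebra.adjoin k (Set.range t)) (φ a)) :
    ∃ (θ : ℂ) (G : Polynomial (MvPolynomial (Fin d) k)) (Q : MvPolynomial (Fin d) k),
      evt t θ G = 0 ∧ evt t θ (Polynomial.derivative G) ≠ 0 ∧ MvPolynomial.aeval t Q ≠ 0 ∧
      (∀ a, ∃ (H : Polynomial (MvPolynomial (Fin d) k)) (m : ℕ),
        φ a * MvPolynomial.aeval t Q ^ m = evt t θ H) ∧
      ∀ (t' : Fin d → ℂ) (θ' : ℂ), evt t' θ' G = 0 → MvPolynomial.aeval t' Q ≠ 0 →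
        ∃ ψ : A →ₐ[k] ℂ, ∀ (a : A) (H : Polynomial (MvPolynomial (Fin d) k)) (m : ℕ), φ a * MvPolynomial.aeval t Q ^ m = evt t θ H →
          ψ a * MvPolynomial.aeval t' Q ^ m = evt t' θ' H := by
  classical
  obtain ⟨gens, hgens⟩ := ‹Algebra.FiniteType k A›.out
  obtain ⟨θ, G, hG, hG', hdvd, hz⟩ := prim_data t ht (gens.image φ) (by
    intro z hz
    obtain ⟨a, -, rfl⟩ := Finset.mem_image.1 hz
    exact hs a)
  have hz' : ∀ a : A, ∃ (q : MvPolynomial (Fin d) k) (H : Polynomial (MvPolynomial (Fin d) k)),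
        q ≠ 0 ∧ (a ∈ gens → φ a * MvPolynomial.aeval t q = evt t θ H) := by
    intro a
    by_cases ha : a ∈ gens
    · obtain ⟨q, H, h1, h2⟩ := hz _ (Finset.mem_image_of_mem _ ha)
      exact ⟨q, H, h1, fun _ => h2⟩
    · exact ⟨1, 0, one_ne_zero, fun h => absurd h ha⟩
  choose q Hq hq0 hq using hz'
  let Q := ∏ a ∈ gens, q a
  have hQ0 : Q ≠ 0 := Finset.prod_ne_zero_iff.2 fun a _ => hq0 a
  have hQt : MvPolynomial.aeval t Q ≠ 0 := by
    intro h
    apply hQ0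
    exact ht (by rw [h, map_zero])
  have hex : ∀ a, ∃ (H : Polynomial (MvPolynomial (Fin d) k)) (m : ℕ), φ a * MvPolynomial.aeval t Q ^ m = evt t θ H := by
    intro a
    have ha : a ∈ Algebra.adjoin k (gens : Set A) := by rw [hgens]; trivial
    induction ha using Algebra.adjoin_induction with
    | mem x hx =>
      refine ⟨Hq x * Polynomial.C (∏ a ∈ gens.erase x, q a), 1, ?_⟩
      rw [map_mul, evt_C, ← hq x hx, pow_one, mul_assoc, ← map_mul]
      congr 2
      exact (Finset.mul_prod_erase gens q hx).symm
    | algebraMap r =>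
      refine ⟨Polynomial.C (MvPolynomial.C r), 0, ?_⟩
      rw [evt_C, φ.commutes]; simp
    | add x y _ _ hx hy =>
      obtain ⟨H1, m1, h1⟩ := hx
      obtain ⟨H2, m2, h2⟩ := hy
      refine ⟨H1 * Polynomial.C (Q ^ m2) + H2 * Polynomial.C (Q ^ m1), m1 + m2, ?_⟩
      simp only [map_add, map_mul, evt_C, ← h1, ← h2, map_pow]
      ring
    | mul x y _ _ hx hy =>
      obtain ⟨H1, m1, h1⟩ := hx
      obtain ⟨H2, m2, h2⟩ := hy
      refine ⟨H1 * H2, m1 + m2, ?_⟩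
      simp only [map_mul, ← h1, ← h2]
      ring
  refine ⟨θ, G, Q, hG, hG', hQt, hex, ?_⟩
  intro t' θ' hG1 hQ1
  have key : ∀ (a : A) (H1 : Polynomial (MvPolynomial (Fin d) k)) (m1 : ℕ)
      (H2 : Polynomial (MvPolynomial (Fin d) k)) (m2 : ℕ), φ a * MvPolynomial.aeval t Q ^ m1 = evt t θ H1 →
      φ a * MvPolynomial.aeval t Q ^ m2 = evt t θ H2 →
      evt t' θ' H1 * MvPolynomial.aeval t' Q ^ m2 = evt t' θ' H2 * MvPolynomial.aeval t' Q ^ m1 := by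
    intro a H1 m1 H2 m2 h1 h2
    obtain ⟨W, hW⟩ := hdvd (H1 * Polynomial.C (Q ^ m2) - H2 * Polynomial.C (Q ^ m1)) (by
      simp only [map_sub, map_mul, evt_C, ← h1, ← h2, map_pow]
      ring)
    have h3 := congrArg (evt t' θ') hW
    rw [map_mul (evt t' θ') G, hG1, zero_mul] at h3
    simp only [map_sub, map_mul, evt_C, map_pow] at h3
    exact sub_eq_zero.1 h3
  choose H m hHm using hex
  have key2 : ∀ (a : A) (H1 : Polynomial (MvPolynomial (Fin d) k)) (m1 : ℕ), φ a * MvPolynomial.aeval t Q ^ m1 = evt t θ H1 →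
      evt t' θ' (H a) / MvPolynomial.aeval t' Q ^ (m a) * MvPolynomial.aeval t' Q ^ m1
        = evt t' θ' H1 := by
    intro a H1 m1 h1
    have := key a _ _ _ _ (hHm a) h1
    rw [div_mul_eq_mul_div, div_eq_iff (pow_ne_zero _ hQ1), this]
  let f : A → ℂ := fun a => evt t' θ' (H a) / MvPolynomial.aeval t' Q ^ (m a)
  have fmul : ∀ a b, f (a * b) = f a * f b := by
    intro a b
    have := key2 (a * b) (H a * H b) (m a + m b) (by
      simp only [map_mul, ← hHm]; ring)
    have h2 := eq_div_of_mul_eq (pow_ne_zero _ hQ1) this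
    simp only [f]
    rw [h2, map_mul, pow_add, div_mul_div_comm]
  have fadd : ∀ a b, f (a + b) = f a + f b := by
    intro a b
    have := key2 (a + b) (H a * Polynomial.C (Q ^ m b) + H b * Polynomial.C (Q ^ m a)) (m a + m b) (by
      simp only [map_mul, map_add, evt_C, map_pow, ← hHm]; ring)
    have h2 := eq_div_of_mul_eq (pow_ne_zero _ hQ1) this
    simp only [f]
    rw [h2]
    simp only [map_mul, map_add, evt_C, map_pow]
    field_simp
    ring
  have fcomm : ∀ r, f (algebraMap k A r) = algebraMap k ℂ r := by
    intro r
    have := key2 (algebraMap k A r) (Polynomial.C (MvPolynomial.C r)) 0 (by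
      rw [evt_C, φ.commutes]; simp)
    rw [pow_zero, mul_one, evt_C, MvPolynomial.aeval_C] at this
    exact this
  have f1 : f 1 = 1 := by have := fcomm 1; rwa [map_one, map_one] at this
  have f0 : f 0 = 0 := by have := fcomm 0; rwa [map_zero, map_zero] at this
  let ψ : A →ₐ[k] ℂ :=
    { toFun := f, map_one' := f1, map_mul' := fmul, map_zero' := f0, map_add' := fadd,
      commutes' := fcomm }
  exact ⟨ψ, fun a H1 m1 h1 => key2 a H1 m1 h1⟩

end

noncomputable section

theorem aeval_strict {k : Type} [Field k] [Algebra k ℂ] {d : ℕ} (t : Fin d → ℂ) (θ : ℂ)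
    (q : MvPolynomial (Fin d) k) :
    ∃ L : ((Fin d → ℂ) × ℂ) →L[ℂ] ℂ,
      HasStrictFDerivAt (fun p : (Fin d → ℂ) × ℂ => MvPolynomial.aeval p.1 q) L (t, θ) ∧
      ∀ D : Derivation k ℂ ℂ, D (MvPolynomial.aeval t q) = L (fun i => D (t i), D θ) := by
  induction q using MvPolynomial.induction_on with
  | C r =>
    refine ⟨0, ?_, fun D => ?_⟩
    · simp only [MvPolynomial.aeval_C]
      exact hasStrictFDerivAt_const _ _
    · rw [MvPolynomial.aeval_C, D.map_algebraMap]; rfl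
  | add p q hp hq =>
    obtain ⟨L1, h1, h1'⟩ := hp
    obtain ⟨L2, h2, h2'⟩ := hq
    refine ⟨L1 + L2, ?_, fun D => ?_⟩
    · simp only [map_add]; exact h1.add h2
    · rw [map_add, map_add, h1', h2']; rfl
  | mul_X p i hp =>
    obtain ⟨L1, h1, h1'⟩ := hp
    have h2 : HasStrictFDerivAt (fun p : (Fin d → ℂ) × ℂ => p.1 i)
        ((ContinuousLinearMap.proj i).comp (ContinuousLinearMap.fst ℂ (Fin d → ℂ) ℂ)) (t, θ) :=
      ((ContinuousLinearMap.proj (R := ℂ) (φ := fun _ : Fin d => ℂ) i).comp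
        (ContinuousLinearMap.fst ℂ (Fin d → ℂ) ℂ)).hasStrictFDerivAt
    refine ⟨MvPolynomial.aeval t p • ((ContinuousLinearMap.proj i).comp
      (ContinuousLinearMap.fst ℂ (Fin d → ℂ) ℂ)) + t i • L1, ?_, fun D => ?_⟩
    · have h3 := h1.mul h2
      have h4 : (fun p_1 : (Fin d → ℂ) × ℂ => MvPolynomial.aeval p_1.1 (p * MvPolynomial.X i)) =
        ((fun p_1 : (Fin d → ℂ) × ℂ => MvPolynomial.aeval p_1.1 p) * fun p => p.1 i) := by
        funext y; simp
      rw [h4]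
      exact h3
    rw [map_mul, D.leibniz, h1', MvPolynomial.aeval_X]
    simp

theorem evt_strict {k : Type} [Field k] [Algebra k ℂ] {d : ℕ} (t : Fin d → ℂ) (θ : ℂ)
    (H : Polynomial (MvPolynomial (Fin d) k)) :
    ∃ L : ((Fin d → ℂ) × ℂ) →L[ℂ] ℂ,
      HasStrictFDerivAt (fun p : (Fin d → ℂ) × ℂ => evt p.1 p.2 H) L (t, θ) ∧
      ∀ D : Derivation k ℂ ℂ, D (evt t θ H) = L (fun i => D (t i), D θ) := by
  have hX : HasStrictFDerivAt (fun p : (Fin d → ℂ) × ℂ => p.2)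
        (ContinuousLinearMap.snd ℂ (Fin d → ℂ) ℂ) (t, θ) :=
    (ContinuousLinearMap.snd ℂ (Fin d → ℂ) ℂ).hasStrictFDerivAt
  have hXn : ∀ (q : MvPolynomial (Fin d) k) (n : ℕ), ∃ L : ((Fin d → ℂ) × ℂ) →L[ℂ] ℂ,
      HasStrictFDerivAt (fun p : (Fin d → ℂ) × ℂ =>
        evt p.1 p.2 (Polynomial.C q * Polynomial.X ^ n)) L (t, θ) ∧
      ∀ D : Derivation k ℂ ℂ, D (evt t θ (Polynomial.C q * Polynomial.X ^ n))
        = L (fun i => D (t i), D θ) := by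
    intro q n
    induction n with
    | zero =>
      obtain ⟨L, h, h'⟩ := aeval_strict t θ q
      refine ⟨L, by simpa only [pow_zero, mul_one, evt_C] using h, fun D => ?_⟩
      rw [pow_zero, mul_one, evt_C, h']
    | succ n ih =>
      obtain ⟨L, h, h'⟩ := ih
      refine ⟨evt t θ (Polynomial.C q * Polynomial.X ^ n) •
        (ContinuousLinearMap.snd ℂ (Fin d → ℂ) ℂ) + θ • L, ?_, fun D => ?_⟩
      · have h3 := h.mul hX
        have h4 : (fun p : (Fin d → ℂ) × ℂ =>
            evt p.1 p.2 (Polynomial.C q * Polynomial.X ^ (n + 1))) =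
          ((fun p : (Fin d → ℂ) × ℂ => evt p.1 p.2 (Polynomial.C q * Polynomial.X ^ n))
            * fun p => p.2) := by
          funext y
          rw [pow_succ, ← mul_assoc, map_mul, evt_X]; rfl
        rw [h4]
        exact h3
      rw [pow_succ, ← mul_assoc, map_mul, D.leibniz, h', evt_X]
      simp
  induction H using Polynomial.induction_on with
  | C q => simpa using hXn q 0
  | add p q hp hq =>
    obtain ⟨L1, h1, h1'⟩ := hp
    obtain ⟨L2, h2, h2'⟩ := hq
    refine ⟨L1 + L2, ?_, fun D => ?_⟩
    · simp only [map_add]; exact h1.add h2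
    · rw [map_add, map_add, h1', h2']; rfl
  | monomial n q _ => exact hXn q (n + 1)

theorem evt_strict_theta {k : Type} [Field k] [Algebra k ℂ] {d : ℕ} (t : Fin d → ℂ) (θ : ℂ)
    (G : Polynomial (MvPolynomial (Fin d) k)) (L : ((Fin d → ℂ) × ℂ) →L[ℂ] ℂ)
    (hL : HasStrictFDerivAt (fun p : (Fin d → ℂ) × ℂ => evt p.1 p.2 G) L (t, θ)) :
    L (0, 1) = evt t θ (Polynomial.derivative G) := by
  have h1 : HasDerivAt (fun z : ℂ => evt t z G) (L (0, 1)) θ := by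
    have h2 : HasDerivAt (fun z : ℂ => ((t, z) : (Fin d → ℂ) × ℂ)) (0, 1) θ :=
      (hasDerivAt_const θ t).prodMk (hasDerivAt_id θ)
    exact hL.hasFDerivAt.comp_hasDerivAt θ h2
  have h3 : ∀ (z : ℂ) (P : Polynomial (MvPolynomial (Fin d) k)), evt t z P =
      (P.map (MvPolynomial.aeval t : MvPolynomial (Fin d) k →ₐ[k] ℂ).toRingHom).eval z := by
    intro z P
    rw [Polynomial.eval_map]; rfl
  simp only [h3] at h1 ⊢
  rw [← Polynomial.derivative_map]
  exact h1.unique (Polynomial.hasDerivAt _ _)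

/-- choosing `d` rows of an injective matrix -/
theorem choose_rows {r d : ℕ} (M : Matrix (Fin r) (Fin d) ℂ)
    (hM : Function.Injective M.mulVec) :
    ∃ i : Fin d → Fin r, Function.Injective (Matrix.mulVec (M.submatrix i id)) := by
  have hrank : Module.finrank ℂ (Submodule.span ℂ (Set.range M.row)) = d := by
    rw [← Matrix.rank_eq_finrank_span_row, ← Matrix.rank_transpose]
    have h := Matrix.mulVec_injective_iff.1 hM
    have h2 := LinearIndependent.rank_matrix (M := M.transpose) h
    rw [h2]; simp
  obtain ⟨κ, a, ha, hspan, hli⟩ := exists_linearIndependent' ℂ M.row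
  have : Finite κ := Finite.of_injective a ha
  have := Fintype.ofFinite κ
  have hcard : Fintype.card κ = d := by
    have h := finrank_span_eq_card hli
    rw [← h, hspan, hrank]
  let e : Fin d ≃ κ := (Fintype.equivFinOfCardEq hcard).symm
  refine ⟨a ∘ e, ?_⟩
  rw [Matrix.mulVec_injective_iff_isUnit, ← Matrix.linearIndependent_rows_iff_isUnit]
  exact hli.comp e e.injective

end

noncomputable section

/-- strictly differentiable at `p0`, compatibly with derivations -/
def StrictDer (k : Type) [Field k] [Algebra k ℂ] {d : ℕ} (p0 : (Fin d → ℂ) × ℂ)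
    (f : ((Fin d → ℂ) × ℂ) → ℂ) : Prop :=
  ∃ L : ((Fin d → ℂ) × ℂ) →L[ℂ] ℂ, HasStrictFDerivAt f L p0 ∧
    ∀ D : Derivation k ℂ ℂ, D (f p0) = L (fun i => D (p0.1 i), D p0.2)

theorem StrictDer.mul {k : Type} [Field k] [Algebra k ℂ] {d : ℕ} {p0 : (Fin d → ℂ) × ℂ}
    {f g : ((Fin d → ℂ) × ℂ) → ℂ} (hf : StrictDer k p0 f) (hg : StrictDer k p0 g) :
    StrictDer k p0 (f * g) := by
  obtain ⟨L1, h1, h1'⟩ := hf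
  obtain ⟨L2, h2, h2'⟩ := hg
  refine ⟨f p0 • L2 + g p0 • L1, h1.mul h2, fun D => ?_⟩
  rw [Pi.mul_apply, D.leibniz, h1', h2']
  rfl

theorem StrictDer.pow {k : Type} [Field k] [Algebra k ℂ] {d : ℕ} {p0 : (Fin d → ℂ) × ℂ}
    {f : ((Fin d → ℂ) × ℂ) → ℂ} (hf : StrictDer k p0 f) (m : ℕ) :
    StrictDer k p0 (f ^ m) := by
  induction m with
  | zero =>
    refine ⟨0, ?_, fun D => ?_⟩
    · rw [pow_zero]; exact hasStrictFDerivAt_const _ _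
    · simp
  | succ m ih => rw [pow_succ]; exact ih.mul hf

theorem StrictDer.inv {k : Type} [Field k] [Algebra k ℂ] {d : ℕ} {p0 : (Fin d → ℂ) × ℂ}
    {f : ((Fin d → ℂ) × ℂ) → ℂ} (hf : StrictDer k p0 f) (h0 : f p0 ≠ 0) :
    StrictDer k p0 (fun p => (f p)⁻¹) := by
  obtain ⟨L1, h1, h1'⟩ := hf
  refine ⟨_, (hasStrictDerivAt_inv h0).comp_hasStrictFDerivAt p0 h1, fun D => ?_⟩
  rw [D.leibniz_inv, h1']
  simp

/-- purely analytic step: an injective derivative produces nearby points -/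
theorem open_points {n d : ℕ} (u : Fin d → Fin n → ℝ) (p0 : (Fin d → ℂ) × ℂ)
    (F : Fin n → ((Fin d → ℂ) × ℂ) → ℂ) (L : Fin n → ((Fin d → ℂ) × ℂ) →L[ℂ] ℂ)
    (hF : ∀ j, HasStrictFDerivAt (F j) (L j) p0) (hF0 : ∀ j, F j p0 ≠ 0)
    (g : ((Fin d → ℂ) × ℂ) → ℂ) (Lg : ((Fin d → ℂ) × ℂ) →L[ℂ] ℂ) (hg : HasStrictFDerivAt g Lg p0)
    (hg0 : g p0 = 0)
    (hinj : ∀ w, (∀ i, ∑ j, (u i j : ℂ) * (L j w / F j p0) = 0) → Lg w = 0 → w = 0)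
    (W : Set ((Fin d → ℂ) × ℂ)) (hW : W ∈ nhds p0) (δ' : ℝ) (hδ' : 0 < δ') :
    ∃ δ : ℝ, 0 < δ ∧ ∀ ζ : Fin d → ℂ, (∀ i, ‖ζ i‖ < δ) → ∃ (p : (Fin d → ℂ) × ℂ) (η : Fin n → ℂ),
      p ∈ W ∧ g p = 0 ∧ (∀ j, ‖η j‖ < δ') ∧ (∀ i, ∑ j, (u i j : ℂ) * η j = ζ i) ∧
      ∀ j, F j p = F j p0 * Complex.exp (η j) := by
  let η : Fin n → ((Fin d → ℂ) × ℂ) → ℂ := fun j p => Complex.log (F j p * (F j p0)⁻¹)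
  have hη0 : ∀ j, η j p0 = 0 := fun j => by simp [η, hF0 j]
  have hη : ∀ j, HasStrictFDerivAt (η j) ((F j p0)⁻¹ • L j) p0 := by
    intro j
    have h1 : HasStrictFDerivAt (fun p => F j p * (F j p0)⁻¹) ((F j p0)⁻¹ • L j) p0 :=
      (hF j).mul_const _
    have h2 := h1.clog (by rw [mul_inv_cancel₀ (hF0 j)]; exact Complex.one_mem_slitPlane)
    rw [mul_inv_cancel₀ (hF0 j), inv_one, one_smul] at h2
    exact h2
  let Φ : ((Fin d → ℂ) × ℂ) → ((Fin d → ℂ) × ℂ) := fun p => (fun i => ∑ j, (u i j : ℂ) * η j p, g p)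
  let M : ((Fin d → ℂ) × ℂ) →L[ℂ] ((Fin d → ℂ) × ℂ) :=
    (ContinuousLinearMap.pi (fun i => ∑ j, (u i j : ℂ) • ((F j p0)⁻¹ • L j))).prod Lg
  have hΦ : HasStrictFDerivAt Φ M p0 := by
    refine HasStrictFDerivAt.prodMk ?_ hg
    rw [hasStrictFDerivAt_pi']
    intro i
    have h3 : HasStrictFDerivAt (fun p => ∑ j, (u i j : ℂ) * η j p)
        (∑ j, (u i j : ℂ) • ((F j p0)⁻¹ • L j)) p0 :=
      HasStrictFDerivAt.fun_sum (fun j _ => (hη j).const_mul _)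
    exact h3
  have hMinj : Function.Injective (M : ((Fin d → ℂ) × ℂ) →ₗ[ℂ] ((Fin d → ℂ) × ℂ)) := by
    rw [injective_iff_map_eq_zero]
    intro w hw
    have hw1 : ∀ i, ∑ j, (u i j : ℂ) * (L j w / F j p0) = 0 := by
      intro i
      have := congrFun (congrArg Prod.fst hw) i
      simp only [M, ContinuousLinearMap.coe_coe, ContinuousLinearMap.prod_apply,
        ContinuousLinearMap.pi_apply, ContinuousLinearMap.sum_apply,
        ContinuousLinearMap.smul_apply, smul_eq_mul, Prod.fst_zero, Pi.zero_apply] at this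
      rw [← this]
      refine Finset.sum_congr rfl fun j _ => ?_
      ring
    exact hinj w hw1 (congrArg Prod.snd hw)
  have hMsurj : (M : ((Fin d → ℂ) × ℂ) →ₗ[ℂ] ((Fin d → ℂ) × ℂ)).range = ⊤ :=
    LinearMap.range_eq_top.2 (LinearMap.injective_iff_surjective.1 hMinj)
  have hmap := hΦ.map_nhds_eq_of_surj hMsurj
  have hΦ0 : Φ p0 = 0 := by
    refine Prod.ext ?_ hg0
    funext i
    simp [Φ, hη0]
  rw [hΦ0] at hmap
  have hW2 : {p | p ∈ W ∧ (∀ j, ‖η j p‖ < δ') ∧ ∀ j, F j p ≠ 0} ∈ nhds p0 := by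
    have e1 : ∀ᶠ p in nhds p0, ∀ j, ‖η j p‖ < δ' := by
      rw [Filter.eventually_all]
      intro j
      have hc : ContinuousAt (fun p => ‖η j p‖) p0 := ((hη j).continuousAt).norm
      exact hc.eventually_lt continuousAt_const (by simpa [hη0 j] using hδ')
    have e2 : ∀ᶠ p in nhds p0, ∀ j, F j p ≠ 0 := by
      rw [Filter.eventually_all]
      intro j
      exact ((hF j).continuousAt).eventually_ne (hF0 j)
    filter_upwards [hW, e1, e2] with p h1 h2 h3
    exact ⟨h1, h2, h3⟩
  have himg := Filter.image_mem_map (m := Φ) hW2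
  rw [hmap, Metric.mem_nhds_iff] at himg
  obtain ⟨δ, hδ, hball⟩ := himg
  refine ⟨δ, hδ, fun ζ hζ => ?_⟩
  have hmem : ((ζ, 0) : (Fin d → ℂ) × ℂ) ∈ Metric.ball (0 : (Fin d → ℂ) × ℂ) δ := by
    rw [mem_ball_zero_iff, Prod.norm_def, max_lt_iff]
    exact ⟨(pi_norm_lt_iff hδ).2 hζ, by simpa using hδ⟩
  obtain ⟨p, ⟨hp1, hp2, hp3⟩, hp4⟩ := hball hmem
  refine ⟨p, fun j => η j p, hp1, congrArg Prod.snd hp4, hp2,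
    fun i => congrFun (congrArg Prod.fst hp4) i, fun j => ?_⟩
  simp only [η]
  rw [Complex.exp_log (mul_ne_zero (hp3 j) (inv_ne_zero (hF0 j)))]
  field_simp [hF0 j]

theorem points_main {k A : Type} [Field k] [CharZero k] [Countable k] [Algebra k ℂ] [CommRing A]
    [IsDomain A] [Algebra k A] [Algebra.FiniteType k A] {n r d : ℕ}
    (htr : Algebra.trdeg k A = d) (x : Fin n → Aˣ) (u : Fin r → Fin n → ℝ)
    (hu : LinearIndependent ℝ u)
    (hna : ∀ (e : ℕ) (a : Fin e → Fin n → ℤ), LinearIndependent ℤ a →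
      ∃ (ρ : ℕ) (f : Fin ρ → Fin e),
        AlgebraicIndependent k (fun i => ((lmon x (a (f i)) : Aˣ) : A)) ∧
        (d ≤ ρ ∨ d + e ≤ r + ρ)) :
    ∃ (i : Fin d → Fin r) (y0 : Fin n → ℂ), (∀ j, y0 j ≠ 0) ∧
      ∀ δ' : ℝ, 0 < δ' → ∃ δ : ℝ, 0 < δ ∧ ∀ ζ : Fin d → ℂ, (∀ i, ‖ζ i‖ < δ) →
        ∃ η : Fin n → ℂ, (∀ j, ‖η j‖ < δ') ∧ (∀ l, ∑ j, (u (i l) j : ℂ) * η j = ζ l) ∧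
          (fun j => y0 j * Complex.exp (η j)) ∈
            {y : Fin n → ℂ | ∃ ψ : A →ₐ[k] ℂ, ∀ j, ψ (x j) = y j} := by
  -- transcendence basis of A
  obtain ⟨s, hs⟩ := exists_isTranscendenceBasis k A
  have hcard : Cardinal.mk s = d := by rw [hs.cardinalMk_eq_trdeg, htr]
  obtain ⟨es⟩ : Nonempty (Fin d ≃ s) := by
    rw [← Cardinal.eq, hcard]; simp
  let b : Fin d → A := fun i => es i
  have hb : IsTranscendenceBasis k b := hs.comp_equiv es
  -- field of constants
  obtain ⟨κ, hU, t, ht⟩ := gen_basis (k := k)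
    (Set.range (fun p : Fin r × Fin n => ((u p.1 p.2 : ℝ) : ℂ))) (Set.countable_range _) d
  have htk : AlgebraicIndependent k t := ht.1.restrictScalars (algebraMap k κ).injective
  obtain ⟨φ, hφ, hφb⟩ := gen_embed b hb t htk
  have ht' : IsTranscendenceBasis κ (fun i => φ (b i)) := by simpa only [hφb] using ht
  let ξ : Fin n → ℂ := fun j => φ (x j)
  have hξ : ∀ j, ξ j ≠ 0 := fun j => ((x j).isUnit.map φ).ne_zero
  have hlm : ∀ a : Fin n → ℤ, φ ((lmon x a : Aˣ) : A) = ∏ j, ξ j ^ a j := by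
    intro a
    have : φ ((lmon x a : Aˣ) : A) = ((Units.map (φ : A →* ℂ) (lmon x a) : ℂˣ) : ℂ) := rfl
    rw [this, lmon, map_prod, Units.coe_prod]
    refine Finset.prod_congr rfl fun j _ => ?_
    rw [map_zpow, Units.val_zpow_eq_zpow_val]; rfl
  let uκ : Fin r → Fin n → κ := fun i j => ⟨((u i j : ℝ) : ℂ), hU ⟨(i, j), rfl⟩⟩
  have huκ : LinearIndependent κ uκ := by
    have h1 : LinearIndependent ℂ (fun i => (fun j => ((u i j : ℝ) : ℂ)) : Fin r → Fin n → ℂ) := by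
      have := (linearIndependent_algebraMap_comp_iff (R := ℝ) (S := ℂ) (v := u)).2 hu
      exact this
    exact (linearIndependent_algebraMap_comp_iff (R := κ) (S := ℂ) (v := uκ)).1 h1
  have hax : ∀ D : Derivation κ ℂ ℂ, (∀ i, ∑ j, ((u i j : ℝ) : ℂ) * (D (ξ j) / ξ j) = 0) → D = 0 := by
    intro D hD
    refine ax_main t ht ξ hξ uκ huκ ?_ D hD
    intro e a ha
    obtain ⟨ρ, f, h1, h2⟩ := hna e a ha
    refine ⟨ρ, f, ?_, h2⟩
    have h3 := gen_indep (κ := κ) b hb φ hφ ht' _ h1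
    simpa only [hlm] using h3
  -- derivations
  have hDex : ∀ l : Fin d, ∃ D : Derivation κ ℂ ℂ, ∀ i, D (t i) = if i = l then 1 else 0 :=
    fun l => ax_der_exists t ht _
  choose Dl hDl using hDex
  have hDcomb : ∀ D : Derivation κ ℂ ℂ, D = ∑ l, D (t l) • Dl l := by
    intro D
    rw [← sub_eq_zero]
    apply ax_der_ext t ht
    intro i
    have : (∑ l, D (t l) • Dl l) (t i) = ∑ l, D (t l) * (Dl l) (t i) := by
      rw [← Derivation.coeFnAddMonoidHom_apply, map_sum, Finset.sum_apply]; rfl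
    rw [Derivation.sub_apply, this]
    simp [hDl]
  let M : Matrix (Fin r) (Fin d) ℂ := fun i l => ∑ j, ((u i j : ℝ) : ℂ) * (Dl l (ξ j) / ξ j)
  have hMv : ∀ (τ : Fin d → ℂ) i, M.mulVec τ i =
      ∑ j, ((u i j : ℝ) : ℂ) * ((∑ l, τ l • Dl l) (ξ j) / ξ j) := by
    intro τ i
    have : ∀ z, (∑ l, τ l • Dl l) z = ∑ l, τ l * (Dl l) z := by
      intro z
      rw [← Derivation.coeFnAddMonoidHom_apply, map_sum, Finset.sum_apply]; rfl
    simp only [this, Matrix.mulVec, dotProduct, M, Finset.sum_mul, Finset.sum_div, Finset.mul_sum]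
    rw [Finset.sum_comm]
    refine Finset.sum_congr rfl fun j _ => Finset.sum_congr rfl fun l _ => ?_
    ring
  have hDt : ∀ (τ : Fin d → ℂ) i, (∑ l, τ l • Dl l) (t i) = τ i := by
    intro τ i
    have : ∀ z, (∑ l, τ l • Dl l) z = ∑ l, τ l * (Dl l) z := by
      intro z
      rw [← Derivation.coeFnAddMonoidHom_apply, map_sum, Finset.sum_apply]; rfl
    rw [this]; simp [hDl]
  have hMinj : Function.Injective M.mulVec := by
    have : Function.Injective M.mulVecLin := by
      rw [injective_iff_map_eq_zero]
      intro τ hτ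
      have h1 := hax (∑ l, τ l • Dl l) (fun i => by
        rw [← hMv]; exact congrFun hτ i)
      funext i
      rw [← hDt τ i, h1]; rfl
    exact this
  obtain ⟨i, hi⟩ := choose_rows M hMinj
  have hax2 : ∀ D : Derivation κ ℂ ℂ,
      (∀ l, ∑ j, ((u (i l) j : ℝ) : ℂ) * (D (ξ j) / ξ j) = 0) → D = 0 := by
    intro D hD
    have h1 : (M.submatrix i id).mulVec (fun l => D (t l)) = 0 := by
      funext l
      have : (M.submatrix i id).mulVec (fun l => D (t l)) l = M.mulVec (fun l => D (t l)) (i l) := rfl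
      rw [this, hMv, ← hDcomb]; exact hD l
    have h2 : (fun l => D (t l)) = 0 := hi (by rw [h1, Matrix.mulVec_zero])
    exact ax_der_ext t ht D (fun l => congrFun h2 l)
  -- algebraic data
  obtain ⟨θ, G, Q, hG, hG', hQ, hex, hψ⟩ := etale_data t htk φ (by
    intro a
    obtain ⟨p, hp0, hp⟩ := hb.isAlgebraic.isAlgebraic a
    have hmem : ∀ z : Algebra.adjoin k (Set.range b), φ z ∈ Algebra.adjoin k (Set.range t) := by
      rintro ⟨z, hz⟩
      have : φ z ∈ (Algebra.adjoin k (Set.range b)).map φ := ⟨z, hz, rfl⟩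
      rw [AlgHom.map_adjoin, ← Set.range_comp] at this
      have h2 : φ ∘ b = t := funext hφb
      rwa [h2] at this
    let g : Algebra.adjoin k (Set.range b) →+* Algebra.adjoin k (Set.range t) :=
      RingHom.codRestrict ((φ : A →+* ℂ).comp (algebraMap _ A)) _ hmem
    have hg : Function.Injective g := by
      intro x y hxy
      have : φ x = φ y := congrArg Subtype.val hxy
      exact Subtype.ext (hφ this)
    refine ⟨p.map g, by rwa [Ne, Polynomial.map_eq_zero_iff hg], ?_⟩
    rw [Polynomial.aeval_def, Polynomial.eval₂_map]
    have := congrArg φ hp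
    rw [map_zero, Polynomial.aeval_def, ← AlgHom.coe_toRingHom, Polynomial.hom_eval₂] at this
    exact this)
  have hexx := fun j => hex (x j : A)
  choose H m hHm using hexx
  obtain ⟨LG, hLG1, hLG2⟩ := evt_strict t θ G
  let F : Fin n → ((Fin d → ℂ) × ℂ) → ℂ := fun j p =>
    evt p.1 p.2 (H j) * ((MvPolynomial.aeval p.1 Q) ^ m j)⁻¹
  have hFξ : ∀ j, F j (t, θ) = ξ j := fun j => by
    simp only [F]
    rw [← hHm, mul_assoc, mul_inv_cancel₀ (pow_ne_zero _ hQ), mul_one]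
  have hFd : ∀ j, StrictDer k (t, θ) (F j) := by
    intro j
    have hQ1 : StrictDer k (t, θ)
      (fun p : (Fin d → ℂ) × ℂ => (MvPolynomial.aeval p.1 Q)) := aeval_strict t θ Q
    exact StrictDer.mul (evt_strict t θ (H j)) ((hQ1.pow (m j)).inv (pow_ne_zero _ hQ))
  choose LF hLF1 hLF2 using hFd
  refine ⟨i, ξ, hξ, fun δ' hδ' => ?_⟩
  have hW : {p : (Fin d → ℂ) × ℂ | MvPolynomial.aeval p.1 Q ≠ 0} ∈ nhds (t, θ) := by
    obtain ⟨LQ, hLQ1, -⟩ := aeval_strict t θ Q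
    exact hLQ1.continuousAt.eventually_ne hQ
  obtain ⟨δ, hδ, hpt⟩ := open_points (fun l => u (i l)) (t, θ) F LF hLF1
    (fun j => by rw [hFξ]; exact hξ j) (fun p => evt p.1 p.2 G) LG hLG1 hG (by
      rintro ⟨τ, ϑ⟩ h1 h2
      let D : Derivation κ ℂ ℂ := ∑ l, τ l • Dl l
      have hDτ : (fun i => D (t i)) = τ := funext (hDt τ)
      have h3 := hLG2 (D.restrictScalars k)
      rw [hG, map_zero] at h3
      change 0 = LG (fun i => D (t i), D θ) at h3
      rw [hDτ] at h3
      have h4 : LG ((D θ - ϑ) • ((0, 1) : (Fin d → ℂ) × ℂ)) = 0 := by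
        have : (D θ - ϑ) • ((0, 1) : (Fin d → ℂ) × ℂ) = (τ, D θ) - (τ, ϑ) := by
          ext <;> simp
        rw [this, map_sub, ← h3, h2, sub_zero]
      rw [map_smul, evt_strict_theta t θ G LG hLG1, smul_eq_mul] at h4
      have h5 : D θ = ϑ := by
        rcases mul_eq_zero.1 h4 with h | h
        · exact sub_eq_zero.1 h
        · exact absurd h hG'
      have h6 : D = 0 := by
        apply hax2
        intro l
        rw [← h1 l]
        refine Finset.sum_congr rfl fun j _ => ?_
        have h7 := hLF2 j (D.restrictScalars k)
        change D (F j (t, θ)) = LF j (fun i => D (t i), D θ) at h7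
        rw [hDτ, h5] at h7
        rw [← h7, hFξ]
      rw [← h5, ← hDτ, h6]
      rfl) _ hW δ' hδ'
  refine ⟨δ, hδ, fun ζ hζ => ?_⟩
  obtain ⟨p, η, hp1, hp2, hη1, hη2, hη3⟩ := hpt ζ hζ
  obtain ⟨ψ, hψ1⟩ := hψ p.1 p.2 hp2 hp1
  refine ⟨η, hη1, hη2, ψ, fun j => ?_⟩
  have h8 := hψ1 _ _ _ (hHm j)
  change ψ (x j) = ξ j * Complex.exp (η j)
  rw [← hFξ, ← hη3]
  simp only [F]
  rw [← h8, mul_assoc, mul_inv_cancel₀ (pow_ne_zero _ hp1), mul_one]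

end

noncomputable section

theorem lmon_map {k A B : Type} [Field k] [CommRing A] [Algebra k A] [Field B] [Algebra k B]
    {n : ℕ} (ψ : A →ₐ[k] B) (x : Fin n → Aˣ) (a : Fin n → ℤ) :
    ψ ((lmon x a : Aˣ) : A) = ∏ j, ψ (x j) ^ a j := by
  have : ψ ((lmon x a : Aˣ) : A) = ((Units.map (ψ : A →* B) (lmon x a) : Bˣ) : B) := rfl
  rw [this, lmon, map_prod, Units.coe_prod]
  refine Finset.prod_congr rfl fun j _ => ?_
  rw [map_zpow, Units.val_zpow_eq_zpow_val]; rfl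

/-- The auxiliary relation: the combination of the Ax-type theorem, the lower bound and the Hilbert
function upper bound. -/
theorem rel_main {k A : Type} [Field k] [CharZero k] [Countable k] [Algebra k ℂ] [CommRing A]
    [IsDomain A] [Algebra k A] [Algebra.FiniteType k A] {n r d : ℕ}
    (htr : Algebra.trdeg k A = d) (x : Fin n → Aˣ) (u : Fin r → Fin n → ℝ)
    (hu : LinearIndependent ℝ u)
    (hna : ∀ (e : ℕ) (a : Fin e → Fin n → ℤ), LinearIndependent ℤ a →
      ∃ (ρ : ℕ) (f : Fin ρ → Fin e),
        AlgebraicIndependent k (fun i => ((lmon x (a (f i)) : Aˣ) : A)) ∧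
        (d ≤ ρ ∨ d + e ≤ r + ρ)) :
    ∃ (i : Fin d → Fin r) (J : ℕ), 1 ≤ J ∧ ∀ M : ℕ, 1 ≤ M → ∀ p : Fin n,
      ∃ (J' : ℕ) (cc : ℕ → (Fin d → Fin (J * M)) → k),
      ∑ l ∈ Finset.range (J' + 1),
        (∑ s, cc l s • (lmon x (dftRound (fun l => u (i l)) (fun i => (s i : ℕ))) : A)) *
        (x p : A) ^ (l * M) = 0 ∧
      ∑ s, cc J' s • (lmon x (dftRound (fun l => u (i l)) (fun i => (s i : ℕ))) : A) ≠ 0 := by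
  obtain ⟨i, y0, hy0, hpts⟩ := points_main htr x u hu hna
  obtain ⟨c, hc, hdft⟩ := dft_main (fun l => u (i l)) y0 hy0 _ hpts
  obtain ⟨J, hJ, h⟩ := rel_exists htr x (fun l => u (i l)) c hc (by
    intro B hB
    let mon : (Fin d → Fin B) → A := fun s => (lmon x (dftRound (fun l => u (i l)) (fun i => (s i : ℕ))) : A)
    let E := Submodule.span k (Set.range mon)
    have : FiniteDimensional k E := FiniteDimensional.span_of_finite k (Set.finite_range mon)
    let e := Module.finBasis k E
    let monE : (Fin d → Fin B) → E := fun s => ⟨mon s, Submodule.subset_span ⟨s, rfl⟩⟩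
    let V : Submodule ℂ ((Fin d → Fin B) → ℂ) := Submodule.span ℂ (Set.range
      (fun m : Fin (Module.finrank k E) => fun s => algebraMap k ℂ (e.repr (monE s) m)))
    have hV : Module.finrank ℂ V ≤ Module.finrank k E := by
      have := finrank_range_le_card (R := ℂ) (fun m : Fin (Module.finrank k E) =>
        fun s : Fin d → Fin B => algebraMap k ℂ (e.repr (monE s) m))
      simpa [Set.finrank] using this
    refine (hdft B V hB ?_).trans (by exact_mod_cast hV)
    rintro y ⟨ψ, hψ⟩
    have hs : (fun s : Fin d → Fin B => ∏ j, y j ^ dftRound (fun l => u (i l)) (fun i => (s i : ℕ)) j)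
        = ∑ m, ψ (e m) • (fun s => algebraMap k ℂ (e.repr (monE s) m)) := by
      funext s
      rw [Finset.sum_apply]
      have h1 : ∏ j, y j ^ dftRound (fun l => u (i l)) (fun i => (s i : ℕ)) j = ψ (mon s) := by
        rw [lmon_map]; simp only [hψ]
      have h2 : mon s = ∑ m, e.repr (monE s) m • (e m : A) := by
        have := congrArg E.subtype (e.sum_repr (monE s))
        rw [map_sum] at this
        simp only [map_smul] at this
        exact this.symm
      rw [h1, h2, map_sum]
      refine Finset.sum_congr rfl fun m _ => ?_
      rw [map_smul, Algebra.smul_def, Pi.smul_apply, smul_eq_mul, mul_comm]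
    rw [hs]
    exact Submodule.sum_mem _ fun m _ => Submodule.smul_mem _ _ (Submodule.subset_span ⟨m, rfl⟩))
  exact ⟨i, J, hJ, h⟩

end

noncomputable section
open Polynomial

abbrev QB : Type := AlgebraicClosure ℚ

instance qbAlg : Algebra.IsAlgebraic ℚ QB := AlgebraicClosure.isAlgebraic ℚ

instance factPr (p : Nat.Primes) : Fact (p : ℕ).Prime := ⟨p.2⟩

def embP (p : Nat.Primes) : QB →+* PadicAlgCl p :=
  (IsAlgClosed.lift : QB →ₐ[ℚ] PadicAlgCl p).toRingHom

def embI : QB →+* ℂ := (IsAlgClosed.lift : QB →ₐ[ℚ] ℂ).toRingHom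

/-- the absolute values on `QB` -/
def nvP (p : Nat.Primes) : QB →*₀ ℝ := (normHom : PadicAlgCl p →*₀ ℝ).comp (embP p).toMonoidWithZeroHom

def nvI : QB →*₀ ℝ := (normHom : ℂ →*₀ ℝ).comp embI.toMonoidWithZeroHom

lemma nvP_nonneg (p) (x : QB) : 0 ≤ nvP p x := norm_nonneg (embP p x)
lemma nvI_nonneg (x : QB) : 0 ≤ nvI x := norm_nonneg (embI x)

lemma nvP_rat (p : Nat.Primes) (q : ℚ) : nvP p (algebraMap ℚ QB q) = (padicNorm p q : ℚ) := by
  have h : nvP p (algebraMap ℚ QB q) = ‖embP p (algebraMap ℚ QB q)‖ := rfl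
  have h2 : embP p (algebraMap ℚ QB q) = (algebraMap ℚ_[p] (PadicAlgCl p) (q : ℚ_[p])) := by simp
  rw [h, h2, PadicAlgCl.norm_extends]
  simp

lemma nvI_rat (q : ℚ) : nvI (algebraMap ℚ QB q) = |(q : ℝ)| := by
  have h : nvI (algebraMap ℚ QB q) = ‖embI (algebraMap ℚ QB q)‖ := rfl
  rw [h]
  simp

lemma nvI_sum_le {ι : Type*} (s : Finset ι) (f : ι → QB) (b : ℝ) (h : ∀ i ∈ s, nvI (f i) ≤ b) :
    nvI (∑ i ∈ s, f i) ≤ s.card * b := by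
  have h1 : nvI (∑ i ∈ s, f i) = ‖∑ i ∈ s, embI (f i)‖ := by
    rw [← map_sum]; rfl
  rw [h1]
  refine (norm_sum_le _ _).trans ?_
  have := Finset.sum_le_card_nsmul s (fun i => ‖embI (f i)‖) b h
  simpa using this

lemma nvP_add_le (p) (x y : QB) : nvP p (x + y) ≤ max (nvP p x) (nvP p y) := by
  have h : nvP p (x + y) = ‖embP p x + embP p y‖ := by rw [← map_add]; rfl
  rw [h]
  exact PadicAlgCl.isNonarchimedean p _ _

lemma nvP_sum_le {ι : Type*} (p) (s : Finset ι) (f : ι → QB) (b : ℝ) (hb : 0 ≤ b)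
    (h : ∀ i ∈ s, nvP p (f i) ≤ b) : nvP p (∑ i ∈ s, f i) ≤ b := by
  classical
  induction s using Finset.induction_on with
  | empty => simpa using hb
  | insert a s ha ih =>
    rw [Finset.sum_insert ha]
    refine (nvP_add_le p _ _).trans (max_le (h _ (by simp)) (ih fun i hi => h i (by simp [hi])))

def mkPr (m : ℕ) (h : m.Prime) : Nat.Primes := ⟨m, h⟩

lemma mkPr_coe (m : ℕ) (h : m.Prime) : ((mkPr m h : Nat.Primes) : ℕ) = m := rfl

lemma rat_places (q : ℚ) (hq : q ≠ 0) : ∃ T0 : Finset Nat.Primes,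
    (∀ p ∉ T0, padicNorm p q = 1) ∧
    ∀ T, T0 ⊆ T → ∑ p ∈ T, Real.log ((padicNorm p q : ℚ) : ℝ) + Real.log |(q : ℝ)| = 0 := by
  classical
  have key : ∀ m : ℕ, m ≠ 0 → ∃ T0 : Finset Nat.Primes, (∀ p ∉ T0, ¬ (p : ℕ) ∣ m) ∧
     ∀ T, T0 ⊆ T → ∑ p ∈ T, (padicValNat p m : ℝ) * Real.log p = Real.log m := by
    intro m hm
    obtain ⟨T0, hT0⟩ : ∃ T0 : Finset Nat.Primes, ∀ p : Nat.Primes, p ∈ T0 ↔ (p : ℕ) ∈ m.primeFactors := by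
      refine ⟨m.primeFactors.attach.image
        (fun p => mkPr p.1 (Nat.prime_of_mem_primeFactors p.2)), fun p => ?_⟩
      simp only [Finset.mem_image, Finset.mem_attach, true_and]
      constructor
      · rintro ⟨a, rfl⟩
        exact a.2
      · intro h
        exact ⟨⟨p, h⟩, rfl⟩
    refine ⟨T0, ?_, ?_⟩
    · intro p hp hd
      exact hp ((hT0 p).2 (Nat.mem_primeFactors.2 ⟨p.2, hd, hm⟩))
    · intro T hT
      have h1 : Real.log m = ∑ p ∈ m.primeFactors, (m.factorization p : ℝ) * Real.log p := by
        conv_lhs => rw [← Nat.prod_factorization_pow_eq_self hm]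
        rw [Finsupp.prod, Nat.support_factorization]
        push_cast
        rw [Real.log_prod]
        · simp
        · intro p hp
          have := (Nat.prime_of_mem_primeFactors hp).pos
          positivity
      rw [h1]
      rw [← Finset.sum_subset hT]
      · refine Finset.sum_nbij (fun p : Nat.Primes => (p : ℕ)) (fun p hp => (hT0 p).1 hp)
          (fun p _ q _ h => Nat.Primes.coe_nat_injective h) ?_ ?_
        · intro p hp
          exact ⟨⟨p, Nat.prime_of_mem_primeFactors hp⟩, (hT0 _).2 hp, rfl⟩
        · intro p hp
          rw [Nat.factorization_def _ p.2]
      · intro p _ hp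
        have : ¬ (p : ℕ) ∣ m := fun hd => hp ((hT0 p).2 (Nat.mem_primeFactors.2 ⟨p.2, hd, hm⟩))
        rw [padicValNat.eq_zero_of_not_dvd this]; simp
  obtain ⟨T1, h1, h1'⟩ := key q.num.natAbs (by simpa using hq)
  obtain ⟨T2, h2, h2'⟩ := key q.den q.den_nz
  have hv : ∀ p : Nat.Primes, padicNorm p q =
      (p : ℚ) ^ (-((padicValNat p q.num.natAbs : ℤ) - (padicValNat p q.den : ℤ))) := by
    intro p
    rw [padicNorm.eq_zpow_of_nonzero hq]
    rfl
  refine ⟨T1 ∪ T2, ?_, ?_⟩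
  · intro p hp
    simp only [Finset.mem_union, not_or] at hp
    rw [hv, padicValNat.eq_zero_of_not_dvd (h1 p hp.1), padicValNat.eq_zero_of_not_dvd (h2 p hp.2)]
    simp
  · intro T hT
    have e1 := h1' T (Finset.union_subset_left hT)
    have e2 := h2' T (Finset.union_subset_right hT)
    have e3 : Real.log |(q : ℝ)| = Real.log (q.num.natAbs : ℕ) - Real.log q.den := by
      have : |(q : ℝ)| = ((q.num.natAbs : ℕ) : ℝ) / q.den := by
        have h0 : (q : ℝ) = (q.num : ℝ) / q.den := by exact_mod_cast (Rat.num_div_den q).symm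
        rw [h0, abs_div]
        simp [Nat.cast_natAbs]
      rw [this, Real.log_div]
      · simpa using hq
      · simp
    rw [e3, ← e1, ← e2, ← Finset.sum_sub_distrib, ← Finset.sum_add_distrib]
    refine Finset.sum_eq_zero fun p _ => ?_
    rw [hv]
    rw [Rat.cast_zpow, Real.log_zpow]
    simp only [Int.cast_neg, Int.cast_sub, Int.cast_natCast, Rat.cast_natCast]
    ring

abbrev cj (x : QB) : Multiset QB := (minpoly ℚ x).aroots QB

lemma minpoly_prod (x : QB) : (minpoly ℚ x).map (algebraMap ℚ QB) =
    ((cj x).map (fun t => X - C t)).prod := by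
  have h := (IsAlgClosed.splits ((minpoly ℚ x).map (algebraMap ℚ QB))).eq_prod_roots
  rw [h]
  have : (((minpoly ℚ x).map (algebraMap ℚ QB))).leadingCoeff = 1 :=
    ((minpoly.monic (Algebra.IsIntegral.isIntegral x)).map _)
  rw [this]
  simp [aroots]

lemma card_cj (x : QB) : (cj x).card = (minpoly ℚ x).natDegree := by
  have := congrArg natDegree (minpoly_prod x)
  rw [natDegree_multiset_prod_X_sub_C_eq_card, natDegree_map] at this
  exact this.symm

lemma nvP_esymm (p) (s : Multiset QB) (k : ℕ) :
    nvP p (s.esymm k) ≤ (s.map (fun y => max 1 (nvP p y))).prod := by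
  classical
  have key : ∀ t ≤ s, nvP p t.prod ≤ (s.map (fun y => max 1 (nvP p y))).prod := by
    intro t ht
    obtain ⟨u, rfl⟩ := Multiset.le_iff_exists_add.1 ht
    rw [Multiset.map_add, Multiset.prod_add, map_multiset_prod]
    have a1 : (t.map (nvP p)).prod ≤ (t.map (fun y => max 1 (nvP p y))).prod := by
      apply Multiset.prod_map_le_prod_map₀
      · intro i _; exact nvP_nonneg p i
      · intro i _; exact le_max_right _ _
    have a2 : (1 : ℝ) ≤ (u.map (fun y => max 1 (nvP p y))).prod := by
      clear ht a1
      induction u using Multiset.induction_on with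
      | empty => simp
      | cons a u ih =>
        rw [Multiset.map_cons, Multiset.prod_cons]
        nlinarith [le_max_left 1 (nvP p a)]
    have a3 : 0 ≤ (t.map (nvP p)).prod := by
      apply Multiset.prod_nonneg
      intro a ha
      obtain ⟨b, _, rfl⟩ := Multiset.mem_map.1 ha
      exact nvP_nonneg p b
    nlinarith
  have hpos : 0 ≤ (s.map (fun y => max 1 (nvP p y))).prod := by
    apply Multiset.prod_nonneg
    intro a ha
    obtain ⟨b, _, rfl⟩ := Multiset.mem_map.1 ha
    positivity
  rw [Multiset.esymm]
  have : ∀ w : Multiset (Multiset QB), (∀ t ∈ w, t ≤ s) → nvP p (w.map Multiset.prod).sum ≤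
      (s.map (fun y => max 1 (nvP p y))).prod := by
    intro w
    induction w using Multiset.induction_on with
    | empty => intro _; simpa using hpos
    | cons a w ih =>
      intro h
      rw [Multiset.map_cons, Multiset.sum_cons]
      refine (nvP_add_le p _ _).trans (max_le (key _ (h _ (by simp))) (ih fun t ht => h t (by simp [ht])))
  apply this
  intro t ht
  exact (Multiset.mem_powersetCard.1 ht).1

lemma nvP_coeff (p : Nat.Primes) (x : QB) (i : ℕ) : ((padicNorm p ((minpoly ℚ x).coeff i) : ℚ) : ℝ) ≤
    ((cj x).map (fun y => max 1 (nvP p y))).prod := by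
  have h := congrArg (fun f => f.coeff i) (minpoly_prod x)
  simp only [coeff_map] at h
  rw [← nvP_rat, h]
  by_cases hi : i ≤ (cj x).card
  · rw [Multiset.prod_X_sub_C_coeff _ hi, map_mul, map_pow]
    have : nvP p (-1) = 1 := by
      have h : nvP p (-1) = ‖embP p (-1)‖ := rfl
      rw [h]; simp
    rw [this, one_pow, one_mul]
    exact nvP_esymm p _ _
  · rw [coeff_eq_zero_of_natDegree_lt, map_zero]
    · apply Multiset.prod_nonneg
      intro a ha
      obtain ⟨b, _, rfl⟩ := Multiset.mem_map.1 ha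
      positivity
    · rw [natDegree_multiset_prod_X_sub_C_eq_card]; omega

lemma prod_cj (x : QB) : ∃ q : ℚ, (x ≠ 0 → q ≠ 0) ∧ (cj x).prod = algebraMap ℚ QB q ∧
    (q = (minpoly ℚ x).coeff 0 ∨ q = - (minpoly ℚ x).coeff 0) := by
  have h := congrArg (fun f => f.coeff 0) (minpoly_prod x)
  simp only [coeff_map] at h
  rw [Multiset.prod_X_sub_C_coeff _ (Nat.zero_le _), Nat.sub_zero] at h
  have he : (cj x).esymm (cj x).card = (cj x).prod := by
    simp [Multiset.esymm]
  rw [he] at h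
  have h0 : x ≠ 0 → (minpoly ℚ x).coeff 0 ≠ 0 := fun hx =>
    minpoly.coeff_zero_ne_zero (Algebra.IsIntegral.isIntegral x) hx
  rcases neg_one_pow_eq_or QB (cj x).card with e | e
  · rw [e, one_mul] at h
    exact ⟨_, h0, h.symm, Or.inl rfl⟩
  · rw [e] at h
    refine ⟨- (minpoly ℚ x).coeff 0, fun hx => neg_ne_zero.2 (h0 hx), ?_, Or.inr rfl⟩
    rw [map_neg, h]; ring
end

noncomputable section
open Polynomial

lemma nvP_pos (p) {x : QB} (hx : x ≠ 0) : 0 < nvP p x :=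
  lt_of_le_of_ne (nvP_nonneg p x) (Ne.symm ((map_ne_zero (nvP p)).2 hx))
lemma nvI_pos {x : QB} (hx : x ≠ 0) : 0 < nvI x :=
  lt_of_le_of_ne (nvI_nonneg x) (Ne.symm ((map_ne_zero nvI).2 hx))

lemma cj_ne_zero {x : QB} (hx : x ≠ 0) {y : QB} (hy : y ∈ cj x) : y ≠ 0 := by
  rintro rfl
  have h := (mem_aroots.1 hy).2
  have h0 := minpoly.coeff_zero_ne_zero (Algebra.IsIntegral.isIntegral (R := ℚ) x) hx
  rw [← coeff_zero_eq_aeval_zero'] at h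
  exact h0 (by simpa using h)

lemma multiset_log_prod {α : Type*} (s : Multiset α) (f : α → ℝ) (h : ∀ y ∈ s, f y ≠ 0) :
    Real.log (s.map f).prod = (s.map (fun y => Real.log (f y))).sum := by
  induction s using Multiset.induction_on with
  | empty => simp
  | cons a s ih =>
    rw [Multiset.map_cons, Multiset.prod_cons, Multiset.map_cons, Multiset.sum_cons,
      Real.log_mul (h a (by simp)), ih (fun y hy => h y (by simp [hy]))]
    apply Multiset.prod_ne_zero
    intro h0
    obtain ⟨b, hb, hb0⟩ := Multiset.mem_map.1 h0
    exact h b (by simp [hb]) hb0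

lemma multiset_prod_le_one_eq (s : Multiset QB) (p) (h : ∀ y ∈ s, nvP p y ≤ 1)
    (h1 : nvP p s.prod = 1) : ∀ y ∈ s, nvP p y = 1 := by
  intro y hy
  obtain ⟨t, rfl⟩ := Multiset.exists_cons_of_mem hy
  rw [Multiset.prod_cons, map_mul] at h1
  have ht : nvP p t.prod ≤ 1 := by
    rw [map_multiset_prod]
    have := Multiset.prod_map_le_prod_map₀ (s := t) (nvP p) (fun _ => (1 : ℝ)) (fun i _ => nvP_nonneg p i)
      (fun i hi => h i (by simp [hi]))
    simpa using this
  have hy1 := h y hy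
  by_contra hne
  have := lt_of_le_of_ne hy1 hne
  nlinarith [nvP_nonneg p y, nvP_nonneg p t.prod]

lemma nvP_root_le (p : Nat.Primes) (f : ℚ[X]) (hf : f.Monic) (h : ∀ i, padicNorm p (f.coeff i) ≤ 1) (y : QB)
    (hy : aeval y f = 0) : nvP p y ≤ 1 := by
  by_contra hlt
  push Not at hlt
  rw [aeval_eq_sum_range, Finset.sum_range_succ] at hy
  rw [coeff_natDegree, hf.leadingCoeff, one_smul] at hy
  have h2 := eq_neg_of_add_eq_zero_right hy
  have hneg : nvP p (-1) = 1 := by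
    have h : nvP p (-1) = ‖embP p (-1)‖ := rfl
    rw [h]; simp
  have hd : f.natDegree ≠ 0 := by
    intro h0
    rw [h0] at hy
    simp at hy
  have h3 : nvP p (y ^ f.natDegree) ≤ (nvP p y) ^ (f.natDegree - 1) := by
    rw [h2, neg_eq_neg_one_mul, map_mul, hneg, one_mul]
    apply nvP_sum_le
    · exact pow_nonneg (nvP_nonneg _ _) _
    · intro i hi
      rw [Algebra.smul_def, map_mul, nvP_rat, map_pow]
      have a1 : ((padicNorm p (f.coeff i) : ℚ) : ℝ) ≤ 1 := by exact_mod_cast h i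
      have a2 : (nvP p y) ^ i ≤ (nvP p y) ^ (f.natDegree - 1) :=
        pow_le_pow_right₀ hlt.le (by have := Finset.mem_range.1 hi; omega)
      have a3 : (0 : ℝ) ≤ (nvP p y) ^ i := pow_nonneg (nvP_nonneg _ _) _
      nlinarith
  rw [map_pow] at h3
  exact absurd h3 (not_le.2 (pow_lt_pow_right₀ hlt (by omega)))

/-- finiteness of bad places, product formula, height bound. -/
lemma cj_places (x : QB) (hx : x ≠ 0) : ∃ T0 : Finset Nat.Primes,
    (∀ p ∉ T0, ∀ y ∈ cj x, nvP p y = 1) ∧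
    ∀ T, T0 ⊆ T → ∑ p ∈ T, ((cj x).map (fun y => Real.log (nvP p y))).sum +
      ((cj x).map (fun y => Real.log (nvI y))).sum = 0 := by
  classical
  set f := minpoly ℚ x with hf
  have hm : f.Monic := minpoly.monic (Algebra.IsIntegral.isIntegral x)
  have hex : ∀ i : ℕ, ∃ T0 : Finset Nat.Primes, f.coeff i ≠ 0 → ∀ p ∉ T0, padicNorm p (f.coeff i) = 1 := by
    intro i
    by_cases h : f.coeff i = 0
    · exact ⟨∅, fun h' => absurd h h'⟩
    · obtain ⟨T, hT, _⟩ := rat_places _ h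
      exact ⟨T, fun _ => hT⟩
  choose t ht using hex
  obtain ⟨q, hq0, hq, hqc⟩ := prod_cj x
  obtain ⟨T1, hT1, hT1'⟩ := rat_places q (hq0 hx)
  refine ⟨T1 ∪ f.support.biUnion t, ?_, ?_⟩
  · intro p hp
    simp only [Finset.mem_union, not_or, Finset.mem_biUnion, not_exists, not_and] at hp
    apply multiset_prod_le_one_eq
    · intro y hy
      refine nvP_root_le p f hm (fun i => ?_) y ((mem_aroots.1 hy).2)
      by_cases h : f.coeff i = 0
      · simp [h]
      · exact (ht i h p (hp.2 i (mem_support_iff.2 h))).le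
    · rw [hq, nvP_rat, hT1 p hp.1]; simp
  · intro T hT
    have := hT1' T (Finset.union_subset_left hT)
    rw [← this]
    congr 1
    · refine Finset.sum_congr rfl fun p _ => ?_
      rw [← multiset_log_prod _ _ (fun y hy => (nvP_pos p (cj_ne_zero hx hy)).ne'),
        ← map_multiset_prod, hq, nvP_rat]
    · rw [← multiset_log_prod _ _ (fun y hy => (nvI_pos (cj_ne_zero hx hy)).ne'),
        ← map_multiset_prod, hq, nvI_rat]

lemma lcm_prime_pow (p : ℕ) (hp : p.Prime) (e : ℕ) (he : e ≠ 0) (s : Finset ℕ) (g : ℕ → ℕ)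
    (hg : ∀ i ∈ s, g i ≠ 0)
    (h : p ^ e ∣ s.lcm g) : ∃ i ∈ s, p ^ e ∣ g i := by
  classical
  induction s using Finset.induction_on with
  | empty =>
    simp at h
    rcases h with h | h
    · exact absurd h hp.one_lt.ne'
    · exact absurd h he
  | insert a s ha ih =>
    rw [Finset.lcm_insert] at h
    have h0 : s.lcm g ≠ 0 := by
      rw [Ne, Finset.lcm_eq_zero_iff]
      rintro ⟨i, hi, hi0⟩
      exact hg i (by simp [Finset.mem_coe.1 hi]) hi0
    have ha0 : g a ≠ 0 := hg a (by simp)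
    have h1 : p ^ e ∣ g a ∨ p ^ e ∣ s.lcm g := by
      rw [hp.pow_dvd_iff_le_factorization ha0, hp.pow_dvd_iff_le_factorization h0]
      have h2 : p ^ e ∣ Nat.lcm (g a) (s.lcm g) := h
      rw [hp.pow_dvd_iff_le_factorization (Nat.lcm_ne_zero ha0 h0), Nat.factorization_lcm ha0 h0] at h2
      simpa using h2
    rcases h1 with h' | h'
    · exact ⟨a, by simp, h'⟩
    · obtain ⟨i, hi, h''⟩ := ih (fun i hi => hg i (by simp [hi])) h'
      exact ⟨i, by simp [hi], h''⟩

lemma den_le (p : Nat.Primes) (x : QB) :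
    (((p : ℕ) ^ (((minpoly ℚ x).support.lcm fun i => ((minpoly ℚ x).coeff i).den).factorization p) : ℕ) : ℝ)
      ≤ ((cj x).map (fun y => max 1 (nvP p y))).prod := by
  set D := (minpoly ℚ x).support.lcm fun i => ((minpoly ℚ x).coeff i).den with hD
  by_cases he : D.factorization p = 0
  · rw [he]
    simp only [pow_zero, Nat.cast_one]
    have h := Multiset.prod_map_le_prod_map₀ (s := cj x) (fun _ => (1 : ℝ))
      (fun y => max 1 (nvP p y)) (fun _ _ => zero_le_one) (fun _ _ => le_max_left _ _)
    simpa using h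
  · obtain ⟨i, hi, hdvd⟩ := lcm_prime_pow p p.2 _ he _ _ (fun i _ => Rat.den_nz _)
      (Nat.ordProj_dvd D p)
    refine le_trans ?_ (nvP_coeff p x i)
    set q := (minpoly ℚ x).coeff i with hq
    have hq0 : q ≠ 0 := mem_support_iff.1 hi
    rw [padicNorm.eq_zpow_of_nonzero hq0]
    have hnum : padicValInt p q.num = 0 := by
      apply padicValInt.eq_zero_of_not_dvd
      intro h
      have h1 : (p : ℕ) ∣ q.num.natAbs := Int.natCast_dvd.1 h
      have h2 : (p : ℕ) ∣ q.den := (dvd_pow_self _ he).trans hdvd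
      have := Nat.dvd_gcd h1 h2
      rw [q.reduced.gcd_eq_one] at this
      exact p.2.one_lt.ne' (Nat.dvd_one.1 this)
    have hv : padicValRat p q = - (padicValNat p q.den : ℤ) := by
      rw [padicValRat, hnum]; simp
    rw [hv, neg_neg, zpow_natCast]
    push_cast
    apply pow_le_pow_right₀
    · exact_mod_cast p.2.one_le
    · rw [← Nat.factorization_def _ p.2]
      exact (p.2.pow_dvd_iff_le_factorization (Rat.den_nz _)).1 hdvd

lemma weil_le (x : QB) (T : Finset Nat.Primes) (hT : ∀ p ∉ T, ∀ y ∈ cj x, nvP p y = 1) :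
    ((minpoly ℚ x).natDegree : ℝ) * weilHeight x ≤
     ∑ p ∈ T, ((cj x).map (fun y => Real.log (max 1 (nvP p y)))).sum +
      ((cj x).map (fun y => Real.log (max 1 (nvI y)))).sum := by
  classical
  have hdeg : ((minpoly ℚ x).natDegree : ℝ) ≠ 0 := by
    have := minpoly.natDegree_pos (Algebra.IsIntegral.isIntegral (R := ℚ) x)
    positivity
  rw [weilHeight, mul_div_cancel₀ _ hdeg]
  apply add_le_add
  · set D := (minpoly ℚ x).support.lcm fun i => ((minpoly ℚ x).coeff i).den with hD
    have hD0 : D ≠ 0 := by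
      rw [Ne, Finset.lcm_eq_zero_iff]
      rintro ⟨i, hi, hi0⟩
      exact Rat.den_nz _ hi0
    have hDq : (D : ℚ) ≠ 0 := by exact_mod_cast hD0
    obtain ⟨T1, _, h1⟩ := rat_places (D : ℚ) hDq
    have h2 := h1 (T ∪ T1) Finset.subset_union_right
    have h3 : Real.log D = ∑ p ∈ T ∪ T1, - Real.log ((padicNorm p (D : ℚ) : ℚ) : ℝ) := by
      rw [Finset.sum_neg_distrib]
      have : Real.log |((D : ℚ) : ℝ)| = Real.log D := by simp
      linarith
    rw [h3]
    have h4 : ∀ p : Nat.Primes, - Real.log ((padicNorm p (D : ℚ) : ℚ) : ℝ) ≤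
        ((cj x).map (fun y => Real.log (max 1 (nvP p y)))).sum := by
      intro p
      rw [← multiset_log_prod _ _ (fun y _ => by positivity), ← Real.log_inv]
      have h5 := den_le p x
      rw [← hD] at h5
      have h6 : (((padicNorm p (D : ℚ) : ℚ) : ℝ))⁻¹ = (((p : ℕ) ^ (D.factorization p) : ℕ) : ℝ) := by
        rw [padicNorm.eq_zpow_of_nonzero hDq, padicValRat.of_nat, Nat.factorization_def _ p.2]
        rw [zpow_neg, zpow_natCast]
        simp
      rw [h6]
      apply Real.log_le_log _ h5
      have := p.2.pos
      positivity
    refine (Finset.sum_le_sum fun p _ => h4 p).trans ?_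
    apply le_of_eq
    symm
    apply Finset.sum_subset Finset.subset_union_left
    intro p _ hp
    apply Multiset.sum_eq_zero
    intro a ha
    obtain ⟨y, hy, rfl⟩ := Multiset.mem_map.1 ha
    simp [hT p hp y hy]
  · apply le_of_eq
    have : (minpoly ℚ x).aroots ℂ = (cj x).map embI := by
      have h := IsAlgClosed.splits ((minpoly ℚ x).map (algebraMap ℚ QB))
      have := h.roots_map embI
      rw [cj, aroots, aroots, ← this, Polynomial.map_map]
      congr 2
      exact RingHom.ext_rat _ _
    rw [this, Multiset.map_map]
    rfl
end

noncomputable section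
open Polynomial

lemma sum_emb_pb {K L F E : Type} [Field K] [Field L] [Field F] [Field E] [Algebra K L] [Algebra K F]
    [Algebra L F] [Algebra K E] [IsScalarTower K L F] [IsAlgClosed E]
    [Algebra.IsSeparable K F] [FiniteDimensional K F] (pb : PowerBasis K L) (g : E → ℝ) :
    ∑ σ : F →ₐ[K] E, g (σ (algebraMap L F pb.gen)) =
      (Module.finrank L F : ℝ) * (((minpoly K pb.gen).aroots E).map g).sum := by
  classical
  have : FiniteDimensional L F := FiniteDimensional.right K L F
  have : Algebra.IsSeparable L F := Algebra.isSeparable_tower_top_of_isSeparable K L F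
  have hsL : Algebra.IsSeparable K L := Algebra.isSeparable_tower_bot_of_isSeparable K L F
  let : Fintype (L →ₐ[K] E) := PowerBasis.AlgHom.fintype pb
  have e1 : ∑ σ : F →ₐ[K] E, g (σ (algebraMap L F pb.gen)) =
      (Module.finrank L F : ℝ) * ∑ σ : L →ₐ[K] E, g (σ pb.gen) := by
    rw [Fintype.sum_equiv algHomEquivSigma (fun σ : F →ₐ[K] E => _) fun σ => g (σ.1 pb.gen),
      ← Finset.univ_sigma_univ, Finset.sum_sigma, Finset.mul_sum]
    · refine Finset.sum_congr rfl fun σ _ => ?_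
      let : Algebra L E := σ.toRingHom.toAlgebra
      simp_rw [Finset.sum_const, nsmul_eq_mul]
      congr
      exact AlgHom.card L F E
    · intro σ
      simp only [algHomEquivSigma, Equiv.coe_fn_mk, AlgHom.domRestrict, AlgHom.comp_apply,
        IsScalarTower.coe_toAlgHom']
  rw [e1]
  congr 1
  rw [@Fintype.sum_equiv (L →ₐ[K] E) _ _ (PowerBasis.AlgHom.fintype pb) _ _ pb.liftEquiv'
    (fun σ => g (σ pb.gen)) (fun x => g x) ?_]
  · rw [Finset.sum_mem_multiset _ _ (fun x => g x) (fun _ => rfl), Finset.sum_eq_multiset_sum,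
      Multiset.toFinset_val, Multiset.dedup_eq_self.mpr]
    exact nodup_roots (.map (Algebra.IsSeparable.isSeparable K pb.gen))
  · intro σ; simp only [PowerBasis.liftEquiv'_apply_coe]

lemma sum_emb_gen {K F E : Type} [Field K] [Field F] [Field E] [Algebra K F]
    [Algebra K E] [IsAlgClosed E]
    [Algebra.IsSeparable K F] [FiniteDimensional K F] (x : F) :
    ∃ c : ℝ, 0 < c ∧ (Module.finrank K F : ℝ) = c * (minpoly K x).natDegree ∧
    ∀ g : E → ℝ, ∑ σ : F →ₐ[K] E, g (σ x) = c * (((minpoly K x).aroots E).map g).sum := by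
  have hi : IsIntegral K x := Algebra.IsIntegral.isIntegral _
  let pb := IntermediateField.adjoin.powerBasis hi
  have hg : algebraMap (IntermediateField.adjoin K {x}) F pb.gen = x := by
    simp [pb, IntermediateField.adjoin.powerBasis_gen]
  have hmp2 : minpoly K pb.gen = minpoly K x := by
    have := (minpoly.algebraMap_eq (A := K) (algebraMap (IntermediateField.adjoin K {x}) F).injective pb.gen).symm
    rw [hg] at this
    exact this
  refine ⟨(Module.finrank (IntermediateField.adjoin K {x}) F : ℝ), ?_, ?_, ?_⟩
  · exact_mod_cast Module.finrank_pos
  · rw [← hmp2, ← Nat.cast_mul, ← Module.finrank_mul_finrank K (IntermediateField.adjoin K {x}) F, mul_comm]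
    congr 2
    rw [pb.finrank, pb.natDegree_minpoly]
  · intro g
    have := sum_emb_pb (F := F) (E := E) pb g
    rw [hmp2, hg] at this
    exact this

lemma sum_emb (M : IntermediateField ℚ QB) [FiniteDimensional ℚ M] (x : QB) (hx : x ∈ M) :
    ∃ c : ℝ, 0 < c ∧ (Module.finrank ℚ M : ℝ) = c * (minpoly ℚ x).natDegree ∧
    ∀ g : QB → ℝ, ∑ σ : M →ₐ[ℚ] QB, g (σ ⟨x, hx⟩) = c * ((cj x).map g).sum := by
  have hmp : minpoly ℚ (⟨x, hx⟩ : M) = minpoly ℚ x := by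
    have := minpoly.algebraMap_eq (A := ℚ) (B := M) (B' := QB) (algebraMap M QB).injective ⟨x, hx⟩
    exact this.symm
  obtain ⟨c, h1, h2, h3⟩ := sum_emb_gen (K := ℚ) (F := M) (E := QB) ⟨x, hx⟩
  rw [hmp] at h2
  simp only [hmp] at h3
  exact ⟨c, h1, h2, h3⟩

lemma emb_mem_cj (M : IntermediateField ℚ QB) (x : QB) (hx : x ∈ M) (σ : M →ₐ[ℚ] QB) :
    σ ⟨x, hx⟩ ∈ cj x := by
  rw [mem_aroots]
  refine ⟨minpoly.ne_zero (Algebra.IsIntegral.isIntegral x), ?_⟩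
  have hmp : minpoly ℚ (⟨x, hx⟩ : M) = minpoly ℚ x := by
    have := minpoly.algebraMap_eq (A := ℚ) (B := M) (B' := QB) (algebraMap M QB).injective ⟨x, hx⟩
    exact this.symm
  rw [← hmp, aeval_algHom_apply, minpoly.aeval, map_zero]

lemma aut_mem_cj (x : QB) (τ : QB →ₐ[ℚ] QB) : τ x ∈ cj x := by
  rw [mem_aroots]
  refine ⟨minpoly.ne_zero (Algebra.IsIntegral.isIntegral x), ?_⟩
  rw [aeval_algHom_apply, minpoly.aeval, map_zero]

lemma exists_ext (M : IntermediateField ℚ QB) (σ : M →ₐ[ℚ] QB) :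
    ∃ τ : QB →ₐ[ℚ] QB, ∀ x (hx : x ∈ M), τ x = σ ⟨x, hx⟩ := by
  obtain ⟨τ, hτ⟩ := IntermediateField.exists_algHom_of_splits (F := ℚ) (E := QB) (K := QB)
    (L := M) (f := σ) (fun s => ⟨Algebra.IsIntegral.isIntegral s, IsAlgClosed.splits _⟩)
  refine ⟨τ, fun x hx => ?_⟩
  rw [← hτ]; rfl

lemma cj_exists_aut (x y : QB) (hy : y ∈ cj x) : ∃ τ : QB →ₐ[ℚ] QB, τ x = y := by
  have hi : IsIntegral ℚ x := Algebra.IsIntegral.isIntegral _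
  obtain ⟨σ, hσ⟩ := (IntermediateField.algHomAdjoinIntegralEquiv ℚ (K := QB) hi).surjective ⟨y, hy⟩
  obtain ⟨τ, hτ⟩ := exists_ext _ σ
  refine ⟨τ, ?_⟩
  rw [hτ x (IntermediateField.mem_adjoin_simple_self ℚ x)]
  have := IntermediateField.algHomAdjoinIntegralEquiv_symm_apply_gen ℚ (K := QB) hi ⟨y, hy⟩
  rw [← hσ, Equiv.symm_apply_apply] at this
  rw [hσ] at this
  exact this

def badT (x : QB) : Finset Nat.Primes :=
  open Classical in if hx : x ≠ 0 then (cj_places x hx).choose else ∅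

def Hc (x : QB) : ℝ := (∑ p ∈ badT x, ((cj x).map (fun y => Real.log (max 1 (nvP p y)))).sum +
      ((cj x).map (fun y => Real.log (max 1 (nvI y)))).sum) / (minpoly ℚ x).natDegree

lemma badT_spec (x : QB) (hx : x ≠ 0) : 
    (∀ p ∉ badT x, ∀ y ∈ cj x, nvP p y = 1) ∧
    ∀ T, badT x ⊆ T → ∑ p ∈ T, ((cj x).map (fun y => Real.log (nvP p y))).sum +
      ((cj x).map (fun y => Real.log (nvI y))).sum = 0 := by
  have := (cj_places x hx).choose_spec
  rw [badT, dif_pos hx]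
  exact this

structure PlaceSys (F : Finset QB) where
  ι : Type
  fin : Fintype ι
  w : ℝ
  ab : ι → QB →*₀ ℝ
  arch : Finset ι
  w_pos : 0 < w
  w_arch : w * arch.card ≤ 1
  ab_nonneg : ∀ i x, 0 ≤ ab i x
  ab_arch : ∀ i, ∀ {κ : Type} (s : Finset κ) (f : κ → QB) (b : ℝ), 0 ≤ b →
    (∀ j ∈ s, ab i (f j) ≤ b) → ab i (∑ j ∈ s, f j) ≤ s.card * b
  ab_narch : ∀ i, i ∉ arch → ∀ {κ : Type} (s : Finset κ) (f : κ → QB) (b : ℝ), 0 ≤ b →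
    (∀ j ∈ s, ab i (f j) ≤ b) → ab i (∑ j ∈ s, f j) ≤ b
  prodf : ∀ x : QBˣ, x ∈ Subgroup.closure {u : QBˣ | (u : QB) ∈ F} →
    ∑ i, Real.log (ab i x) = 0
  weil : ∀ x : QBˣ, x ∈ Subgroup.closure {u : QBˣ | (u : QB) ∈ F} →
    weilHeight x ≤ w * ∑ i, Real.log (max 1 (ab i x))
  hc : ∀ x ∈ F, w * ∑ i, Real.log (max 1 (ab i x)) = Hc x

lemma log_max_nonneg (a : ℝ) : 0 ≤ Real.log (max 1 a) := Real.log_nonneg (le_max_left _ _)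

theorem place_sys (F : Finset QB) (hF : ∀ x ∈ F, x ≠ 0) : Nonempty (PlaceSys F) := by
  classical
  let M := IntermediateField.adjoin ℚ (F : Set QB)
  have hfin : FiniteDimensional ℚ M := by
    apply IntermediateField.finiteDimensional_adjoin
    intro x _; exact Algebra.IsIntegral.isIntegral x
  have hFM : ∀ x ∈ F, x ∈ M := fun x hx => IntermediateField.subset_adjoin ℚ _ hx
  let T := F.biUnion badT
  choose ex hex using exists_ext M
  let vv : Option T → QB →*₀ ℝ := fun v => match v with
    | none => nvI
    | some p => nvP p.1
  have hvv : ∀ v x, 0 ≤ vv v x := by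
    rintro (_ | p) x
    · exact nvI_nonneg x
    · exact nvP_nonneg _ x
  have hgM : ∀ x : QBˣ, x ∈ Subgroup.closure {u : QBˣ | (u : QB) ∈ F} → (x : QB) ∈ M := by
    intro x hx
    induction hx using Subgroup.closure_induction with
    | mem x hx => exact hFM _ hx
    | one => simpa using M.one_mem
    | mul x y _ _ h1 h2 => simpa using M.mul_mem h1 h2
    | inv x _ h => simpa using M.inv_mem h
  have hgT : ∀ x : QBˣ, x ∈ Subgroup.closure {u : QBˣ | (u : QB) ∈ F} → ∀ p ∉ T, ∀ y ∈ cj (x : QB),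
      nvP p y = 1 := by
    intro x hx p hp y hy
    obtain ⟨τ, rfl⟩ := cj_exists_aut _ _ hy
    clear hy
    induction hx using Subgroup.closure_induction with
    | mem x hx =>
      refine (badT_spec (x : QB) x.ne_zero).1 p (fun h => hp ?_) _ (aut_mem_cj _ _)
      exact Finset.mem_biUnion.2 ⟨_, hx, h⟩
    | one => simp
    | mul x y _ _ h1 h2 => simp [h1, h2]
    | inv x _ h => simp [h]
  have hw : (0 : ℝ) < Module.finrank ℚ M := by exact_mod_cast Module.finrank_pos
  -- summation formula
  have hsum : ∀ x (hx : x ∈ M), ∃ c : ℝ, 0 < c ∧ (Module.finrank ℚ M : ℝ) = c * (minpoly ℚ x).natDegree ∧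
      ∀ g : ℝ → ℝ, ∑ i : (M →ₐ[ℚ] QB) × Option T, g (vv i.2 (ex i.1 x)) =
      c * (∑ p ∈ T, ((cj x).map (fun y => g (nvP p y))).sum + ((cj x).map (fun y => g (nvI y))).sum) := by
    intro x hx
    obtain ⟨c, hc, hc', h⟩ := sum_emb M x hx
    refine ⟨c, hc, hc', fun g => ?_⟩
    rw [Fintype.sum_prod_type_right, Fintype.sum_option, add_comm, mul_add]
    congr 1
    · rw [Finset.mul_sum, ← Finset.sum_coe_sort T]
      refine Finset.sum_congr rfl fun p _ => ?_
      rw [← h (fun y => g (nvP p y))]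
      refine Finset.sum_congr rfl fun σ _ => ?_
      simp only [hex σ x hx, vv]
    · rw [← h (fun y => g (nvI y))]
      refine Finset.sum_congr rfl fun σ _ => ?_
      simp only [hex σ x hx, vv]
  refine ⟨{
    ι := (M →ₐ[ℚ] QB) × Option T
    fin := inferInstance
    w := (Module.finrank ℚ M : ℝ)⁻¹
    ab := fun i => (vv i.2).comp (ex i.1).toRingHom.toMonoidWithZeroHom
    arch := Finset.univ.filter (fun i => i.2 = none)
    w_pos := by positivity
    w_arch := ?_
    ab_nonneg := fun i x => hvv _ _
    ab_arch := ?_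
    ab_narch := ?_
    prodf := ?_
    weil := ?_
    hc := ?_ }⟩
  · have : (Finset.univ.filter (fun i : (M →ₐ[ℚ] QB) × Option T => i.2 = none)).card = Module.finrank ℚ M := by
      rw [← AlgHom.card ℚ M QB, ← Finset.card_univ]
      refine Finset.card_nbij (fun i => i.1) (fun _ _ => Finset.mem_univ _) ?_ ?_
      · rintro ⟨a, b⟩ h1 ⟨c, d⟩ h2 h
        simp_all
      · intro σ _
        exact ⟨(σ, none), by simp⟩
    rw [this, inv_mul_cancel₀ hw.ne']
  · rintro ⟨σ, v⟩ κ s f b hb h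
    have e : ex σ (∑ j ∈ s, f j) = ∑ j ∈ s, ex σ (f j) := map_sum _ _ _
    change vv v (ex σ (∑ j ∈ s, f j)) ≤ _
    rw [e]
    rcases v with _ | p
    · exact nvI_sum_le s _ b h
    · rcases s.eq_empty_or_nonempty with rfl | hs
      · simp
      refine (nvP_sum_le p.1 s _ b hb h).trans ?_
      have : (1 : ℝ) ≤ s.card := by exact_mod_cast hs.card_pos
      nlinarith
  · rintro ⟨σ, v⟩ hi κ s f b hb h
    have e : ex σ (∑ j ∈ s, f j) = ∑ j ∈ s, ex σ (f j) := map_sum _ _ _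
    change vv v (ex σ (∑ j ∈ s, f j)) ≤ _
    rw [e]
    rcases v with _ | p
    · simp at hi
    · exact nvP_sum_le p.1 s _ b hb h
  · intro x hx
    obtain ⟨c, hc, hc', h⟩ := hsum x (hgM x hx)
    have := h Real.log
    refine this.trans ?_
    have h2 := (badT_spec (x : QB) x.ne_zero).2 (T ∪ badT (x : QB)) Finset.subset_union_right
    rw [← Finset.sum_subset Finset.subset_union_left] at h2
    · rw [h2, mul_zero]
    · intro p _ hp
      apply Multiset.sum_eq_zero
      intro a ha
      obtain ⟨y, hy, rfl⟩ := Multiset.mem_map.1 ha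
      simp [hgT x hx p hp y hy]
  · intro x hx
    obtain ⟨c, hc, hc', h⟩ := hsum x (hgM x hx)
    have := h (fun t => Real.log (max 1 t))
    have h2 := weil_le (x : QB) T (hgT x hx)
    refine le_of_le_of_eq ?_ (congrArg (fun t => (Module.finrank ℚ M : ℝ)⁻¹ * t) this.symm)
    have h3 := mul_le_mul_of_nonneg_left h2 hc.le
    rw [← mul_assoc, ← hc'] at h3
    beta_reduce
    rw [inv_mul_eq_div, le_div_iff₀ hw, mul_comm]
    exact h3
  · intro x hx
    obtain ⟨c, hc, hc', h⟩ := hsum x (hFM x hx)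
    have := h (fun t => Real.log (max 1 t))
    refine Eq.trans (congrArg (fun t => (Module.finrank ℚ M : ℝ)⁻¹ * t) this) ?_
    have e1 : ∑ p ∈ T, ((cj x).map (fun y => Real.log (max 1 (nvP p y)))).sum =
        ∑ p ∈ badT x, ((cj x).map (fun y => Real.log (max 1 (nvP p y)))).sum := by
      symm
      apply Finset.sum_subset (Finset.subset_biUnion_of_mem badT hx)
      intro p _ hp
      apply Multiset.sum_eq_zero
      intro a ha
      obtain ⟨y, hy, rfl⟩ := Multiset.mem_map.1 ha
      simp [(badT_spec x (hF x hx)).1 p hp y hy]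
    have hd : (0 : ℝ) < (minpoly ℚ x).natDegree := by
      exact_mod_cast minpoly.natDegree_pos (Algebra.IsIntegral.isIntegral (R := ℚ) x)
    rw [Hc, e1, hc']
    field_simp

lemma Hc_nonneg (x : QB) : 0 ≤ Hc x := by
  apply div_nonneg _ (Nat.cast_nonneg _)
  apply add_nonneg
  · apply Finset.sum_nonneg
    intro p _
    apply Multiset.sum_nonneg
    intro a ha
    obtain ⟨y, hy, rfl⟩ := Multiset.mem_map.1 ha
    exact log_max_nonneg _
  · apply Multiset.sum_nonneg
    intro a ha
    obtain ⟨y, hy, rfl⟩ := Multiset.mem_map.1 ha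
    exact log_max_nonneg _
end

noncomputable section

namespace PlaceSys
attribute [instance] PlaceSys.fin

variable {F : Finset QB} (S : PlaceSys F)

lemma ab_pos (i : S.ι) (x : QBˣ) : 0 < S.ab i x :=
  lt_of_le_of_ne (S.ab_nonneg i x) (Ne.symm ((map_ne_zero (S.ab i)).2 x.ne_zero))

def u {n : ℕ} (P : Fin n → QBˣ) (i : S.ι) (j : Fin n) : ℝ := Real.log (S.ab i (P j))

lemma log_lmon {n : ℕ} (P : Fin n → QBˣ) (a : Fin n → ℤ) (i : S.ι) :
    Real.log (S.ab i (lmon P a : QBˣ)) = ∑ j, (a j : ℝ) * S.u P i j := by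
  have h : ((lmon P a : QBˣ) : QB) = ∏ j, (P j : QB) ^ a j := by simp [lmon]
  rw [h, map_prod, Real.log_prod]
  · refine Finset.sum_congr rfl fun j _ => ?_
    rw [map_zpow₀, Real.log_zpow]; rfl
  · intro j _
    have := S.ab_pos i (P j)
    rw [map_zpow₀]; positivity

lemma abs_log (t : ℝ) (ht : 0 < t) : |Real.log t| = 2 * Real.log (max 1 t) - Real.log t := by
  rcases le_total 1 t with h | h
  · rw [max_eq_right h, abs_of_nonneg (Real.log_nonneg h)]; ring
  · rw [max_eq_left h, abs_of_nonpos (Real.log_nonpos ht.le h)]; simp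

lemma sum_abs (x : QBˣ) (hx : (x : QB) ∈ F) :
    S.w * ∑ i, |Real.log (S.ab i x)| = 2 * Hc x := by
  have h1 := S.hc x hx
  have h2 := S.prodf x (Subgroup.subset_closure hx)
  have : ∑ i, |Real.log (S.ab i x)| = 2 * ∑ i, Real.log (max 1 (S.ab i x)) - ∑ i, Real.log (S.ab i x) := by
    rw [Finset.mul_sum, ← Finset.sum_sub_distrib]
    exact Finset.sum_congr rfl fun i _ => abs_log _ (S.ab_pos i x)
  rw [this, h2, ← h1]; ring

lemma sum_u {n : ℕ} (P : Fin n → QBˣ) (hP : ∀ j, (P j : QB) ∈ F) :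
    S.w * ∑ i, ∑ j, |S.u P i j| = 2 * ∑ j, Hc (P j) := by
  rw [Finset.sum_comm, Finset.mul_sum, Finset.mul_sum]
  exact Finset.sum_congr rfl fun j _ => S.sum_abs (P j) (hP j)

end PlaceSys

lemma rel_local {J' : ℕ} {κ : Type} [Fintype κ] (ab : QB →*₀ ℝ) (hab : ∀ x, 0 ≤ ab x) (arch : Prop) [Decidable arch]
   (h1 : ∀ {κ : Type} (s : Finset κ) (f : κ → QB) (b : ℝ), 0 ≤ b →
    (∀ j ∈ s, ab (f j) ≤ b) → ab (∑ j ∈ s, f j) ≤ s.card * b)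
   (h2 : ¬ arch → ∀ {κ : Type} (s : Finset κ) (f : κ → QB) (b : ℝ), 0 ≤ b →
    (∀ j ∈ s, ab (f j) ≤ b) → ab (∑ j ∈ s, f j) ≤ b)
   (f : ℕ → κ → QB) (b : ℝ) (hb : 0 ≤ b) (hf : ∀ l ≤ J', ∀ s, ab (f l s) ≤ b) (z : QB)
   (hz : ∑ l ∈ Finset.range (J' + 1), (∑ s, f l s) * z ^ l = 0) (hJ : ∑ s, f J' s ≠ 0) :
   max 1 (ab z) * ab (∑ s, f J' s) ≤ (if arch then ((J' + 1 : ℕ) : ℝ) * Fintype.card κ else 1) * b := by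
  have hκ : 1 ≤ Fintype.card κ := by
    rcases Nat.eq_zero_or_pos (Fintype.card κ) with h | h
    · have := Fintype.card_eq_zero_iff.1 h
      exact absurd (by simp) hJ
    · exact h
  have hκ' : (1 : ℝ) ≤ Fintype.card κ := by exact_mod_cast hκ
  set A : ℝ := if arch then (Fintype.card κ : ℝ) else 1 with hA
  set A' : ℝ := if arch then ((J' + 1 : ℕ) : ℝ) else 1 with hA'
  have hAA : (if arch then ((J' + 1 : ℕ) : ℝ) * Fintype.card κ else 1) = A' * A := by
    by_cases h : arch <;> simp [hA, hA', h]
  have hA1 : 1 ≤ A := by by_cases h : arch <;> simp [hA, h, hκ']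
  have hA1' : 1 ≤ A' := by by_cases h : arch <;> simp [hA', h]
  rw [hAA]
  have hfl : ∀ l ≤ J', ab (∑ s, f l s) ≤ A * b := by
    intro l hl
    by_cases h : arch
    · simp only [hA, h, if_true]
      simpa using h1 Finset.univ (f l) b hb (fun s _ => hf l hl s)
    · simp only [hA, h, if_false, one_mul]
      exact h2 h Finset.univ (f l) b hb (fun s _ => hf l hl s)
  rcases le_total (ab z) 1 with hz1 | hz1
  · rw [max_eq_left hz1, one_mul]
    refine (hfl J' le_rfl).trans ?_
    have : 0 ≤ A * b := by positivity
    nlinarith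
  · rw [max_eq_right hz1]
    rw [Finset.sum_range_succ] at hz
    have hJ0 : J' ≠ 0 := by
      rintro rfl
      simp at hz
      exact hJ hz
    have e := eq_neg_of_add_eq_zero_right hz
    have hneg : ab (-1) = 1 := by
      have h : ab (-1) * ab (-1) = 1 := by rw [← map_mul]; simp
      nlinarith [hab (-1)]
    have e2 : ab (∑ s, f J' s) * ab z ^ J' ≤ A' * (A * b * ab z ^ (J' - 1)) := by
      rw [← map_pow, ← map_mul, e, neg_eq_neg_one_mul, map_mul, hneg, one_mul]
      have hl : ∀ l ∈ Finset.range J', ab ((∑ s, f l s) * z ^ l) ≤ A * b * ab z ^ (J' - 1) := by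
        intro l hl
        have hl' := Finset.mem_range.1 hl
        rw [map_mul, map_pow]
        refine mul_le_mul (hfl l hl'.le) (pow_le_pow_right₀ hz1 (by omega)) (pow_nonneg (hab _) _) (by positivity)
      have hb' : 0 ≤ A * b * ab z ^ (J' - 1) := mul_nonneg (by positivity) (pow_nonneg (hab _) _)
      by_cases h : arch
      · refine (h1 _ _ _ hb' hl).trans ?_
        apply mul_le_mul_of_nonneg_right _ hb'
        simp [hA', h]
      · simp only [hA', h, if_false]
        rw [one_mul]
        exact h2 h _ _ _ hb' hl
    obtain ⟨m, rfl⟩ := Nat.exists_eq_succ_of_ne_zero hJ0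
    simp only [Nat.succ_eq_add_one, Nat.add_sub_cancel] at e2
    have hpos : 0 < ab z ^ m := by positivity
    rw [pow_succ] at e2
    apply le_of_mul_le_mul_right _ hpos
    linarith

/-- height bound from a relation -/
theorem rel_height {n : ℕ} (P : Fin n → QBˣ) (M J' : ℕ) {κ : Type} [Fintype κ] (cc : ℕ → κ → QB)
    (b : κ → Fin n → ℤ) (p : Fin n) (δ : ℝ)
    (hrel : ∑ l ∈ Finset.range (J' + 1), (∑ s, cc l s * (lmon P (b s) : QBˣ)) * (P p : QB) ^ (l * M) = 0)
    (hne : ∑ s, cc J' s * ((lmon P (b s) : QBˣ) : QB) ≠ 0)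
    (hb : ∀ u : Fin n → ℝ, (∀ a : Fin n → ℤ, lmon P a = 1 → ∑ j, (a j : ℝ) * u j = 0) →
      ∀ s, |∑ j, (b s j : ℝ) * u j| ≤ δ * ∑ j, |u j|) :
    M * Hc (P p) ≤ Real.log (((J' + 1 : ℕ) : ℝ) * Fintype.card κ) +
      ∑ l ∈ Finset.range (J' + 1), ∑ s, Hc (cc l s) + δ * (2 * ∑ j, Hc (P j)) := by
  classical
  let y : QBˣ := Units.mk0 _ hne
  let F : Finset QB := (Finset.univ.image (fun j => (P j : QB))) ∪
    ((Finset.range (J' + 1) ×ˢ (Finset.univ : Finset κ)).image (fun q => cc q.1 q.2)).filter (· ≠ 0) ∪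
    {(y : QB)}
  have hF : ∀ x ∈ F, x ≠ 0 := by
    intro x hx
    simp only [F, Finset.mem_union, Finset.mem_image, Finset.mem_filter, Finset.mem_singleton] at hx
    rcases hx with (⟨j, _, rfl⟩ | ⟨_, h⟩) | rfl
    · exact (P j).ne_zero
    · exact h
    · exact y.ne_zero
  obtain ⟨S⟩ := place_sys F hF
  have hPF : ∀ j, (P j : QB) ∈ F := fun j => by simp [F]
  have hyF : (y : QB) ∈ F := by simp [F]
  have hcF : ∀ l ∈ Finset.range (J' + 1), ∀ s, cc l s ≠ 0 → cc l s ∈ F := by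
    intro l hl s h
    simp only [F, Finset.mem_union, Finset.mem_image, Finset.mem_filter]
    exact Or.inl (Or.inr ⟨⟨(l, s), by simpa using Finset.mem_range.1 hl, rfl⟩, h⟩)
  have hlm : ∀ a, lmon P a ∈ Subgroup.closure {u : QBˣ | (u : QB) ∈ F} := by
    intro a
    apply Subgroup.prod_mem
    intro j _
    exact Subgroup.zpow_mem _ (Subgroup.subset_closure (show P j ∈ {u : QBˣ | (u : QB) ∈ F} from hPF j)) _
  let ar : S.ι → ℝ := fun i => if i ∈ S.arch then Real.log (((J' + 1 : ℕ) : ℝ) * Fintype.card κ) else 0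
  have hκ : 1 ≤ Fintype.card κ := by
    rcases Nat.eq_zero_or_pos (Fintype.card κ) with h | h
    · have := Fintype.card_eq_zero_iff.1 h
      exact absurd (by simp) hne
    · exact h
  have hκ' : (1 : ℝ) ≤ Fintype.card κ := by exact_mod_cast hκ
  have hJκ : (1 : ℝ) ≤ ((J' + 1 : ℕ) : ℝ) * Fintype.card κ := by
    have : (1 : ℝ) ≤ ((J' + 1 : ℕ) : ℝ) := by exact_mod_cast Nat.succ_le_succ (Nat.zero_le _)
    nlinarith
  -- local inequality
  have hloc : ∀ i, M * Real.log (max 1 (S.ab i (P p))) + Real.log (S.ab i y) ≤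
      ar i + ∑ l ∈ Finset.range (J' + 1), ∑ s, Real.log (max 1 (S.ab i (cc l s))) +
        δ * ∑ j, |S.u P i j| := by
    intro i
    set c : ℝ := ∑ l ∈ Finset.range (J' + 1), ∑ s, Real.log (max 1 (S.ab i (cc l s))) with hcdef
    set e : ℝ := δ * ∑ j, |S.u P i j| with hedef
    have hlog1 : ∀ s, Real.log (S.ab i (lmon P (b s) : QBˣ)) ≤ e := by
      intro s
      rw [S.log_lmon]
      refine (le_abs_self _).trans (hb _ (fun a ha => ?_) s)
      rw [← S.log_lmon, ha]; simp
    have hlog2 : ∀ l ≤ J', ∀ s, Real.log (max 1 (S.ab i (cc l s))) ≤ c := by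
      intro l hl s
      have h1 : Real.log (max 1 (S.ab i (cc l s))) ≤ ∑ s, Real.log (max 1 (S.ab i (cc l s))) :=
        Finset.single_le_sum (f := fun s => Real.log (max 1 (S.ab i (cc l s))))
          (fun s _ => log_max_nonneg _) (Finset.mem_univ s)
      refine h1.trans ?_
      exact Finset.single_le_sum (f := fun l => ∑ s, Real.log (max 1 (S.ab i (cc l s))))
          (fun l _ => Finset.sum_nonneg fun s _ => log_max_nonneg _) (Finset.mem_range.2 (by omega))
    have := rel_local (J' := J') (S.ab i) (S.ab_nonneg i) (i ∈ S.arch) (S.ab_arch i) (S.ab_narch i)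
      (fun l s => cc l s * (lmon P (b s) : QBˣ)) (Real.exp (c + e)) (Real.exp_pos _).le ?_
      ((P p : QB) ^ M) ?_ hne
    · have h3 := Real.log_le_log (mul_pos (by positivity) (S.ab_pos i y)) this
      rw [Real.log_mul (by positivity) (S.ab_pos i y).ne', Real.log_mul, Real.log_exp] at h3
      · have h4 : Real.log (max 1 (S.ab i ((P p : QB) ^ M))) = M * Real.log (max 1 (S.ab i (P p))) := by
          rw [← Real.log_pow, map_pow]
          congr 1
          rcases le_total 1 (S.ab i (P p)) with h | h
          · rw [max_eq_right h, max_eq_right (one_le_pow₀ h)]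
          · rw [max_eq_left h, max_eq_left (pow_le_one₀ (S.ab_nonneg _ _) h), one_pow]
        have h5 : Real.log (if i ∈ S.arch then ((J' + 1 : ℕ) : ℝ) * Fintype.card κ else 1) = ar i := by
          by_cases h : i ∈ S.arch <;> simp [ar, h]
        rw [h4, h5] at h3
        change _ ≤ _ at h3
        have h6 : Real.log (S.ab i ((y : QBˣ) : QB)) =
          Real.log (S.ab i (∑ s, cc J' s * ((lmon P (b s) : QBˣ) : QB))) := rfl
        linarith
      · split_ifs <;> positivity
      · positivity
    · intro l hl s
      rw [map_mul, Real.exp_add]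
      apply mul_le_mul
      · refine (le_max_right 1 _).trans ?_
        rw [← Real.log_le_iff_le_exp (by positivity)]
        exact hlog2 l hl s
      · rw [← Real.log_le_iff_le_exp (S.ab_pos i _)]
        exact hlog1 s
      · exact S.ab_nonneg _ _
      · positivity
    · rw [← hrel]
      refine Finset.sum_congr rfl fun l _ => ?_
      rw [← pow_mul, mul_comm M l]
  have hsum := Finset.sum_le_sum (fun i (_ : i ∈ Finset.univ) => hloc i)
  have hsum' := mul_le_mul_of_nonneg_left hsum S.w_pos.le
  simp only [Finset.sum_add_distrib, ← Finset.mul_sum] at hsum'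
  rw [S.prodf y (Subgroup.subset_closure hyF), add_zero] at hsum'
  have k1 : S.w * (M * ∑ i, Real.log (max 1 (S.ab i (P p)))) = M * Hc (P p) := by
    rw [← S.hc _ (hPF p)]; ring
  have k2 : S.w * ∑ i, ar i ≤ Real.log (((J' + 1 : ℕ) : ℝ) * Fintype.card κ) := by
    simp only [ar]
    rw [Finset.sum_ite_mem, Finset.univ_inter, Finset.sum_const, nsmul_eq_mul, ← mul_assoc]
    have := S.w_arch
    have h0 := Real.log_nonneg hJκ
    nlinarith
  have k3 : S.w * ∑ i, ∑ l ∈ Finset.range (J' + 1), ∑ s, Real.log (max 1 (S.ab i (cc l s))) ≤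
      ∑ l ∈ Finset.range (J' + 1), ∑ s, Hc (cc l s) := by
    rw [Finset.sum_comm, Finset.mul_sum]
    refine Finset.sum_le_sum fun l hl => ?_
    rw [Finset.sum_comm, Finset.mul_sum]
    refine Finset.sum_le_sum fun s _ => ?_
    by_cases h : cc l s = 0
    · simp only [h, map_zero]
      simp [Hc_nonneg]
    · exact (S.hc _ (hcF l hl s h)).le
  have k4 : S.w * (δ * ∑ i, ∑ j, |S.u P i j|) = δ * (2 * ∑ j, Hc (P j)) := by
    rw [← S.sum_u P hPF]; ring
  rw [k1, mul_add, mul_add, k4] at hsum'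
  linarith

/-- the height seminorm attached to a point -/
theorem height_seminorm {n : ℕ} (P : Fin n → QBˣ) : ∃ (ι : Type) (_ : Fintype ι) (w : ℝ) (u : ι → Fin n → ℝ),
    0 < w ∧ (∀ a : Fin n → ℤ, weilHeight (lmon P a : QBˣ) ≤ w * ∑ i, |∑ j, (a j : ℝ) * u i j|) ∧
    (w * ∑ i, ∑ j, |u i j| = 2 * ∑ j, Hc (P j)) := by
  classical
  let F : Finset QB := (Finset.univ.image (fun j => (P j : QB)))
  have hF : ∀ x ∈ F, x ≠ 0 := by
    intro x hx
    simp only [F, Finset.mem_image] at hx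
    obtain ⟨j, _, rfl⟩ := hx
    exact (P j).ne_zero
  have hPF : ∀ j, (P j : QB) ∈ F := fun j => by simp [F]
  have hlm : ∀ a, lmon P a ∈ Subgroup.closure {u : QBˣ | (u : QB) ∈ F} := by
    intro a
    apply Subgroup.prod_mem
    intro j _
    exact Subgroup.zpow_mem _ (Subgroup.subset_closure (show P j ∈ {u : QBˣ | (u : QB) ∈ F} from hPF j)) _
  obtain ⟨S⟩ := place_sys F hF
  refine ⟨S.ι, S.fin, S.w, S.u P, S.w_pos, fun a => ?_, S.sum_u P hPF⟩
  refine (S.weil _ (hlm a)).trans ?_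
  apply mul_le_mul_of_nonneg_left _ S.w_pos.le
  refine Finset.sum_le_sum fun i _ => ?_
  rw [← S.log_lmon]
  rcases le_total 1 (S.ab i (lmon P a : QBˣ)) with h | h
  · rw [max_eq_right h]; exact le_abs_self _
  · rw [max_eq_left h]; simp
end

noncomputable section

lemma qb_countable : Countable QB := by
  rw [← Cardinal.mk_le_aleph0_iff]
  have h := Algebra.IsAlgebraic.cardinalMk_le_max ℚ QB
  simpa using h

lemma onb_exists {r n : ℕ} (a : Fin r → Fin n → ℤ) (ha : LinearIndependent ℤ a) :
    ∃ v : Fin r → EuclideanSpace ℝ (Fin n), Orthonormal ℝ v ∧ ∀ w : Fin n → ℝ,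
      (∀ i, ∑ j, (a i j : ℝ) * w j = 0) → ∀ i, ∑ j, v i j * w j = 0 := by
  have h1 : LinearIndependent ℝ (fun i => (fun j => (a i j : ℝ) : Fin n → ℝ)) := by
    have h2 := (linearIndependent_algebraMap_comp_iff (R := ℤ) (S := ℝ) (v := a)).2 ha
    exact h2
  have h2 : LinearIndependent ℝ (fun i => (WithLp.toLp 2 (fun j => (a i j : ℝ)) : EuclideanSpace ℝ (Fin n))) := by
    have := h1.map' (WithLp.linearEquiv 2 ℝ (Fin n → ℝ)).symm.toLinearMap (LinearEquiv.ker _)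
    exact this
  refine ⟨InnerProductSpace.gramSchmidtNormed ℝ _, InnerProductSpace.gramSchmidtNormed_orthonormal h2, ?_⟩
  intro w hw i
  set W : EuclideanSpace ℝ (Fin n) := WithLp.toLp 2 w
  have hin : ∀ x : EuclideanSpace ℝ (Fin n), inner ℝ W x = ∑ j, x j * w j := by
    intro x
    simp [W, PiLp.inner_apply]
  rw [← hin]
  have hmem : InnerProductSpace.gramSchmidt ℝ (fun i => (WithLp.toLp 2 (fun j => (a i j : ℝ)) : EuclideanSpace ℝ (Fin n))) i
     ∈ (Submodule.span ℝ {W})ᗮ := by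
    have h3 := InnerProductSpace.gramSchmidt_mem_span ℝ (fun i => (WithLp.toLp 2 (fun j => (a i j : ℝ)) : EuclideanSpace ℝ (Fin n))) (le_refl i)
    refine (Submodule.span_le.2 ?_) h3
    rintro _ ⟨j, _, rfl⟩
    rw [SetLike.mem_coe, Submodule.mem_orthogonal_singleton_iff_inner_right, hin]
    exact hw j
  rw [Submodule.mem_orthogonal_singleton_iff_inner_right] at hmem
  rw [InnerProductSpace.gramSchmidtNormed, inner_smul_right, hmem, mul_zero]

lemma onb_lim {r n : ℕ} (v : ℕ → Fin r → EuclideanSpace ℝ (Fin n)) (hv : ∀ m, Orthonormal ℝ (v m)) :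
    ∃ (u : Fin r → Fin n → ℝ) (φ : ℕ → ℕ), StrictMono φ ∧ LinearIndependent ℝ u ∧
      ∀ ε > 0, ∀ᶠ m in Filter.atTop, ∀ i j, |u i j - v (φ m) i j| ≤ ε := by
  obtain ⟨u, -, φ, hφ, hu⟩ := (isCompact_closedBall (0 : Fin r → EuclideanSpace ℝ (Fin n)) 1).tendsto_subseq
    (x := v) (fun m => by
      rw [mem_closedBall_zero_iff, pi_norm_le_iff_of_nonneg zero_le_one]
      intro i; rw [(hv m).1 i])
  have hui : ∀ i, Filter.Tendsto (fun m => v (φ m) i) Filter.atTop (nhds (u i)) := fun i =>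
    (tendsto_pi_nhds.1 hu) i
  have hon : Orthonormal ℝ u := by
    rw [orthonormal_iff_ite]
    intro i j
    have h1 := (hui i).inner (𝕜 := ℝ) (hui j)
    have h2 : (fun m => inner ℝ (v (φ m) i) (v (φ m) j)) = fun _ => (if i = j then (1 : ℝ) else 0) :=
      funext fun m => (orthonormal_iff_ite.1 (hv (φ m))) i j
    rw [h2] at h1
    exact tendsto_nhds_unique h1 tendsto_const_nhds
  refine ⟨fun i j => u i j, φ, hφ, ?_, ?_⟩
  · have := hon.linearIndependent.map' (WithLp.linearEquiv 2 ℝ (Fin n → ℝ)).toLinearMap (LinearEquiv.ker _)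
    exact this
  · intro ε hε
    rw [Filter.eventually_all]; intro i
    rw [Filter.eventually_all]; intro j
    have h1 : Filter.Tendsto (fun m => v (φ m) i j) Filter.atTop (nhds (u i j)) :=
      ((EuclideanSpace.proj (𝕜 := ℝ) j).continuous.tendsto (u i)).comp (hui i)
    filter_upwards [(Metric.tendsto_nhds.1 h1) ε hε] with m hm
    rw [Real.dist_eq, abs_sub_comm] at hm
    exact hm.le

lemma dft_pair {d n B : ℕ} (u v : Fin d → Fin n → ℝ) (s : Fin d → Fin B) (w : Fin n → ℝ) (ε : ℝ)
    (hε : 0 ≤ ε)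
    (huv : ∀ i j, |u i j - v i j| ≤ ε) (hv : ∀ i, ∑ j, v i j * w j = 0) :
    |∑ j, (dftRound u (fun i => (s i : ℕ)) j : ℝ) * w j| ≤ (d * B * ε + 1 / 2) * ∑ j, |w j| := by
  have h0 : ∀ j, |(dftRound u (fun i => (s i : ℕ)) j : ℝ) - ∑ i, ((s i : ℕ) : ℝ) * v i j| ≤ d * B * ε + 1/2 := by
    intro j
    have h1 := abs_sub_round (∑ i, ((s i : ℕ) : ℝ) * u i j)
    have h2 : |∑ i, ((s i : ℕ) : ℝ) * u i j - ∑ i, ((s i : ℕ) : ℝ) * v i j| ≤ d * B * ε := by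
      rw [← Finset.sum_sub_distrib]
      refine (Finset.abs_sum_le_sum_abs _ _).trans ?_
      refine (Finset.sum_le_card_nsmul _ _ (B * ε) ?_).trans (by simp [mul_assoc])
      intro i _
      rw [← mul_sub, abs_mul, Nat.abs_cast]
      have : ((s i : ℕ) : ℝ) ≤ B := by exact_mod_cast (s i).2.le
      exact mul_le_mul this (huv i j) (abs_nonneg _) (by positivity)
    unfold dftRound
    rw [abs_sub_comm] at h1
    calc _ ≤ _ := abs_sub_le _ (∑ i, ((s i : ℕ) : ℝ) * u i j) _
      _ ≤ _ := by linarith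
  have h3 : ∑ j, (∑ i, ((s i : ℕ) : ℝ) * v i j) * w j = 0 := by
    simp_rw [Finset.sum_mul]
    rw [Finset.sum_comm]
    refine Finset.sum_eq_zero fun i _ => ?_
    simp_rw [mul_assoc]
    rw [← Finset.mul_sum, hv, mul_zero]
  have h4 : ∑ j, (dftRound u (fun i => (s i : ℕ)) j : ℝ) * w j =
      ∑ j, ((dftRound u (fun i => (s i : ℕ)) j : ℝ) - ∑ i, ((s i : ℕ) : ℝ) * v i j) * w j := by
    simp_rw [sub_mul]
    rw [Finset.sum_sub_distrib, h3, sub_zero]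
  rw [h4, Finset.mul_sum]
  refine (Finset.abs_sum_le_sum_abs _ _).trans (Finset.sum_le_sum fun j _ => ?_)
  rw [abs_mul]
  exact mul_le_mul_of_nonneg_right (h0 j) (abs_nonneg _)

def evP {A : Type} [CommRing A] [Algebra QB A] {n : ℕ} (ψ : A →ₐ[QB] QB) (x : Fin n → Aˣ) : Fin n → QBˣ :=
  fun j => Units.map (ψ : A →* QB) (x j)

lemma evP_lmon {A : Type} [CommRing A] [Algebra QB A] {n : ℕ} (ψ : A →ₐ[QB] QB) (x : Fin n → Aˣ)
    (a : Fin n → ℤ) : ψ ((lmon x a : Aˣ) : A) = ((lmon (evP ψ x) a : QBˣ) : QB) := by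
  rw [lmon_map, lmon, Units.coe_prod]
  refine Finset.prod_congr rfl fun j _ => ?_
  rw [Units.val_zpow_eq_zpow_val]; rfl

/-- Bounded height, abstract form. -/
theorem height_not_tendsto {A : Type} [CommRing A]
    [IsDomain A] [Algebra QB A] [Algebra.FiniteType QB A] {n r d : ℕ}
    (htr : Algebra.trdeg QB A = d) (x : Fin n → Aˣ)
    (hna : ∀ e (a : Fin e → Fin n → ℤ), LinearIndependent ℤ a → ∃ (ρ : ℕ) (f : Fin ρ → Fin e),
      AlgebraicIndependent QB (fun i => ((lmon x (a (f i)) : Aˣ) : A)) ∧ (d ≤ ρ ∨ d + e ≤ r + ρ))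
    (ψ : ℕ → (A →ₐ[QB] QB))
    (hdense : ∀ f : A, f ≠ 0 → ∀ᶠ m in Filter.atTop, ψ m f ≠ 0)
    (hrel : ∀ m, ∃ a : Fin r → Fin n → ℤ, LinearIndependent ℤ a ∧ ∀ i, lmon (evP (ψ m) x) (a i) = 1) :
    ¬ Filter.Tendsto (fun m => ∑ j, Hc (evP (ψ m) x j)) Filter.atTop Filter.atTop := by
  intro hT
  have := qb_countable
  let _ : Algebra QB ℂ := embI.toAlgebra
  choose a ha1 ha2 using hrel
  choose v hv1 hv2 using fun m => onb_exists (a m) (ha1 m)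
  obtain ⟨u, φ, hφ, hu, hlim⟩ := onb_lim v hv1
  obtain ⟨i, J, hJ, hR⟩ := rel_main htr x u hu hna
  set M : ℕ := 2 * n + 1 with hM
  choose J' cc hrel0 hne0 using fun p => hR M (by omega) p
  set ε : ℝ := 1 / (2 * (d * (J * M) + 1)) with hε
  have hε0 : 0 < ε := by positivity
  set C : ℝ := ∑ p, (Real.log (((J' p + 1 : ℕ) : ℝ) * Fintype.card (Fin d → Fin (J * M))) +
     ∑ l ∈ Finset.range (J' p + 1), ∑ s, Hc (cc p l s)) with hC
  have e1 := hlim ε hε0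
  have e2 : ∀ᶠ m in Filter.atTop, ∀ p, ψ (φ m) (∑ s, cc p (J' p) s • ((lmon x (dftRound (fun l => u (i l)) (fun i => (s i : ℕ))) : Aˣ) : A)) ≠ 0 := by
    rw [Filter.eventually_all]
    intro p
    exact hφ.tendsto_atTop.eventually (hdense _ (hne0 p))
  have e3 := (hT.comp hφ.tendsto_atTop).eventually_gt_atTop C
  obtain ⟨m, h1, h2, h3⟩ := (e1.and (e2.and e3)).exists
  set P := evP (ψ (φ m)) x with hP
  set H : ℝ := ∑ j, Hc (P j) with hH
  have hH0 : 0 ≤ H := Finset.sum_nonneg fun j _ => Hc_nonneg _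
  have key : ∀ p, (M : ℝ) * Hc (P p) ≤ (Real.log (((J' p + 1 : ℕ) : ℝ) * Fintype.card (Fin d → Fin (J * M))) +
     ∑ l ∈ Finset.range (J' p + 1), ∑ s, Hc (cc p l s)) + 1 * (2 * H) := by
    intro p
    refine rel_height P M (J' p) (cc p) (fun s => dftRound (fun l => u (i l)) (fun i => (s i : ℕ))) p 1 ?_ ?_ ?_
    · have h5 := congrArg (ψ (φ m)) (hrel0 p)
      rw [map_zero, map_sum] at h5
      rw [← h5]
      refine Finset.sum_congr rfl fun l _ => ?_
      rw [map_mul, map_pow, map_sum]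
      congr 1
      refine Finset.sum_congr rfl fun s _ => ?_
      rw [map_smul, evP_lmon, smul_eq_mul]
    · have h5 := h2 p
      rw [map_sum] at h5
      convert h5 using 3
      rename_i s _
      rw [map_smul, evP_lmon, smul_eq_mul]
    · intro w hw s
      have h6 : ∀ i', ∑ j, v (φ m) i' j * w j = 0 :=
        hv2 (φ m) w fun i' => hw _ (ha2 (φ m) i')
      refine (dft_pair (fun l => u (i l)) (fun l j => v (φ m) (i l) j) s w ε hε0.le
        (fun l j => h1 _ _) (fun l => h6 _)).trans ?_
      refine mul_le_mul_of_nonneg_right ?_ (Finset.sum_nonneg fun j _ => abs_nonneg _)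
      have : (d : ℝ) * ((J * M : ℕ) : ℝ) * ε ≤ 1 / 2 := by
        rw [hε]
        push_cast
        rw [mul_one_div, div_le_div_iff₀ (by positivity) (by norm_num)]
        linarith
      linarith
  have hs := Finset.sum_le_sum fun p (_ : p ∈ Finset.univ) => key p
  rw [← Finset.mul_sum, Finset.sum_add_distrib] at hs
  simp only [Finset.sum_const, Finset.card_univ, Fintype.card_fin, nsmul_eq_mul] at hs
  rw [← hC] at hs
  have h3' : C < H := h3
  rw [← hH, hM] at hs
  push_cast at hs
  nlinarith
end

noncomputable section

/-- natural-number valued transcendence degree -/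
def td (k B : Type) [CommRing k] [CommRing B] [Algebra k B] : ℕ := (Algebra.trdeg k B).toNat

lemma trdeg_eq_td (k B : Type) [Field k] [CommRing B] [IsDomain B] [Algebra k B] [Algebra.FiniteType k B] :
    Algebra.trdeg k B = td k B :=
  (Cardinal.cast_toNat_of_lt_aleph0 (trdeg_lt_aleph0_of_finiteType (R := k) (S := B))).symm

lemma exists_tb (k B : Type) [Field k] [CommRing B] [IsDomain B] [Algebra k B] [Algebra.FiniteType k B] :
    ∃ c : Fin (td k B) → B, IsTranscendenceBasis k c := by
  obtain ⟨s, hs⟩ := exists_isTranscendenceBasis k B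
  have h1 := hs.cardinalMk_eq_trdeg
  rw [trdeg_eq_td] at h1
  have hf : Finite s := by
    rw [← Cardinal.lt_aleph0_iff_finite, h1]; exact Cardinal.natCast_lt_aleph0
  have := Fintype.ofFinite s
  have h2 : Fintype.card s = td k B := by
    rw [Cardinal.mk_fintype] at h1; exact_mod_cast h1
  exact ⟨_, hs.comp_equiv (Fintype.equivFinOfCardEq h2).symm⟩

lemma algInd_le_td {k B : Type} [Field k] [CommRing B] [IsDomain B] [Algebra k B] [Algebra.FiniteType k B]
    {ι : Type} [Fintype ι] {c : ι → B} (hc : AlgebraicIndependent k c) : Fintype.card ι ≤ td k B := by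
  have h := hc.cardinalMk_le_trdeg
  rw [trdeg_eq_td, Cardinal.mk_fintype] at h
  exact_mod_cast h

lemma td_le_of_injective {k B C : Type} [Field k] [CommRing B] [IsDomain B] [Algebra k B] [Algebra.FiniteType k B]
    [CommRing C] [IsDomain C] [Algebra k C] [Algebra.FiniteType k C] (φ : B →ₐ[k] C)
    (hφ : Function.Injective φ) : td k B ≤ td k C := by
  obtain ⟨c, hc⟩ := exists_tb k B
  simpa using algInd_le_td (hc.1.map' hφ)

lemma td_le_of_surjective {k B C : Type} [Field k] [CommRing B] [IsDomain B] [Algebra k B] [Algebra.FiniteType k B]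
    [CommRing C] [IsDomain C] [Algebra k C] [Algebra.FiniteType k C] (φ : B →ₐ[k] C)
    (hφ : Function.Surjective φ) : td k C ≤ td k B := by
  obtain ⟨c, hc⟩ := exists_tb k C
  choose b hb using fun i => hφ (c i)
  have : AlgebraicIndependent k b := by
    refine AlgebraicIndependent.of_comp φ ?_
    have : ⇑φ ∘ b = c := funext hb
    rw [this]; exact hc.1
  simpa using algInd_le_td this

lemma td_lt_of_surjective {k B C : Type} [Field k] [CommRing B] [IsDomain B] [Algebra k B] [Algebra.FiniteType k B]
    [CommRing C] [IsDomain C] [Algebra k C] [Algebra.FiniteType k C] (φ : B →ₐ[k] C)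
    (hφ : Function.Surjective φ) (f : B) (hf : f ≠ 0) (hf0 : φ f = 0) : td k C + 1 ≤ td k B := by
  obtain ⟨c, hc⟩ := exists_tb k C
  choose b hb using fun i => hφ (c i)
  have hcb : ⇑φ ∘ b = c := funext hb
  have hbi : AlgebraicIndependent k b := by
    refine AlgebraicIndependent.of_comp φ ?_
    rw [hcb]; exact hc.1
  have hle : td k C ≤ td k B := by simpa using algInd_le_td hbi
  by_contra hlt
  have heq : td k B = td k C := by omega
  have htb : IsTranscendenceBasis k b := by
    refine hbi.isTranscendenceBasis_of_trdeg_le_of_finite ?_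
    rw [trdeg_eq_td, heq, Cardinal.mk_fintype, Fintype.card_fin]
  have halg := htb.isAlgebraic
  have hne := Ideal.comap_ne_bot_of_algebraic_mem (I := RingHom.ker φ) hf hf0 (halg.isAlgebraic f)
  apply hne
  rw [eq_bot_iff]
  rintro ⟨y, hy⟩ hy0
  have hy1 : φ y = 0 := hy0
  rw [Algebra.adjoin_range_eq_range_aeval] at hy
  obtain ⟨p, hp⟩ := hy
  have hp' : MvPolynomial.aeval b p = y := hp
  have h3 : MvPolynomial.aeval c p = 0 := by
    rw [← hcb, ← hy1, ← hp']
    exact (congrArg (fun F : MvPolynomial _ k →ₐ[k] C => F p) (MvPolynomial.comp_aeval b φ)).symm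
  have h4 : p = 0 := hc.1.eq_zero_of_aeval_eq_zero p h3
  rw [Submodule.mem_bot]
  apply Subtype.ext
  change y = 0
  rw [← hp', h4, map_zero]

/-- principal ideal theorem, transcendence degree form -/
theorem pit {k B : Type} [Field k] [CommRing B] [IsDomain B] [Algebra k B] [Algebra.FiniteType k B]
    (f : B) (hf : f ≠ 0) (m : Ideal B) [m.IsPrime] (hfm : f ∈ m) :
    ∃ q : Ideal B, q.IsPrime ∧ f ∈ q ∧ q ≤ m ∧ td k B ≤ td k (B ⧸ q) + 1 := by
  have hN : IsNoetherianRing B := Algebra.FiniteType.isNoetherianRing k B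
  obtain ⟨q, hq, hqm⟩ := Ideal.exists_minimalPrimes_le (I := Ideal.span {f}) (J := m)
    ((Ideal.span_singleton_le_iff_mem _).2 hfm)
  have hqp : q.IsPrime := hq.1.1
  have hfq : f ∈ q := hq.1.2 (Ideal.mem_span_singleton_self f)
  refine ⟨q, hqp, hfq, hqm, ?_⟩
  have hh := Ideal.height_le_one_of_isPrincipal_of_mem_minimalPrimes (Ideal.span {f}) q hq
  obtain ⟨s, g, ginj, gint⟩ := exists_integral_inj_algHom_of_fg k B
  let _ : Algebra (MvPolynomial (Fin s) k) B := g.toRingHom.toAlgebra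
  have hga : ∀ x, algebraMap (MvPolynomial (Fin s) k) B x = g x := fun _ => rfl
  have _ : IsScalarTower k (MvPolynomial (Fin s) k) B := IsScalarTower.of_algebraMap_eq fun x => by
    rw [hga, MvPolynomial.algebraMap_eq, ← MvPolynomial.algebraMap_eq, AlgHom.commutes]
  have _ : Algebra.IsIntegral (MvPolynomial (Fin s) k) B := ⟨gint⟩
  have _ : FaithfulSMul (MvPolynomial (Fin s) k) B := (faithfulSMul_iff_algebraMap_injective _ _).2 ginj
  set p : Ideal (MvPolynomial (Fin s) k) := q.under _ with hp
  have _ : q.LiesOver p := ⟨rfl⟩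
  have hpp : p.IsPrime := inferInstance
  have hpm : ∀ x, x ∈ p ↔ g x ∈ q := fun x => Iff.rfl
  have h1 := Ideal.height_eq_height_add_of_liesOver_of_hasGoingDown p q
  have hp1 : p.height ≤ 1 := le_trans (by rw [h1]; exact le_self_add) hh
  have hpbot : p ≠ ⊥ := Ideal.comap_ne_bot_of_integral_mem hf hfq (Algebra.IsIntegral.isIntegral f)
  have hp2 : p.height = 1 := by
    refine le_antisymm hp1 ?_
    rw [ENat.one_le_iff_ne_zero]
    intro h0
    exact hpbot (Ideal.height_eq_zero_iff_eq_bot.1 h0)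
  have hpr := UniqueFactorizationMonoid.isPrincipal_of_height_eq_one hp2
  obtain ⟨π, hπ⟩ := hpr.principal
  have hπmem : ∀ x, x ∈ p ↔ π ∣ x := by
    intro x
    rw [hπ]; exact Ideal.mem_span_singleton
  have hπ0 : π ≠ 0 := by
    rintro rfl
    apply hpbot
    rw [hπ]; simp
  have hex : ∃ i, MvPolynomial.degreeOf i π ≠ 0 := by
    by_contra hcon
    push Not at hcon
    have h0 : π.totalDegree = 0 := by
      rw [MvPolynomial.totalDegree_eq_zero_iff]
      intro m hm i
      have := MvPolynomial.degreeOf_eq_sup i π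
      rw [hcon] at this
      have h2 : m i ≤ π.support.sup fun m => m i := Finset.le_sup (f := fun m => m i) hm
      omega
    rw [MvPolynomial.totalDegree_eq_zero_iff_eq_C] at h0
    have hu : IsUnit π := by
      rw [h0]
      refine IsUnit.map _ (IsUnit.mk0 _ ?_)
      intro h00
      rw [h00] at h0
      exact hπ0 (by simpa using h0)
    exact hpp.ne_top ((Ideal.eq_top_iff_one _).2 ((hπmem 1).2 hu.dvd))
  obtain ⟨i, hi⟩ := hex
  have hind : AlgebraicIndependent k (fun j : {j : Fin s // j ≠ i} => (Ideal.Quotient.mkₐ k q) (g (MvPolynomial.X (j : Fin s)))) := by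
    rw [algebraicIndependent_iff]
    intro F hF
    by_contra hF0
    have h5 : MvPolynomial.aeval (fun j : {j : Fin s // j ≠ i} => (Ideal.Quotient.mkₐ k q) (g (MvPolynomial.X (j : Fin s)))) =
        ((Ideal.Quotient.mkₐ k q).comp g).comp (MvPolynomial.rename (fun j : {j : Fin s // j ≠ i} => (j : Fin s))) := by
      ext j; simp
    rw [h5] at hF
    have h6 : MvPolynomial.rename (fun j : {j : Fin s // j ≠ i} => (j : Fin s)) F ∈ p := by
      rw [hpm]
      exact Ideal.Quotient.eq_zero_iff_mem.1 hF
    obtain ⟨G, hG⟩ := (hπmem _).1 h6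
    have h7 : MvPolynomial.rename (fun j : {j : Fin s // j ≠ i} => (j : Fin s)) F ≠ 0 := by
      intro h
      exact hF0 (MvPolynomial.rename_injective _ Subtype.val_injective (by rw [h, map_zero]))
    have hG0 : G ≠ 0 := by
      rintro rfl
      exact h7 (by rw [hG, mul_zero])
    have h8 := congrArg (MvPolynomial.degreeOf i) hG
    rw [MvPolynomial.degreeOf_mul_eq hπ0 hG0] at h8
    have h9 : MvPolynomial.degreeOf i (MvPolynomial.rename (fun j : {j : Fin s // j ≠ i} => (j : Fin s)) F) = 0 := by
      by_contra hcon
      have h10 : i ∈ (MvPolynomial.rename (fun j : {j : Fin s // j ≠ i} => (j : Fin s)) F).vars := by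
        rw [MvPolynomial.mem_vars]
        by_contra hc2
        push Not at hc2
        apply hcon
        rw [MvPolynomial.degreeOf_eq_sup]
        apply Nat.le_zero.1
        refine Finset.sup_le fun m hm => ?_
        have := hc2 m hm
        simp at this
        omega
      classical
      have h11 := MvPolynomial.vars_rename (fun j : {j : Fin s // j ≠ i} => (j : Fin s)) F h10
      rw [Finset.mem_image] at h11
      obtain ⟨j, -, hj⟩ := h11
      exact j.2 hj
    omega
  have h12 := algInd_le_td hind
  have h13 : Fintype.card {j : Fin s // j ≠ i} = s - 1 := by simp
  have h14 : td k B ≤ s := by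
    have h15 := _root_.trdeg_add_eq k (MvPolynomial (Fin s) k) (A := B)
    rw [trdeg_eq_zero (R := MvPolynomial (Fin s) k) (A := B), add_zero, MvPolynomial.trdeg_of_isDomain, trdeg_eq_td] at h15
    simp at h15
    omega
  omega
end

noncomputable section

theorem cut_finset {k B : Type} [Field k] [CommRing B] [IsDomain B] [Algebra k B] [Algebra.FiniteType k B]
    (m : Ideal B) [hm : m.IsPrime] (s : Finset B) (hs : ∀ f ∈ s, f ∈ m) :
    ∃ q : Ideal B, q.IsPrime ∧ (∀ f ∈ s, f ∈ q) ∧ q ≤ m ∧ td k B ≤ td k (B ⧸ q) + s.card := by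
  classical
  induction s using Finset.induction_on with
  | empty =>
    refine ⟨⊥, Ideal.isPrime_bot, by simp, bot_le, ?_⟩
    have _ : (⊥ : Ideal B).IsPrime := Ideal.isPrime_bot
    have : Function.Injective (Ideal.Quotient.mkₐ k (⊥ : Ideal B)) := by
      rw [injective_iff_map_eq_zero]
      intro a ha
      exact Ideal.Quotient.eq_zero_iff_mem.1 ha
    have := td_le_of_injective _ this
    simpa using this
  | insert f s hfs ih =>
    obtain ⟨q, hq, h1, h2, h3⟩ := ih fun g hg => hs g (Finset.mem_insert_of_mem hg)
    rw [Finset.card_insert_of_notMem hfs]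
    by_cases hf : f ∈ q
    · exact ⟨q, hq, fun g hg => (Finset.mem_insert.1 hg).elim (fun h => h ▸ hf) (h1 g), h2, by omega⟩
    · have hsur := Ideal.Quotient.mkₐ_surjective k q
      have hmp : (m.map (Ideal.Quotient.mkₐ k q)).IsPrime :=
        Ideal.map_isPrime_of_surjective hsur (by
          intro z hz
          exact h2 (Ideal.Quotient.eq_zero_iff_mem.1 hz))
      obtain ⟨q', hq', hf', hle, htd⟩ := pit (k := k) (Ideal.Quotient.mkₐ k q f)
        (fun h => hf (Ideal.Quotient.eq_zero_iff_mem.1 h)) (m.map (Ideal.Quotient.mkₐ k q))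
        (Ideal.mem_map_of_mem _ (hs f (Finset.mem_insert_self _ _)))
      have hqc : q ≤ q'.comap (Ideal.Quotient.mkₐ k q) := by
        intro z hz
        rw [Ideal.mem_comap]
        have : Ideal.Quotient.mkₐ k q z = 0 := Ideal.Quotient.eq_zero_iff_mem.2 hz
        rw [this]; exact zero_mem _
      refine ⟨q'.comap (Ideal.Quotient.mkₐ k q), Ideal.comap_isPrime _ _, ?_, ?_, ?_⟩
      · intro g hg
        rcases Finset.mem_insert.1 hg with rfl | h
        · exact hf'
        · exact hqc (h1 g h)
      · intro z hz
        have hz1 := hle hz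
        rw [Ideal.mem_map_iff_of_surjective _ hsur] at hz1
        obtain ⟨y, hy, hyz⟩ := hz1
        have : y - z ∈ q := Ideal.Quotient.eq_zero_iff_mem.1 (by
          have : Ideal.Quotient.mkₐ k q (y - z) = 0 := by rw [map_sub, hyz, sub_self]
          exact this)
        have h5 := m.sub_mem hy (h2 this)
        simpa using h5
      · have hpr : (q'.comap (Ideal.Quotient.mkₐ k q)).IsPrime := Ideal.comap_isPrime _ _
        let θ : (B ⧸ q'.comap (Ideal.Quotient.mkₐ k q)) →ₐ[k] ((B ⧸ q) ⧸ q') :=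
          Ideal.quotientMapₐ q' (Ideal.Quotient.mkₐ k q) le_rfl
        have hθ : Function.Surjective θ := Ideal.quotientMap_surjective (H := le_rfl) hsur
        have := td_le_of_surjective θ hθ
        omega

theorem height_le_td {k B : Type} [Field k] [CommRing B] [IsDomain B] [Algebra k B] [Algebra.FiniteType k B]
    (p : Ideal B) [hp : p.IsPrime] : p.height ≤ td k B := by
  have key : ∀ l : LTSeries (PrimeSpectrum B), l.length ≤ td k B := by
    intro l
    have h : ∀ i : Fin (l.length + 1), (i : ℕ) + td k (B ⧸ (l i).asIdeal) ≤ td k B := by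
      intro i
      induction i using Fin.induction with
      | zero =>
        have := td_le_of_surjective _ (Ideal.Quotient.mkₐ_surjective k (l 0).asIdeal)
        simpa using this
      | succ i ih =>
        have hlt : (l i.castSucc).asIdeal < (l i.succ).asIdeal := l.step i
        obtain ⟨f, hf1, hf2⟩ := Set.exists_of_ssubset hlt
        have hsur : Function.Surjective (Ideal.Quotient.factorₐ k hlt.le) := Ideal.Quotient.factor_surjective hlt.le
        have := td_lt_of_surjective (Ideal.Quotient.factorₐ k hlt.le) hsur (Ideal.Quotient.mk _ f)
          (fun h => hf2 (Ideal.Quotient.eq_zero_iff_mem.1 h)) (Ideal.Quotient.eq_zero_iff_mem.2 hf1)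
        rw [Fin.val_castSucc] at ih
        rw [Fin.val_succ]
        omega
    have := h (Fin.last _)
    simp at this
    omega
  have _ : IsNoetherianRing B := Algebra.FiniteType.isNoetherianRing k B
  obtain ⟨l, _, hl⟩ := p.exists_ltSeries_length_eq_height
  rw [← hl]
  exact_mod_cast key l

theorem fibre {k B : Type} [Field k] [CommRing B] [IsDomain B] [Algebra k B] [Algebra.FiniteType k B]
    (E : Subalgebra k B) (hE : E.FG) (m : Ideal B) [hm : m.IsPrime] :
    ∃ q : Ideal B, q.IsPrime ∧ (∀ f ∈ E, f ∈ m → f ∈ q) ∧ q ≤ m ∧ td k B ≤ td k (B ⧸ q) + td k E := by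
  classical
  have _ : Algebra.FiniteType k E := (Subalgebra.fg_iff_finiteType E).1 hE
  have _ : IsNoetherianRing E := Algebra.FiniteType.isNoetherianRing k E
  set p : Ideal E := m.comap (algebraMap E B) with hp
  have hpp : p.IsPrime := Ideal.comap_isPrime _ _
  obtain ⟨s, hs, hcard⟩ := p.exists_finset_card_eq_height_of_isNoetherianRing
  have hc : s.card ≤ td k E := by
    have := height_le_td (k := k) p
    rw [← hcard] at this
    exact_mod_cast this
  obtain ⟨q, hq, h1, h2, h3⟩ := cut_finset (k := k) m (s.image (algebraMap E B)) (by
    intro f hf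
    obtain ⟨g, hg, rfl⟩ := Finset.mem_image.1 hf
    exact hs.1.2 (Ideal.subset_span hg))
  refine ⟨q, hq, ?_, h2, h3.trans (by have := Finset.card_image_le (s := s) (f := algebraMap E B); omega)⟩
  intro f hf hfm
  have hqp : (q.comap (algebraMap E B)).IsPrime := Ideal.comap_isPrime _ _
  have hle : p ≤ q.comap (algebraMap E B) := by
    refine hs.2 ⟨hqp, ?_⟩ (Ideal.comap_mono h2)
    rw [Ideal.span_le]
    intro g hg
    exact h1 _ (Finset.mem_image_of_mem _ hg)
  exact hle (x := ⟨f, hf⟩) hfm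
end

noncomputable section
open MvPolynomial

abbrev RR (n : ℕ) : Type := MvPolynomial (Fin n ⊕ Fin n) QB

def evc {n : ℕ} (x : TorusPt n) : Fin n ⊕ Fin n → QB :=
  Sum.elim (fun i => (x i : QB)) (fun i => ((x i)⁻¹ : QBˣ))

def ev {n : ℕ} (x : TorusPt n) : RR n →ₐ[QB] QB := aeval (evc x)

def vI {n : ℕ} (Y : Set (TorusPt n)) : Ideal (RR n) := vanishingIdeal QB (evc '' Y)

lemma mem_vI {n : ℕ} {Y : Set (TorusPt n)} {f : RR n} : f ∈ vI Y ↔ ∀ y ∈ Y, ev y f = 0 := by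
  simp [vI, ev]

def vZ {n : ℕ} (I : Ideal (RR n)) : Set (TorusPt n) := {x | ∀ f ∈ I, ev x f = 0}

lemma ev_poly {n : ℕ} (f : RR n) : ∃ (N : ℕ) (g : MvPolynomial (Fin n) QB),
    ∀ x : TorusPt n, eval (fun i => (x i : QB)) g = (∏ i, (x i : QB)) ^ N * ev x f := by
  classical
  induction f using MvPolynomial.induction_on with
  | C a => exact ⟨0, C a, fun x => by simp [ev]⟩
  | add p q hp hq =>
    obtain ⟨N, g, hg⟩ := hp
    obtain ⟨M, h, hh⟩ := hq
    refine ⟨N + M, (∏ i, X i) ^ M * g + (∏ i, X i) ^ N * h, fun x => ?_⟩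
    rw [map_add, map_mul, map_mul, hg, hh, map_add]
    simp only [map_pow, map_prod, eval_X]
    ring
  | mul_X p i hp =>
    obtain ⟨N, g, hg⟩ := hp
    cases i with
    | inl i =>
      refine ⟨N, g * X i, fun x => ?_⟩
      rw [map_mul, hg, map_mul]
      simp [ev, evc, mul_assoc]
    | inr i =>
      refine ⟨N + 1, g * ∏ j ∈ Finset.univ.erase i, X j, fun x => ?_⟩
      rw [map_mul, hg, map_mul, map_prod]
      simp only [eval_X]
      have h1 : ev x (X (Sum.inr i)) = ((x i : QB))⁻¹ := by simp [ev, evc]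
      have h2 := Finset.mul_prod_erase Finset.univ (fun j => (x j : QB)) (Finset.mem_univ i)
      rw [h1, pow_succ, ← h2]
      have h3 : (x i : QB) ≠ 0 := (x i).ne_zero
      field_simp

lemma ev_zero_poly {n : ℕ} (f : RR n) : ∃ (g : MvPolynomial (Fin n) QB),
    ∀ x : TorusPt n, eval (fun i => (x i : QB)) g = 0 ↔ ev x f = 0 := by
  obtain ⟨N, g, hg⟩ := ev_poly f
  refine ⟨g, fun x => ?_⟩
  rw [hg, mul_eq_zero, or_iff_right]
  exact pow_ne_zero _ (Finset.prod_ne_zero_iff.2 fun i _ => (x i).ne_zero)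

lemma vZ_closed {n : ℕ} (I : Ideal (RR n)) : ZClosed (vZ I) := by
  choose g hg using fun f : RR n => ev_zero_poly f
  refine ⟨g '' (I : Set (RR n)), ?_⟩
  ext x
  constructor
  · rintro hx _ ⟨f, hf, rfl⟩
    exact (hg f x).2 (hx f hf)
  · intro hx f hf
    exact (hg f x).1 (hx _ ⟨f, hf, rfl⟩)

lemma ev_rename {n : ℕ} (x : TorusPt n) (g : MvPolynomial (Fin n) QB) :
    ev x (rename Sum.inl g) = eval (fun i => (x i : QB)) g := by
  rw [ev, aeval_rename, MvPolynomial.aeval_eq_eval]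
  rfl

lemma vZ_vI {n : ℕ} {Y : Set (TorusPt n)} (hY : ZClosed Y) : vZ (vI Y) = Y := by
  apply Set.Subset.antisymm
  · obtain ⟨I, hI⟩ := hY
    intro x hx
    rw [hI]
    intro f hf
    rw [← ev_rename]
    refine hx _ (mem_vI.2 fun y hy => ?_)
    rw [ev_rename]
    rw [hI] at hy
    exact hy f hf
  · intro x hx f hf
    exact mem_vI.1 hf x hx

lemma vI_anti {n : ℕ} {Y Z : Set (TorusPt n)} (h : Y ⊆ Z) : vI Z ≤ vI Y := fun _ hf =>
  mem_vI.2 fun y hy => mem_vI.1 hf y (h hy)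

lemma le_of_vI {n : ℕ} {Y Z : Set (TorusPt n)} (hZ : ZClosed Z) (h : vI Z ≤ vI Y) : Y ⊆ Z := by
  rw [← vZ_vI hZ]
  exact fun y hy f hf => mem_vI.1 (h hf) y hy

lemma tor_mem {n : ℕ} (Y : Set (TorusPt n)) (i : Fin n) :
    (X (Sum.inl i) * X (Sum.inr i) - 1 : RR n) ∈ vI Y := mem_vI.2 fun y _ => by simp [ev, evc]

lemma vI_vZ {n : ℕ} {q : Ideal (RR n)} [hq : q.IsPrime]
    (ht : ∀ i : Fin n, (X (Sum.inl i) * X (Sum.inr i) - 1 : RR n) ∈ q) : vI (vZ q) = q := by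
  have h1 := MvPolynomial.vanishingIdeal_zeroLocus_eq_radical (K := QB) q
  rw [hq.isRadical.radical] at h1
  have h2 : evc '' (vZ q) = zeroLocus QB q := by
    ext z
    constructor
    · rintro ⟨x, hx, rfl⟩
      exact hx
    · intro hz
      have h3 : ∀ i, z (Sum.inl i) * z (Sum.inr i) = 1 := by
        intro i
        have := hz _ (ht i)
        simpa [sub_eq_zero] using this
      have h5 : evc (fun i => (⟨z (Sum.inl i), z (Sum.inr i), h3 i, by rw [mul_comm]; exact h3 i⟩ : QBˣ)) = z := by
        ext i
        cases i <;> rfl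
      refine ⟨_, ?_, h5⟩
      intro f hf
      rw [ev, h5]
      exact hz f hf
  rw [vI, h2, h1]

lemma ZIrred.prime {n : ℕ} {Y : Set (TorusPt n)} (h : ZIrred Y) : (vI Y).IsPrime := by
  obtain ⟨⟨y, hy⟩, h⟩ := h
  refine ⟨?_, ?_⟩
  · intro htop
    have := mem_vI.1 ((Ideal.eq_top_iff_one _).1 htop) y hy
    simp at this
  · intro f g hfg
    have hc : ∀ f : RR n, f ∈ vI (vZ (Ideal.span {f})) := fun f =>
      mem_vI.2 fun y hy => hy f (Ideal.mem_span_singleton_self f)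
    rcases h (vZ (Ideal.span {f})) (vZ (Ideal.span {g})) (vZ_closed _) (vZ_closed _) (by
      intro y hy
      have h1 := mem_vI.1 hfg y hy
      rw [map_mul, mul_eq_zero] at h1
      refine h1.imp ?_ ?_
      all_goals
        intro h2 f' hf'
        obtain ⟨t, rfl⟩ := Ideal.mem_span_singleton.1 hf'
        rw [map_mul, h2, zero_mul]) with h1 | h1
    · exact Or.inl (vI_anti h1 (hc f))
    · exact Or.inr (vI_anti h1 (hc g))

lemma ZIrred.of_prime {n : ℕ} {Y : Set (TorusPt n)} (h : (vI Y).IsPrime) : ZIrred Y := by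
  constructor
  · by_contra hne
    rw [Set.not_nonempty_iff_eq_empty] at hne
    apply h.ne_top
    rw [Ideal.eq_top_iff_one, mem_vI, hne]
    simp
  · intro Z₁ Z₂ h1 h2 h12
    by_contra hcon
    push Not at hcon
    obtain ⟨hc1, hc2⟩ := hcon
    have k1 : ¬ vI Z₁ ≤ vI Y := fun h => hc1 (le_of_vI h1 h)
    have k2 : ¬ vI Z₂ ≤ vI Y := fun h => hc2 (le_of_vI h2 h)
    obtain ⟨f, hf, hf'⟩ := SetLike.not_le_iff_exists.1 k1
    obtain ⟨g, hg, hg'⟩ := SetLike.not_le_iff_exists.1 k2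
    have : f * g ∈ vI Y := mem_vI.2 fun y hy => by
      rw [map_mul, mul_eq_zero]
      exact (h12 hy).imp (fun h => mem_vI.1 hf y h) (fun h => mem_vI.1 hg y h)
    exact (h.mem_or_mem this).elim hf' hg'

/-- irreducible closed subset -/
structure Irr {n : ℕ} (Y : Set (TorusPt n)) : Prop where
  cl : ZClosed Y
  pr : (vI Y).IsPrime

lemma Irr.irred {n : ℕ} {Y : Set (TorusPt n)} (h : Irr Y) : ZIrred Y := ZIrred.of_prime h.pr
lemma irr_of {n : ℕ} {Y : Set (TorusPt n)} (h : ZClosed Y) (h' : ZIrred Y) : Irr Y := ⟨h, h'.prime⟩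

abbrev AA {n : ℕ} (Y : Set (TorusPt n)) : Type := RR n ⧸ vI Y

def tdY {n : ℕ} (Y : Set (TorusPt n)) : ℕ := td QB (AA Y)

lemma irr_vZ {n : ℕ} {Y : Set (TorusPt n)} {q : Ideal (RR n)} (hq : q.IsPrime) (h : vI Y ≤ q) :
    Irr (vZ q) ∧ vI (vZ q) = q := by
  have h1 := vI_vZ (q := q) fun i => h (tor_mem Y i)
  exact ⟨⟨vZ_closed q, by rw [h1]; exact hq⟩, h1⟩

lemma tdY_lt {n : ℕ} {Y Z : Set (TorusPt n)} (hY : Irr Y) (hZ : Irr Z) (h : Y ⊂ Z) : tdY Y + 1 ≤ tdY Z := by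
  have _ := hY.pr
  have _ := hZ.pr
  have hle := vI_anti h.1
  obtain ⟨f, hf1, hf2⟩ := SetLike.not_le_iff_exists.1 (fun h' : vI Y ≤ vI Z => h.2 (le_of_vI hY.cl h'))
  exact td_lt_of_surjective (Ideal.Quotient.factorₐ QB hle) (Ideal.Quotient.factor_surjective hle) (Ideal.Quotient.mk _ f)
          (fun h => hf2 (Ideal.Quotient.eq_zero_iff_mem.1 h)) (Ideal.Quotient.eq_zero_iff_mem.2 hf1)

lemma tdY_le {n : ℕ} {Y Z : Set (TorusPt n)} (hY : Irr Y) (hZ : Irr Z) (h : Y ⊆ Z) : tdY Y ≤ tdY Z := by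
  have _ := hY.pr
  have _ := hZ.pr
  exact td_le_of_surjective (Ideal.Quotient.factorₐ QB (vI_anti h)) (Ideal.Quotient.factor_surjective (vI_anti h))

lemma tdY_bdd {n : ℕ} {Y : Set (TorusPt n)} (hY : Irr Y) : tdY Y ≤ td QB (RR n) := by
  have _ := hY.pr
  exact td_le_of_surjective _ (Ideal.Quotient.mkₐ_surjective QB (vI Y))

lemma irr_pt {n : ℕ} (P : TorusPt n) : Irr ({P} : Set (TorusPt n)) := by
  refine ⟨⟨Set.range fun i => X i - C (P i : QB), ?_⟩, ?_⟩
  · ext x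
    rw [Set.mem_singleton_iff]
    constructor
    · rintro rfl _ ⟨i, rfl⟩
      simp
    · intro h
      funext i
      have := h _ ⟨i, rfl⟩
      rw [map_sub, eval_X, eval_C, sub_eq_zero] at this
      exact Units.ext this
  · rw [vI, Set.image_singleton]; infer_instance

end

noncomputable section
open MvPolynomial

lemma zpow_split {F : Type} [Field F] (x : Fˣ) (m : ℤ) :
    ((x ^ m : Fˣ) : F) = (x : F) ^ m.toNat * ((x⁻¹ : Fˣ) : F) ^ (-m).toNat := by
  rcases le_total 0 m with h | h
  · obtain ⟨k, rfl⟩ := Int.eq_ofNat_of_zero_le h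
    simp
  · obtain ⟨k, hk⟩ := Int.eq_ofNat_of_zero_le (neg_nonneg.2 h)
    have : m = -(k : ℤ) := by omega
    subst this
    simp

def LM {n : ℕ} (a : Fin n → ℤ) : RR n :=
  ∏ j, (X (Sum.inl j) ^ (a j).toNat * X (Sum.inr j) ^ (-(a j)).toNat)

lemma ev_LM {n : ℕ} (x : TorusPt n) (a : Fin n → ℤ) : ev x (LM a) = ((lmon x a : QBˣ) : QB) := by
  rw [LM, map_prod, lmon, Units.coe_prod]
  refine Finset.prod_congr rfl fun j _ => ?_
  rw [zpow_split]
  simp [ev, evc]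

def xx {n : ℕ} (Y : Set (TorusPt n)) : Fin n → (AA Y)ˣ := fun i =>
  ⟨Ideal.Quotient.mk _ (X (Sum.inl i)), Ideal.Quotient.mk _ (X (Sum.inr i)),
   by rw [← map_mul, ← map_one (Ideal.Quotient.mk (vI Y)), Ideal.Quotient.eq]; exact tor_mem Y i,
   by rw [← map_mul, ← map_one (Ideal.Quotient.mk (vI Y)), Ideal.Quotient.eq, mul_comm]; exact tor_mem Y i⟩

def evA {n : ℕ} {Y : Set (TorusPt n)} {P : TorusPt n} (hP : P ∈ Y) : AA Y →ₐ[QB] QB :=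
  Ideal.Quotient.liftₐ (vI Y) (ev P) fun _ hf => mem_vI.1 hf P hP

lemma evA_mk {n : ℕ} {Y : Set (TorusPt n)} {P : TorusPt n} (hP : P ∈ Y) (f : RR n) :
    evA hP (Ideal.Quotient.mk _ f) = ev P f := rfl

lemma evP_evA {n : ℕ} {Y : Set (TorusPt n)} {P : TorusPt n} (hP : P ∈ Y) : evP (evA hP) (xx Y) = P := by
  funext i
  apply Units.ext
  change ev P (X (Sum.inl i)) = _
  simp [ev, evc]

lemma AA_ext {n : ℕ} {Y : Set (TorusPt n)} (f g : AA Y) (h : ∀ P (hP : P ∈ Y), evA hP f = evA hP g) : f = g := by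
  obtain ⟨f, rfl⟩ := Ideal.Quotient.mk_surjective f
  obtain ⟨g, rfl⟩ := Ideal.Quotient.mk_surjective g
  rw [Ideal.Quotient.eq, mem_vI]
  intro y hy
  have := h y hy
  rw [evA_mk, evA_mk] at this
  rw [map_sub, this, sub_self]

lemma evA_lmon {n : ℕ} {Y : Set (TorusPt n)} {P : TorusPt n} (hP : P ∈ Y) (a : Fin n → ℤ) :
    evA hP ((lmon (xx Y) a : (AA Y)ˣ) : AA Y) = ((lmon P a : QBˣ) : QB) := by
  rw [evP_lmon, evP_evA]

lemma mk_LM {n : ℕ} (Y : Set (TorusPt n)) (a : Fin n → ℤ) :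
    (Ideal.Quotient.mk (vI Y) (LM a)) = ((lmon (xx Y) a : (AA Y)ˣ) : AA Y) :=
  AA_ext _ _ fun P hP => by rw [evA_mk, evA_lmon, ev_LM]

def zset {n : ℕ} (S : Set (TorusPt n)) : Set ℕ := {d : ℕ | ∃ Z : Fin (d + 1) → Set (TorusPt n),
    (∀ i, ZClosed (Z i) ∧ ZIrred (Z i) ∧ Z i ⊆ S) ∧
    ∀ i j : Fin (d + 1), i < j → Z i ⊂ Z j}

lemma chain_td {n d : ℕ} (Z : Fin (d + 1) → Set (TorusPt n)) (h1 : ∀ i, Irr (Z i))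
    (h2 : ∀ i j : Fin (d + 1), i < j → Z i ⊂ Z j) : d ≤ tdY (Z (Fin.last d)) := by
  have h : ∀ i : Fin (d + 1), (i : ℕ) ≤ tdY (Z i) := by
    intro i
    induction i using Fin.induction with
    | zero => simp
    | succ i ih =>
      have := tdY_lt (h1 _) (h1 _) (h2 i.castSucc i.succ Fin.castSucc_lt_succ)
      rw [Fin.val_castSucc] at ih
      rw [Fin.val_succ]
      omega
  simpa using h (Fin.last d)

lemma zset_bdd {n : ℕ} (S : Set (TorusPt n)) : BddAbove (zset S) := by
  refine ⟨td QB (RR n), ?_⟩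
  rintro d ⟨Z, h1, h2⟩
  have hi : ∀ i, Irr (Z i) := fun i => irr_of (h1 i).1 (h1 i).2.1
  exact (chain_td Z hi h2).trans (tdY_bdd (hi _))

lemma zdim_le {n N : ℕ} (S : Set (TorusPt n)) (h : ∀ Z, Irr Z → Z ⊆ S → tdY Z ≤ N) : zdim S ≤ N := by
  by_cases hne : (zset S).Nonempty
  · refine csSup_le hne ?_
    rintro d ⟨Z, h1, h2⟩
    have hi : ∀ i, Irr (Z i) := fun i => irr_of (h1 i).1 (h1 i).2.1
    exact (chain_td Z hi h2).trans (h _ (hi _) (h1 _).2.2)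
  · rw [Set.not_nonempty_iff_eq_empty] at hne
    have : zdim S = sSup (zset S) := rfl
    rw [this, hne]
    simp

lemma zdim_mono {n : ℕ} {S T : Set (TorusPt n)} (hne : (zset S).Nonempty) (h : S ⊆ T) : zdim S ≤ zdim T := by
  refine csSup_le_csSup (zset_bdd T) hne ?_
  rintro d ⟨Z, h1, h2⟩
  exact ⟨Z, fun i => ⟨(h1 i).1, (h1 i).2.1, (h1 i).2.2.trans h⟩, h2⟩

lemma zset_ne {n : ℕ} {Y : Set (TorusPt n)} (hY : Irr Y) : (zset Y).Nonempty :=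
  ⟨0, fun _ => Y, fun _ => ⟨hY.cl, hY.irred, subset_rfl⟩, fun i j hij => absurd hij (by
    have h1 := i.2
    have h2 := j.2
    rw [Fin.lt_def]; omega)⟩

lemma zdim_lt {n : ℕ} {Y Z : Set (TorusPt n)} (hY : Irr Y) (hZ : Irr Z) (h : Y ⊂ Z) : zdim Y + 1 ≤ zdim Z := by
  have hm : zdim Y ∈ zset Y := Nat.sSup_mem (zset_ne hY) (zset_bdd Y)
  obtain ⟨W, h1, h2⟩ := hm
  refine le_csSup (zset_bdd Z) ?_
  refine ⟨Fin.snoc W Z, ?_, ?_⟩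
  · intro i
    refine Fin.lastCases ?_ (fun i => ?_) i
    · rw [Fin.snoc_last]; exact ⟨hZ.cl, hZ.irred, subset_rfl⟩
    · rw [Fin.snoc_castSucc]; exact ⟨(h1 i).1, (h1 i).2.1, (h1 i).2.2.trans h.1⟩
  · intro i j
    refine Fin.lastCases ?_ (fun j => ?_) j
    · refine Fin.lastCases ?_ (fun i => ?_) i
      · intro hh; exact absurd hh (lt_irrefl _)
      · intro _
        rw [Fin.snoc_last, Fin.snoc_castSucc]
        exact lt_of_le_of_lt (h1 i).2.2 h
    · refine Fin.lastCases ?_ (fun i => ?_) i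
      · intro hh; exact absurd hh (not_lt.2 (Fin.le_last _))
      · intro hij
        rw [Fin.snoc_castSucc, Fin.snoc_castSucc]
        exact h2 i j (by simpa using hij)

lemma td_congr {n : ℕ} {I J : Ideal (RR n)} (h : I = J) : td QB (RR n ⧸ I) = td QB (RR n ⧸ J) := by rw [h]

lemma sub_of_prime {n : ℕ} {Y : Set (TorusPt n)} (hY : Irr Y) {P : TorusPt n} (hP : P ∈ Y)
    (q : Ideal (AA Y)) (hq : q.IsPrime) (hqm : q ≤ RingHom.ker (evA hP)) :
    ∃ Y' : Set (TorusPt n), Irr Y' ∧ P ∈ Y' ∧ Y' ⊆ Y ∧ td QB (AA Y ⧸ q) ≤ tdY Y' ∧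
      ∀ f ∈ q, ∀ y (hy : y ∈ Y), y ∈ Y' → evA hy f = 0 := by
  have _ := hY.pr
  have hpr : (q.comap (Ideal.Quotient.mkₐ QB (vI Y))).IsPrime := Ideal.comap_isPrime _ _
  have hle : vI Y ≤ q.comap (Ideal.Quotient.mkₐ QB (vI Y)) := by
    intro z hz
    rw [Ideal.mem_comap]
    have : Ideal.Quotient.mkₐ QB (vI Y) z = 0 := Ideal.Quotient.eq_zero_iff_mem.2 hz
    rw [this]; exact zero_mem _
  obtain ⟨h1, h2⟩ := irr_vZ hpr hle
  refine ⟨_, h1, ?_, ?_, ?_, ?_⟩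
  · intro f hf
    have := hqm hf
    exact this
  · intro x hx
    have hx2 : x ∈ vZ (vI Y) := fun f hf => hx f (hle hf)
    rwa [vZ_vI hY.cl] at hx2
  · rw [tdY, td_congr h2]
    let θ : (RR n ⧸ q.comap (Ideal.Quotient.mkₐ QB (vI Y))) →ₐ[QB] (AA Y ⧸ q) :=
          Ideal.quotientMapₐ q (Ideal.Quotient.mkₐ QB (vI Y)) le_rfl
    have hθ : Function.Surjective θ := Ideal.quotientMap_surjective (H := le_rfl) (Ideal.Quotient.mkₐ_surjective QB (vI Y))
    exact td_le_of_surjective θ hθ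
  · intro f hf y hy hy'
    obtain ⟨f, rfl⟩ := Ideal.Quotient.mk_surjective f
    rw [evA_mk]
    exact hy' f hf

lemma tdY_le_zdim {n : ℕ} (N : ℕ) : ∀ {Y : Set (TorusPt n)}, Irr Y → tdY Y ≤ N → tdY Y ≤ zdim Y := by
  induction N with
  | zero => intro Y _ h; omega
  | succ N ih =>
    intro Y hY hN
    have _ := hY.pr
    obtain ⟨P, hP⟩ := hY.irred.1
    by_cases h0 : tdY Y = 0
    · omega
    have hex : ∃ f : AA Y, f ≠ 0 ∧ evA hP f = 0 := by
      by_contra hcon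
      push Not at hcon
      apply h0
      have hinj : Function.Injective (evA hP) := by
        rw [injective_iff_map_eq_zero]
        intro a ha
        by_contra h
        exact hcon a h ha
      have h1 := td_le_of_injective _ hinj
      have h2 : td QB QB = 0 := by
        rw [td, trdeg_eq_zero]; simp
      have : tdY Y = td QB (AA Y) := rfl
      omega
    obtain ⟨f, hf, hf0⟩ := hex
    have _ : (RingHom.ker (evA hP)).IsPrime := RingHom.ker_isPrime _
    obtain ⟨q, hq, hfq, hqm, htd⟩ := pit (k := QB) f hf (RingHom.ker (evA hP)) hf0
    obtain ⟨Y', h1, h2, h3, h4, h5⟩ := sub_of_prime hY hP q hq hqm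
    have hss : Y' ⊂ Y := by
      refine lt_of_le_of_ne h3 ?_
      rintro rfl
      apply hf
      exact AA_ext _ _ fun y hy => by rw [h5 f hfq y hy hy, map_zero]
    have h6 := tdY_lt h1 hY hss
    have h7 := ih h1 (by omega)
    have h8 := zdim_lt h1 hY hss
    have : tdY Y = td QB (AA Y) := rfl
    omega

lemma zdim_eq {n : ℕ} {Y : Set (TorusPt n)} (hY : Irr Y) : zdim Y = tdY Y :=
  le_antisymm (zdim_le Y fun _ hZ h => tdY_le hZ hY h) (tdY_le_zdim _ hY le_rfl)

end

noncomputable section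
open MvPolynomial

lemma rank_alg {k B : Type} [Field k] [CommRing B] [IsDomain B] [Algebra k B] [Algebra.FiniteType k B]
    {e : ℕ} (z : Fin e → B) (hz : Algebra.IsAlgebraic (Algebra.adjoin k (Set.range z)) B) :
    ∃ (ρ : ℕ) (f : Fin ρ → Fin e), AlgebraicIndependent k (fun i => z (f i)) ∧ td k B = ρ := by
  obtain ⟨t, hts, ht⟩ := exists_isTranscendenceBasis_subset (R := k) (A := B) (Set.range z)
  have h1 := ht.cardinalMk_eq_trdeg
  rw [trdeg_eq_td] at h1
  have hfin : Finite t := (Set.finite_range z).subset hts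
  have hc : Nat.card t = td k B := by rw [Nat.card, h1]; simp
  have e1 : Fin (td k B) ≃ t := (Finite.equivFinOfCardEq hc).symm
  choose g hg using fun i : t => hts i.2
  refine ⟨td k B, fun i => g (e1 i), ?_, rfl⟩
  have : (fun i => z (g (e1 i))) = (Subtype.val : t → B) ∘ e1 := by
    funext i
    exact hg (e1 i)
  rw [this]
  exact ht.1.comp _ e1.injective

lemma rank_adj {k B : Type} [Field k] [CommRing B] [IsDomain B] [Algebra k B] [Algebra.FiniteType k B]
    {e : ℕ} (z : Fin e → B) :
    ∃ (ρ : ℕ) (f : Fin ρ → Fin e), AlgebraicIndependent k (fun i => z (f i)) ∧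
      td k (Algebra.adjoin k (Set.range z)) = ρ := by
  have hfg : (Algebra.adjoin k (Set.range z)).FG := by
    have := Subalgebra.fg_adjoin_finset (R := k) (Set.finite_range z).toFinset
    simpa using this
  have _ : Algebra.FiniteType k (Algebra.adjoin k (Set.range z)) := (Subalgebra.fg_iff_finiteType _).1 hfg
  let z' : Fin e → Algebra.adjoin k (Set.range z) := fun i => ⟨z i, Algebra.subset_adjoin ⟨i, rfl⟩⟩
  have htop : Algebra.adjoin k (Set.range z') = ⊤ := by
    have h := Algebra.adjoin_adjoin_coe_preimage (R := k) (s := Set.range z)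
    rw [← h]
    congr 1
    ext w
    constructor
    · rintro ⟨i, rfl⟩; exact ⟨i, rfl⟩
    · rintro ⟨i, hi⟩; exact ⟨i, Subtype.ext hi⟩
  obtain ⟨ρ, f, hf, h⟩ := rank_alg (k := k) z' ⟨fun w =>
    isAlgebraic_algebraMap (⟨w, by rw [htop]; trivial⟩ : Algebra.adjoin k (Set.range z'))⟩
  refine ⟨ρ, f, ?_, h⟩
  exact hf.map' (f := (Algebra.adjoin k (Set.range z)).val) Subtype.val_injective

lemma algInd_mon {k B : Type} [Field k] [CommRing B] [IsDomain B] [Algebra k B] {ρ : ℕ}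
    (z : Fin ρ → Bˣ) (hz : AlgebraicIndependent k (fun i => (z i : B))) (m : Fin ρ → ℤ) (c : k)
    (hm : ((lmon z m : Bˣ) : B) = algebraMap k B c) : m = 0 := by
  have h1 : (∏ i, (z i : B) ^ (m i).toNat) = algebraMap k B c * ∏ i, (z i : B) ^ (-m i).toNat := by
    rw [← hm, lmon]
    have : (∏ i, z i ^ (m i).toNat) = (∏ i, z i ^ m i) * ∏ i, z i ^ (-m i).toNat := by
      rw [← Finset.prod_mul_distrib]
      refine Finset.prod_congr rfl fun i _ => ?_
      rw [← zpow_natCast, ← zpow_natCast, ← zpow_add]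
      congr 1
      omega
    have h2 := congrArg (fun u : Bˣ => (u : B)) this
    simpa [Units.coe_prod] using h2
  let p : Fin ρ →₀ ℕ := Finsupp.equivFunOnFinite.symm fun i => (m i).toNat
  let q : Fin ρ →₀ ℕ := Finsupp.equivFunOnFinite.symm fun i => (-m i).toNat
  have h3 : aeval (fun i => (z i : B)) (monomial p (1 : k)) = aeval (fun i => (z i : B)) (monomial q c) := by
    rw [aeval_monomial, aeval_monomial, map_one, one_mul, Finsupp.prod_fintype _ _ (by simp),
      Finsupp.prod_fintype _ _ (by simp)]
    exact h1
  have h4 := hz h3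
  rw [monomial_eq_monomial_iff] at h4
  rcases h4 with h4 | h4
  · funext i
    have := DFunLike.congr_fun h4.1 i
    have h5 : (m i).toNat = (-m i).toNat := this
    simp only [Pi.zero_apply]
    omega
  · exact absurd h4.1 one_ne_zero

lemma lmon_sum {A ι : Type} [CommRing A] [Fintype ι] {n : ℕ} (x : Fin n → Aˣ) (a : ι → Fin n → ℤ) (g : ι → ℤ) :
    lmon x (∑ i, g i • a i) = ∏ i, lmon x (a i) ^ g i := by
  classical
  have h : ∀ s : Finset ι, lmon x (∑ i ∈ s, g i • a i) = ∏ i ∈ s, lmon x (a i) ^ g i := by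
    intro s
    induction s using Finset.induction_on with
    | empty => simp [lmon_zero]
    | insert i s hi ih => rw [Finset.sum_insert hi, Finset.prod_insert hi, lmon_add, lmon_smul, ih]
  exact h _

/-- the set of exponents whose character is constant -/
def cst (k : Type) {B : Type} [Field k] [CommRing B] [Algebra k B] {n : ℕ} (x : Fin n → Bˣ) : Submodule ℤ (Fin n → ℤ) where
  carrier := {a | ∃ c : kˣ, lmon x a = Units.map (algebraMap k B : k →* B) c}
  add_mem' := by
    rintro a b ⟨c, hc⟩ ⟨d, hd⟩
    exact ⟨c * d, by rw [lmon_add, hc, hd, map_mul]⟩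
  zero_mem' := ⟨1, by rw [lmon_zero, map_one]⟩
  smul_mem' := by
    rintro m a ⟨c, hc⟩
    exact ⟨c ^ m, by rw [lmon_smul, hc, map_zpow]⟩

lemma indep_mod_cst {k B : Type} [Field k] [CommRing B] [IsDomain B] [Algebra k B] {n ρ e : ℕ} (x : Fin n → Bˣ)
    (b : Fin ρ → Fin n → ℤ) (hb : AlgebraicIndependent k (fun i => ((lmon x (b i) : Bˣ) : B)))
    (a : Fin e → Fin n → ℤ) (ha : LinearIndependent ℤ a) (hac : ∀ i, a i ∈ cst k x) : ρ + e ≤ n := by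
  have h : LinearIndependent ℤ (Sum.elim b a) := by
    rw [Fintype.linearIndependent_iff]
    intro g hg
    rw [Fintype.sum_sum_type] at hg
    simp only [Sum.elim_inl, Sum.elim_inr] at hg
    have h1 : ∑ i, g (Sum.inl i) • b i ∈ cst k x := by
      rw [eq_neg_of_add_eq_zero_left hg]
      exact neg_mem (sum_mem fun i _ => Submodule.smul_mem _ _ (hac i))
    obtain ⟨c, hc⟩ := h1
    have h2 := algInd_mon (k := k) (fun i => lmon x (b i)) hb (fun i => g (Sum.inl i)) c (by
      rw [lmon_sum] at hc
      rw [lmon, hc]; rfl)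
    have h3 : ∀ i, g (Sum.inl i) = 0 := fun i => congrFun h2 i
    have h4 : ∑ i, g (Sum.inr i) • a i = 0 := by simpa [h3] using hg
    rw [Fintype.linearIndependent_iff] at ha
    have h5 := ha _ h4
    rintro (i | i)
    · exact h3 i
    · exact h5 i
  simpa using h.fintype_card_le_finrank

lemma mon_td {n e : ℕ} {Y : Set (TorusPt n)} (hY : Irr Y) (a : Fin e → Fin n → ℤ) (ha : LinearIndependent ℤ a)
    (hac : ∀ i, a i ∈ cst QB (xx Y)) : tdY Y + e ≤ n := by
  have _ := hY.pr
  obtain ⟨ρ, f, hf, h⟩ := rank_alg (k := QB) (B := AA Y) (fun j => (xx Y j : AA Y)) (by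
    have hs : Algebra.adjoin QB (Set.range (Ideal.Quotient.mk (vI Y) ∘ (X : Fin n ⊕ Fin n → RR n))) = ⊤ := by
      rw [Set.range_comp]
      have := AlgHom.map_adjoin (Ideal.Quotient.mkₐ QB (vI Y)) (Set.range (X : Fin n ⊕ Fin n → RR n))
      rw [MvPolynomial.adjoin_range_X] at this
      have h2 : (Ideal.Quotient.mkₐ QB (vI Y)).range = ⊤ :=
        (AlgHom.range_eq_top _).2 (Ideal.Quotient.mkₐ_surjective QB (vI Y))
      rw [Algebra.map_top, h2] at this
      exact this.symm
    have hall : ∀ w : AA Y, IsAlgebraic (Algebra.adjoin QB (Set.range fun j => (xx Y j : AA Y))) w := by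
      intro w
      have hw : w ∈ Algebra.adjoin QB (Set.range (Ideal.Quotient.mk (vI Y) ∘ (X : Fin n ⊕ Fin n → RR n))) := by
        rw [hs]; trivial
      induction hw using Algebra.adjoin_induction with
      | mem w hw =>
        obtain ⟨j, rfl⟩ := hw
        have hx : ∀ j, IsAlgebraic (Algebra.adjoin QB (Set.range fun j => (xx Y j : AA Y))) (xx Y j : AA Y) := fun j =>
          isAlgebraic_algebraMap (⟨(xx Y j : AA Y), Algebra.subset_adjoin ⟨j, rfl⟩⟩ : Algebra.adjoin QB (Set.range fun j => (xx Y j : AA Y)))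
        rcases j with j | j
        · exact hx j
        · let _ : Invertible (xx Y j : AA Y) := (xx Y j).invertible
          have := (hx j).invOf
          rw [invOf_units] at this
          exact this
      | algebraMap r =>
        have := isAlgebraic_algebraMap (A := AA Y) (algebraMap QB (Algebra.adjoin QB (Set.range fun j => (xx Y j : AA Y))) r)
        exact this
      | add u v _ _ hu hv => exact hu.add hv
      | mul u v _ _ hu hv => exact hu.mul hv
    exact ⟨hall⟩)
  have := indep_mod_cst (k := QB) (xx Y) (fun i => Pi.single (f i) 1) (by
    simp only [lmon_single]; exact hf) a ha hac
  have h' : tdY Y = ρ := h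
  omega

lemma fibre_geo {n e : ℕ} {Y : Set (TorusPt n)} (hY : Irr Y) {P : TorusPt n} (hP : P ∈ Y) (a : Fin e → Fin n → ℤ) :
    ∃ Y' : Set (TorusPt n), Irr Y' ∧ P ∈ Y' ∧ Y' ⊆ Y ∧ (∀ i, ∀ y ∈ Y', lmon y (a i) = lmon P (a i)) ∧
      ∃ (ρ : ℕ) (f : Fin ρ → Fin e),
        AlgebraicIndependent QB (fun i => ((lmon (xx Y) (a (f i)) : (AA Y)ˣ) : AA Y)) ∧ tdY Y ≤ tdY Y' + ρ := by
  have _ := hY.pr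
  obtain ⟨ρ, f, hf, hρ⟩ := rank_adj (k := QB) (fun i => ((lmon (xx Y) (a i) : (AA Y)ˣ) : AA Y))
  set E := Algebra.adjoin QB (Set.range (fun i => ((lmon (xx Y) (a i) : (AA Y)ˣ) : AA Y))) with hE
  have hfg : E.FG := by
    have := Subalgebra.fg_adjoin_finset (R := QB)
      (Set.finite_range (fun i => ((lmon (xx Y) (a i) : (AA Y)ˣ) : AA Y))).toFinset
    simpa using this
  have _ : (RingHom.ker (evA hP)).IsPrime := RingHom.ker_isPrime _
  obtain ⟨q, hq, h1, h2, h3⟩ := fibre (k := QB) E hfg (RingHom.ker (evA hP))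
  obtain ⟨Y', g1, g2, g3, g4, g5⟩ := sub_of_prime hY hP q hq h2
  refine ⟨Y', g1, g2, g3, ?_, ρ, f, hf, ?_⟩
  · intro i y hy
    have hm : ((lmon (xx Y) (a i) : (AA Y)ˣ) : AA Y) - algebraMap QB (AA Y) (lmon P (a i) : QBˣ) ∈ q := by
      refine h1 _ (sub_mem (Algebra.subset_adjoin ⟨i, rfl⟩) (Subalgebra.algebraMap_mem _ _)) ?_
      rw [RingHom.mem_ker, map_sub, evA_lmon, AlgHom.commutes]
      exact sub_self _
    have := g5 _ hm y (g3 hy) hy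
    rw [map_sub, evA_lmon, AlgHom.commutes, sub_eq_zero] at this
    exact Units.ext this
  · have : tdY Y = td QB (AA Y) := rfl
    omega

end

noncomputable section
open MvPolynomial

lemma closed_of {n : ℕ} (S : Set (RR n)) : ZClosed {x : TorusPt n | ∀ f ∈ S, ev x f = 0} := by
  have : {x : TorusPt n | ∀ f ∈ S, ev x f = 0} = vZ (Ideal.span S) := by
    ext x
    constructor
    · intro h f hf
      have : Ideal.span S ≤ RingHom.ker (ev x) := Ideal.span_le.2 h
      exact this hf
    · intro h f hf
      exact h f (Ideal.subset_span hf)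
  rw [this]
  exact vZ_closed _

lemma closed_mon {n : ℕ} {ι : Type} (a : ι → Fin n → ℤ) (c : ι → QBˣ) :
    ZClosed {x : TorusPt n | ∀ i, lmon x (a i) = c i} := by
  have := closed_of (Set.range fun i => LM (a i) - C ((c i : QB)))
  convert this using 1
  ext x
  simp only [Set.mem_setOf_eq, Set.forall_mem_range, map_sub, ev_LM, sub_eq_zero]
  refine forall_congr' fun i => ?_
  have : ev x (C (c i : QB)) = (c i : QB) := by simp [ev]
  rw [this, Units.val_inj]

lemma mem_cst {n : ℕ} {Y : Set (TorusPt n)} (hY : Irr Y) (a : Fin n → ℤ) :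
    a ∈ cst QB (xx Y) ↔ ∃ c : QBˣ, ∀ y ∈ Y, lmon y a = c := by
  constructor
  · rintro ⟨c, hc⟩
    refine ⟨c, fun y hy => ?_⟩
    have := congrArg (fun u : (AA Y)ˣ => evA hy (u : AA Y)) hc
    simp only [evA_lmon] at this
    apply Units.ext
    rw [this]
    exact AlgHom.commutes _ _
  · rintro ⟨c, hc⟩
    refine ⟨c, Units.ext ?_⟩
    refine AA_ext _ _ fun y hy => ?_
    rw [evA_lmon, hc y hy]
    exact ((evA hy).commutes (c : QB)).symm

lemma lmon_mul {n : ℕ} (x y : TorusPt n) (a : Fin n → ℤ) : lmon (x * y) a = lmon x a * lmon y a := by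
  simp [lmon, mul_zpow, Finset.prod_mul_distrib]

lemma lmon_inv {n : ℕ} (x : TorusPt n) (a : Fin n → ℤ) : lmon x⁻¹ a = (lmon x a)⁻¹ := by
  simp [lmon, inv_zpow]

lemma lmon_one {n : ℕ} (a : Fin n → ℤ) : lmon (1 : TorusPt n) a = 1 := by
  simp [lmon]

lemma sub_alg {n : ℕ} {ι : Type} (a : ι → Fin n → ℤ) :
    IsAlgSubgroup {x : TorusPt n | ∀ i, lmon x (a i) = 1} := by
  refine ⟨closed_mon a fun _ => 1, fun i => lmon_one _, ?_, ?_⟩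
  · intro x hx y hy i
    rw [lmon_mul, hx i, hy i, one_mul]
  · intro x hx i
    rw [lmon_inv, hx i, inv_one]

lemma coset_mon {n : ℕ} {ι : Type} (a : ι → Fin n → ℤ) (P : TorusPt n) :
    IsCoset {x : TorusPt n | ∀ i, lmon x (a i) = lmon P (a i)} := by
  refine ⟨P, _, sub_alg a, ?_⟩
  ext x
  constructor
  · intro h
    refine ⟨P⁻¹ * x, fun i => ?_, by simp⟩
    rw [lmon_mul, lmon_inv, h i, inv_mul_cancel]
  · rintro ⟨y, hy, rfl⟩ i
    have h2 : lmon y (a i) = 1 := hy i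
    change lmon (P * y) (a i) = _
    rw [lmon_mul, h2, mul_one]

lemma zdim_coset {n e : ℕ} (a : Fin e → Fin n → ℤ) (ha : LinearIndependent ℤ a) (P : TorusPt n) :
    zdim {x : TorusPt n | ∀ i, lmon x (a i) = lmon P (a i)} + e ≤ n := by
  have hen : e ≤ n := by simpa using ha.fintype_card_le_finrank
  have := zdim_le (N := n - e) {x : TorusPt n | ∀ i, lmon x (a i) = lmon P (a i)} (fun Z hZ h => by
    have := mon_td hZ a ha (fun i => (mem_cst hZ _).2 ⟨lmon P (a i), fun y hy => h hy i⟩)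
    omega)
  omega

theorem nonanom {n e : ℕ} {X Y : Set (TorusPt n)} (hY : Irr Y) (hYX : Y ⊆ X) {P : TorusPt n} (hP : P ∈ Y)
    (hoa : P ∈ openAnom X (zdim X)) (a : Fin e → Fin n → ℤ) (ha : LinearIndependent ℤ a) :
    ∃ (ρ : ℕ) (f : Fin ρ → Fin e),
        AlgebraicIndependent QB (fun i => ((lmon (xx Y) (a (f i)) : (AA Y)ˣ) : AA Y)) ∧
        (tdY Y ≤ ρ ∨ tdY Y + e ≤ zdim X + ρ) := by
  obtain ⟨Y', h1, h2, h3, h4, ρ, f, hf, h5⟩ := fibre_geo hY hP a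
  refine ⟨ρ, f, hf, ?_⟩
  by_cases h0 : tdY Y' = 0
  · left; omega
  right
  by_contra hcon
  apply hoa.2
  simp only [Set.mem_iUnion]
  refine ⟨Y', ⟨h3.trans hYX, h1.cl, h1.irred, ?_, _, coset_mon a P, fun y hy i => h4 i y hy, ?_⟩, h2⟩
  · rw [zdim_eq h1]; omega
  · have := zdim_coset a ha P
    rw [zdim_eq h1]
    omega

/-- relations bound: `e` independent constant characters -/
lemma nonanom_cst {n e : ℕ} {X Y : Set (TorusPt n)} (hY : Irr Y) (hYX : Y ⊆ X) {P : TorusPt n} (hP : P ∈ Y)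
    (hoa : P ∈ openAnom X (zdim X)) (hd : 1 ≤ tdY Y) (a : Fin e → Fin n → ℤ) (ha : LinearIndependent ℤ a)
    (hc : ∀ i, a i ∈ cst QB (xx Y)) : tdY Y + e ≤ zdim X := by
  have _ := hY.pr
  obtain ⟨ρ, f, hf, h⟩ := nonanom hY hYX hP hoa a ha
  have hρ : ρ = 0 := by
    by_contra h0
    have i0 : Fin ρ := ⟨0, Nat.pos_of_ne_zero h0⟩
    obtain ⟨c, hc⟩ := hc (f i0)
    have := hf.transcendental i0
    apply this
    rw [hc]
    exact isAlgebraic_algebraMap (R := QB) (A := AA Y) (c : QB)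
  omega

end

noncomputable section
open MvPolynomial

lemma poly_torus_zero {n : ℕ} (g : MvPolynomial (Fin n) QB)
    (h : ∀ x : TorusPt n, eval (fun i => (x i : QB)) g = 0) : g = 0 := by
  refine MvPolynomial.funext_set (fun _ => {0}ᶜ) (fun _ => (Set.finite_singleton _).infinite_compl) ?_
  intro x hx
  rw [map_zero]
  exact h fun i => Units.mk0 (x i) (hx i trivial)

lemma irr_univ (n : ℕ) : Irr (Set.univ : Set (TorusPt n)) := by
  refine ⟨⟨∅, by simp⟩, ?_, ?_⟩
  · rw [Ne, Ideal.eq_top_iff_one, mem_vI]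
    intro h
    have := h 1 trivial
    simp at this
  · intro f g hfg
    obtain ⟨N, F, hF⟩ := ev_poly f
    obtain ⟨M, G, hG⟩ := ev_poly g
    have h1 : F * G = 0 := by
      refine poly_torus_zero _ fun x => ?_
      have := mem_vI.1 hfg x trivial
      rw [map_mul] at this
      rw [map_mul, hF, hG]
      linear_combination (∏ i, (x i : QB)) ^ N * (∏ i, (x i : QB)) ^ M * this
    have key : ∀ (x : TorusPt n) (N : ℕ), (∏ i, (x i : QB)) ^ N ≠ 0 := fun x N =>
      pow_ne_zero _ (Finset.prod_ne_zero_iff.2 fun i _ => (x i).ne_zero)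
    rcases mul_eq_zero.1 h1 with h | h
    · left
      rw [mem_vI]
      intro x _
      have := hF x
      rw [h, map_zero] at this
      exact (mul_eq_zero.1 this.symm).resolve_left (key x N)
    · right
      rw [mem_vI]
      intro x _
      have := hG x
      rw [h, map_zero] at this
      exact (mul_eq_zero.1 this.symm).resolve_left (key x M)

lemma tdY_univ (n : ℕ) : n ≤ tdY (Set.univ : Set (TorusPt n)) := by
  have _ := (irr_univ n).pr
  have h : AlgebraicIndependent QB (fun j => (xx (Set.univ : Set (TorusPt n)) j : AA (Set.univ : Set (TorusPt n)))) := by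
    rw [algebraicIndependent_iff]
    intro p hp
    refine poly_torus_zero _ fun x => ?_
    have h1 := congrArg (evA (Set.mem_univ x)) hp
    rw [map_zero, ← AlgHom.comp_apply, comp_aeval] at h1
    rw [← h1, aeval_eq_eval]
    congr 2
    funext j
    have h2 := congrFun (evP_evA (Set.mem_univ x)) j
    exact (congrArg (fun u : QBˣ => (u : QB)) h2).symm
  have h3 := algInd_le_td h
  rw [Fintype.card_fin] at h3
  exact h3

def LamH {n : ℕ} (H : Set (TorusPt n)) : Submodule ℤ (Fin n → ℤ) where
  carrier := {a | ∀ x ∈ H, lmon x a = 1}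
  add_mem' := by
    intro a b ha hb x hx
    rw [lmon_add, ha x hx, hb x hx, one_mul]
  zero_mem' := fun x _ => lmon_zero x
  smul_mem' := by
    intro m a ha x hx
    rw [lmon_smul, ha x hx, one_zpow]

lemma LamH_sat {n : ℕ} {H : Set (TorusPt n)} (hH : IsAlgSubgroup H) (hc : ZConnected H) (m : ℤ) (hm : m ≠ 0)
    (a : Fin n → ℤ) (ha : m • a ∈ LamH H) : a ∈ LamH H := by
  have hN : m.natAbs ≠ 0 := Int.natAbs_ne_zero.2 hm
  set N := m.natAbs with hNd
  have h1 : ∀ x ∈ H, (lmon x a) ^ N = 1 := by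
    intro x hx
    have h := ha x hx
    rw [lmon_smul] at h
    rw [← zpow_natCast, hNd]
    rcases Int.natAbs_eq m with h2 | h2
    · rw [← h2]; exact h
    · have h3 : ((m.natAbs : ℕ) : ℤ) = -m := by omega
      rw [h3, zpow_neg, h, inv_one]
  have hz2 := closed_of ({∑ k ∈ Finset.range N, LM a ^ k} : Set (RR n))
  have hz1 := closed_mon (fun _ : Unit => a) (fun _ => 1)
  have key : ∀ x : TorusPt n, ev x (∑ k ∈ Finset.range N, LM a ^ k) = ∑ k ∈ Finset.range N, ((lmon x a : QBˣ) : QB) ^ k := by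
    intro x
    rw [map_sum]
    simp only [map_pow, ev_LM]
  have hdis : ∀ x : TorusPt n, lmon x a = 1 → ev x (∑ k ∈ Finset.range N, LM a ^ k) ≠ 0 := by
    intro x hx
    rw [key, hx]
    simpa using hN
  refine (hc _ _ hz1 hz2 ?_ ?_).elim (fun h x hx => h hx ())
    (fun h => absurd (h hH.2.1 _ rfl) (hdis 1 (lmon_one a)))
  · intro x hx
    by_cases h2 : lmon x a = 1
    · left; exact fun _ => h2
    · right
      intro f hf
      rw [Set.mem_singleton_iff] at hf
      rw [hf, key]
      have h3 := geom_sum_mul ((lmon x a : QBˣ) : QB) N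
      have h4 : ((lmon x a : QBˣ) : QB) ^ N = 1 := by
        have := congrArg (fun u : QBˣ => (u : QB)) (h1 x hx)
        simpa using this
      rw [h4, sub_self] at h3
      refine (mul_eq_zero.1 h3).resolve_right ?_
      rw [sub_eq_zero]
      intro h5
      exact h2 (Units.ext h5)
  · rw [Set.eq_empty_iff_forall_notMem]
    rintro x ⟨⟨_, h2⟩, h3⟩
    exact hdis x (h2 ()) (h3 _ rfl)

def sexp {n : ℕ} (s : Fin n ⊕ Fin n →₀ ℕ) : Fin n → ℤ := fun j => (s (Sum.inl j) : ℤ) - s (Sum.inr j)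

lemma ev_monomial {n : ℕ} (x : TorusPt n) (s : Fin n ⊕ Fin n →₀ ℕ) (c : QB) :
    ev x (monomial s c) = c * ((lmon x (sexp s) : QBˣ) : QB) := by
  rw [ev, aeval_monomial, Finsupp.prod_fintype _ _ (by simp), Fintype.prod_sum_type, lmon, Units.coe_prod,
    ← Finset.prod_mul_distrib]
  simp only [Algebra.algebraMap_self, RingHom.id_apply]
  congr 1
  refine Finset.prod_congr rfl fun j _ => ?_
  have : (x j ^ sexp s j : QBˣ) = x j ^ s (Sum.inl j) * (x j)⁻¹ ^ s (Sum.inr j) := by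
    rw [sexp, zpow_sub, zpow_natCast, zpow_natCast, inv_pow]
  rw [this]
  simp [evc]

lemma mem_of_LamH {n : ℕ} {H : Set (TorusPt n)} (hH : IsAlgSubgroup H) (x : TorusPt n)
    (hx : ∀ a ∈ LamH H, lmon x a = 1) : x ∈ H := by
  classical
  obtain ⟨hcl, h1, hmul, hinv⟩ := hH
  rw [← vZ_vI hcl]
  intro f hf
  rw [mem_vI] at hf
  let G : Subgroup (TorusPt n) := ⟨⟨⟨H, fun {a b} ha hb => hmul a ha b hb⟩, h1⟩, fun {a} ha => hinv a ha⟩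
  let χ : (Fin n → ℤ) → (G →* QB) := fun a =>
    { toFun := fun g => ((lmon g.1 a : QBˣ) : QB)
      map_one' := by
        change ((lmon (1 : TorusPt n) a : QBˣ) : QB) = 1
        rw [lmon_one]; rfl
      map_mul' := fun g h => by
        change ((lmon (g.1 * h.1) a : QBˣ) : QB) = _
        rw [lmon_mul]; rfl }
  have hχ : ∀ a b, χ a = χ b → lmon x a = lmon x b := by
    intro a b hab
    have : a - b ∈ LamH H := by
      intro y hy
      have h2 := DFunLike.congr_fun hab (⟨y, hy⟩ : G)
      have h3 : lmon y a = lmon y b := Units.ext h2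
      rw [sub_eq_add_neg, lmon_add, lmon_neg, h3, mul_inv_cancel]
    have h4 := hx _ this
    rw [sub_eq_add_neg, lmon_add, lmon_neg, mul_inv_eq_one] at h4
    exact h4
  let ψ : (G →* QB) → QB := fun c => if h : ∃ a, χ a = c then ((lmon x h.choose : QBˣ) : QB) else 0
  have hψ : ∀ a, ψ (χ a) = ((lmon x a : QBˣ) : QB) := by
    intro a
    have h : ∃ b, χ b = χ a := ⟨a, rfl⟩
    change (if h : ∃ b, χ b = χ a then ((lmon x h.choose : QBˣ) : QB) else 0) = _
    rw [dif_pos h, hχ _ _ h.choose_spec]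
  let v : (G →* QB) →₀ QB := ∑ s ∈ f.support, Finsupp.single (χ (sexp s)) (coeff s f)
  have hev : ∀ y : TorusPt n, ev y f = ∑ s ∈ f.support, coeff s f * ((lmon y (sexp s) : QBˣ) : QB) := by
    intro y
    conv_lhs => rw [f.as_sum]
    rw [map_sum]
    exact Finset.sum_congr rfl fun s _ => ev_monomial _ _ _
  have hv : v = 0 := by
    have hli := linearIndependent_monoidHom G QB
    rw [linearIndependent_iff] at hli
    apply hli
    rw [map_sum]
    funext g
    simp only [Finsupp.linearCombination_single, Finset.sum_apply, Pi.smul_apply, smul_eq_mul, Pi.zero_apply]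
    have := hf g.1 g.2
    rw [hev] at this
    exact this
  have h5 : Finsupp.linearCombination QB ψ v = 0 := by rw [hv, map_zero]
  rw [map_sum] at h5
  simp only [Finsupp.linearCombination_single, smul_eq_mul, hψ] at h5
  rw [hev, h5]

theorem subgroup_rels {n r : ℕ} {H : Set (TorusPt n)} (hH : IsAlgSubgroup H) (hd : r + zdim H ≤ n) :
    r ≤ Module.finrank ℤ (LamH H) := by
  let b := Module.finBasis ℤ (LamH H)
  obtain ⟨Y', h1, h2, _, h4, ρ, f, hf, h5⟩ := fibre_geo (irr_univ n) (Set.mem_univ (1 : TorusPt n)) (fun i => (b i : Fin n → ℤ))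
  have hsub : Y' ⊆ H := by
    intro y hy
    refine mem_of_LamH hH y fun a ha => ?_
    have h6 := b.sum_repr ⟨a, ha⟩
    have h7 := congrArg (fun w : LamH H => (w : Fin n → ℤ)) h6
    simp only [Submodule.coe_sum, Submodule.coe_smul] at h7
    rw [← h7, lmon_sum]
    refine Finset.prod_eq_one fun i _ => ?_
    rw [h4 i y hy, lmon_one, one_zpow]
  have hρ : ρ ≤ Module.finrank ℤ (LamH H) := by
    have _ := (irr_univ n).pr
    have hinj : Function.Injective f := by
      intro i j hij
      apply hf.injective
      simp only [hij]
    simpa using Fintype.card_le_of_injective f hinj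
  have h8 := zdim_mono (zset_ne h1) hsub
  rw [zdim_eq h1] at h8
  have := tdY_univ n
  omega

end

noncomputable section
open MvPolynomial

theorem generic_set {n : ℕ} {X : Set (TorusPt n)} (hX : Irr X) (S : Set (TorusPt n)) (hSX : S ⊆ X) (hS : S.Infinite) :
    ∃ Y : Set (TorusPt n), Irr Y ∧ Y ⊆ X ∧ (S ∩ Y).Infinite ∧ 1 ≤ tdY Y ∧
      ∀ T ⊆ S ∩ Y, T.Infinite → ∀ f : RR n, (∀ y ∈ T, ev y f = 0) → f ∈ vI Y := by
  classical
  let p : ℕ → Prop := fun N => ∃ Y : Set (TorusPt n), Irr Y ∧ Y ⊆ X ∧ (S ∩ Y).Infinite ∧ tdY Y = N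
  have hp : ∃ N, p N := ⟨tdY X, X, hX, subset_rfl, by rwa [Set.inter_eq_left.2 hSX], rfl⟩
  obtain ⟨Y, hY, hYX, hSY, hN⟩ := Nat.find_spec hp
  have hmin : ∀ Z : Set (TorusPt n), Irr Z → Z ⊆ X → (S ∩ Z).Infinite → tdY Y ≤ tdY Z := by
    intro Z h1 h2 h3
    rw [hN]
    exact Nat.find_min' hp ⟨Z, h1, h2, h3, rfl⟩
  refine ⟨Y, hY, hYX, hSY, ?_, ?_⟩
  · obtain ⟨P, hP⟩ := hSY.nonempty
    have hss : ({P} : Set (TorusPt n)) ⊂ Y := by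
      refine lt_of_le_of_ne (Set.singleton_subset_iff.2 hP.2) ?_
      intro h
      apply hSY
      rw [← h]
      exact (Set.finite_singleton P).inter_of_right S
    have := tdY_lt (irr_pt P) hY hss
    omega
  · intro T hT hTi f hf
    by_contra hfY
    set J : Ideal (RR n) := vI Y ⊔ Ideal.span {f} with hJ
    have hfin : J.minimalPrimes.Finite := Ideal.finite_minimalPrimes_of_isNoetherianRing (RR n) J
    have hcov : T ⊆ ⋃ q ∈ J.minimalPrimes, (T ∩ vZ q) := by
      intro y hy
      have _ : (RingHom.ker (ev y)).IsPrime := RingHom.ker_isPrime _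
      have hle : J ≤ RingHom.ker (ev y) := by
        rw [hJ]
        refine sup_le ?_ ?_
        · intro g hg
          exact mem_vI.1 hg y (hT hy).2
        · rw [Ideal.span_singleton_le_iff_mem]
          exact hf y hy
      obtain ⟨q, hq, hqy⟩ := Ideal.exists_minimalPrimes_le hle
      simp only [Set.mem_iUnion]
      exact ⟨q, hq, hy, fun g hg => hqy hg⟩
    have hex : ∃ q ∈ J.minimalPrimes, (T ∩ vZ q).Infinite := by
      by_contra hcon
      push Not at hcon
      exact hTi ((hfin.biUnion fun q hq => hcon q hq).subset hcov)
    obtain ⟨q, hq, hqi⟩ := hex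
    have hJq : J ≤ q := hq.1.2
    have hYq : vI Y ≤ q := le_sup_left.trans hJq
    obtain ⟨h1, h2⟩ := irr_vZ hq.1.1 hYq
    have hsub : vZ q ⊆ Y := le_of_vI hY.cl (by rw [h2]; exact hYq)
    have hss : vZ q ⊂ Y := by
      refine lt_of_le_of_ne hsub ?_
      intro h
      apply hfY
      rw [← h, h2]
      exact hJq (Ideal.mem_sup_right (Ideal.mem_span_singleton_self f))
    have h3 := tdY_lt h1 hY hss
    have h4 := hmin _ h1 (hsub.trans hYX) (hqi.mono fun y hy => ⟨(hT hy.1).1, hy.2⟩)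
    omega

theorem bounded_height {n r : ℕ} {Y S : Set (TorusPt n)} (hY : Irr Y) (hS : S.Infinite) (hSY : S ⊆ Y)
    (hna : ∀ e (a : Fin e → Fin n → ℤ), LinearIndependent ℤ a → ∃ (ρ : ℕ) (f : Fin ρ → Fin e),
        AlgebraicIndependent QB (fun i => ((lmon (xx Y) (a (f i)) : (AA Y)ˣ) : AA Y)) ∧
        (tdY Y ≤ ρ ∨ tdY Y + e ≤ r + ρ))
    (hdense : ∀ T ⊆ S, T.Infinite → ∀ f : RR n, (∀ y ∈ T, ev y f = 0) → f ∈ vI Y)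
    (hrel : ∀ P ∈ S, ∃ a : Fin r → Fin n → ℤ, LinearIndependent ℤ a ∧ ∀ i, lmon P (a i) = 1) :
    ∃ B : ℝ, {P ∈ S | ∑ j, Hc (P j) ≤ B}.Infinite := by
  by_contra hcon
  push Not at hcon
  have _ := hY.pr
  let g : ℕ → S := fun m => hS.natEmbedding S m
  have hg : Function.Injective g := (hS.natEmbedding S).injective
  have hgf : ∀ T : Set (TorusPt n), T.Finite → {m | (g m : TorusPt n) ∈ T}.Finite := by
    intro T hT
    exact hT.preimage ((Subtype.val_injective.comp hg).injOn)
  refine height_not_tendsto (A := AA Y) (r := r) (d := tdY Y) (trdeg_eq_td QB (AA Y)) (xx Y) hna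
    (fun m => evA (hSY (g m).2)) ?_ ?_ ?_
  · intro f hf
    obtain ⟨f, rfl⟩ := Ideal.Quotient.mk_surjective f
    simp only [evA_mk]
    have hfin : {P ∈ S | ev P f = 0}.Finite := by
      by_contra h
      exact hf (Ideal.Quotient.eq_zero_iff_mem.2 (hdense _ (Set.sep_subset _ _) h f fun y hy => hy.2))
    have := (hgf _ hfin).eventually_cofinite_notMem
    rw [Nat.cofinite_eq_atTop] at this
    filter_upwards [this] with m hm h0
    exact hm ⟨(g m).2, h0⟩
  · intro m
    rw [evP_evA]
    exact hrel _ (g m).2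
  · rw [Filter.tendsto_atTop]
    intro B
    simp only [evP_evA]
    have := (hgf _ (hcon B)).eventually_cofinite_notMem
    rw [Nat.cofinite_eq_atTop] at this
    filter_upwards [this] with m hm
    by_contra h0
    exact hm ⟨(g m).2, (not_le.1 h0).le⟩

end

noncomputable section

theorem height_seminorm2 {n : ℕ} (P : Fin n → QBˣ) : ∃ (ι : Type) (_ : Fintype ι) (w : ℝ) (u : ι → Fin n → ℝ),
    0 < w ∧ (∀ a : Fin n → ℤ, weilHeight (lmon P a : QBˣ) ≤ w * ∑ i, |∑ j, (a j : ℝ) * u i j|) ∧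
    (w * ∑ i, ∑ j, |u i j| = 2 * ∑ j, Hc (P j)) ∧
    ∀ a : Fin n → ℤ, (∃ k : ℕ, 1 ≤ k ∧ lmon P a ^ k = 1) → ∀ i, ∑ j, (a j : ℝ) * u i j = 0 := by
  classical
  let F : Finset QB := (Finset.univ.image (fun j => (P j : QB)))
  have hF : ∀ x ∈ F, x ≠ 0 := by
    intro x hx
    simp only [F, Finset.mem_image] at hx
    obtain ⟨j, _, rfl⟩ := hx
    exact (P j).ne_zero
  have hPF : ∀ j, (P j : QB) ∈ F := fun j => by simp [F]
  have hlm : ∀ a, lmon P a ∈ Subgroup.closure {u : QBˣ | (u : QB) ∈ F} := by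
    intro a
    apply Subgroup.prod_mem
    intro j _
    exact Subgroup.zpow_mem _ (Subgroup.subset_closure (show P j ∈ {u : QBˣ | (u : QB) ∈ F} from hPF j)) _
  obtain ⟨S⟩ := place_sys F hF
  refine ⟨S.ι, S.fin, S.w, S.u P, S.w_pos, fun a => ?_, S.sum_u P hPF, ?_⟩
  · refine (S.weil _ (hlm a)).trans ?_
    apply mul_le_mul_of_nonneg_left _ S.w_pos.le
    refine Finset.sum_le_sum fun i _ => ?_
    rw [← S.log_lmon]
    rcases le_total 1 (S.ab i (lmon P a : QBˣ)) with h | h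
    · rw [max_eq_right h]; exact le_abs_self _
    · rw [max_eq_left h]; simp
  · rintro a ⟨k, hk, hak⟩ i
    rw [← S.log_lmon]
    have h1 : (S.ab i (lmon P a : QBˣ)) ^ k = 1 := by
      rw [← map_pow, ← Units.val_pow_eq_pow_val, hak]; simp
    have h2 : (k : ℝ) * Real.log (S.ab i (lmon P a : QBˣ)) = 0 := by
      rw [← Real.log_pow, h1, Real.log_one]
    have h3 : (k : ℝ) ≠ 0 := by
      have : k ≠ 0 := by omega
      exact_mod_cast this
    exact (mul_eq_zero.1 h2).resolve_left h3

def Rt {n : ℕ} (P : TorusPt n) : Submodule ℤ (Fin n → ℤ) where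
  carrier := {a | ∃ k : ℕ, 1 ≤ k ∧ lmon P a ^ k = 1}
  add_mem' := by
    rintro a b ⟨k, hk, ha⟩ ⟨l, hl, hb⟩
    refine ⟨k * l, Nat.one_le_iff_ne_zero.2 (by positivity), ?_⟩
    rw [lmon_add, mul_pow, pow_mul, ha, mul_comm k l, pow_mul, hb, one_pow, one_pow, one_mul]
  zero_mem' := ⟨1, le_rfl, by rw [lmon_zero, one_pow]⟩
  smul_mem' := by
    rintro m a ⟨k, hk, ha⟩
    refine ⟨k, hk, ?_⟩
    rw [lmon_smul, ← zpow_natCast, ← zpow_mul, mul_comm, zpow_mul, zpow_natCast, ha, one_zpow]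

lemma Rt_sat {n : ℕ} (P : TorusPt n) (m : ℤ) (hm : m ≠ 0) (a : Fin n → ℤ) (h : m • a ∈ Rt P) : a ∈ Rt P := by
  obtain ⟨k, hk, h⟩ := h
  have hN : m.natAbs ≠ 0 := Int.natAbs_ne_zero.2 hm
  refine ⟨m.natAbs * k, Nat.one_le_iff_ne_zero.2 (by positivity), ?_⟩
  rw [lmon_smul] at h
  rw [pow_mul]
  have h4 : lmon P a ^ m.natAbs = lmon P a ^ m ∨ lmon P a ^ m.natAbs = (lmon P a ^ m)⁻¹ := by
    rw [← zpow_natCast]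
    rcases Int.natAbs_eq m with h2 | h2
    · left; rw [← h2]
    · right
      have h3 : ((m.natAbs : ℕ) : ℤ) = -m := by omega
      rw [h3, zpow_neg]
  rcases h4 with h4 | h4
  · rw [h4, h]
  · rw [h4, inv_pow, h, inv_one]

def satsp {n : ℕ} (W : Submodule ℤ (Fin n → ℤ)) : Submodule ℤ (Fin n → ℤ) where
  carrier := {a | ∃ m : ℤ, m ≠ 0 ∧ m • a ∈ W}
  add_mem' := by
    rintro a b ⟨k, hk, ha⟩ ⟨l, hl, hb⟩
    refine ⟨k * l, mul_ne_zero hk hl, ?_⟩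
    rw [smul_add]
    refine add_mem ?_ ?_
    · rw [mul_comm, mul_smul]; exact W.smul_mem _ ha
    · rw [mul_smul]; exact W.smul_mem _ hb
  zero_mem' := ⟨1, one_ne_zero, by simp⟩
  smul_mem' := by
    rintro c a ⟨k, hk, ha⟩
    exact ⟨k, hk, by rw [smul_comm]; exact W.smul_mem _ ha⟩

def toR {n : ℕ} (a : Fin n → ℤ) : Fin n → ℝ := fun j => (a j : ℝ)

lemma linInd_toR {n : ℕ} {ι : Type} (a : ι → Fin n → ℤ) (h : LinearIndependent ℤ a) :
    LinearIndependent ℝ (fun i => toR (a i)) :=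
  (linearIndependent_algebraMap_comp_iff (R := ℤ) (S := ℝ) (v := a)).2 h

lemma real_span {n : ℕ} (W : Submodule ℤ (Fin n → ℤ)) (a0 : Fin n → ℤ) (h : a0 ∉ satsp W) :
    toR a0 ∉ Submodule.span ℝ (toR '' (W : Set (Fin n → ℤ))) := by
  let b := Module.finBasis ℤ W
  have hb : LinearIndependent ℤ (fun i => (b i : Fin n → ℤ)) :=
    b.linearIndependent.map' W.subtype (Submodule.ker_subtype W)
  have hmem : ∀ w ∈ W, ∃ c : Fin (Module.finrank ℤ W) → ℤ, w = ∑ i, c i • (b i : Fin n → ℤ) := by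
    intro w hw
    have h6 := b.sum_repr ⟨w, hw⟩
    have h7 := congrArg (fun w : W => (w : Fin n → ℤ)) h6
    simp only [Submodule.coe_sum, Submodule.coe_smul] at h7
    exact ⟨_, h7.symm⟩
  have hli : LinearIndependent ℤ (Fin.cons a0 (fun i => (b i : Fin n → ℤ)) : Fin (Module.finrank ℤ W + 1) → Fin n → ℤ) := by
    rw [Fintype.linearIndependent_iff]
    intro g hg
    rw [Fin.sum_univ_succ] at hg
    simp only [Fin.cons_zero, Fin.cons_succ] at hg
    have hg0 : g 0 = 0 := by
      by_contra h0
      apply h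
      refine ⟨g 0, h0, ?_⟩
      rw [eq_neg_of_add_eq_zero_left hg]
      exact neg_mem (sum_mem fun i _ => W.smul_mem _ (b i).2)
    rw [hg0, zero_smul, zero_add] at hg
    rw [Fintype.linearIndependent_iff] at hb
    have := hb _ hg
    intro i
    refine Fin.cases hg0 this i
  have hR := linInd_toR _ hli
  have hR2 : LinearIndependent ℝ (Fin.cons (toR a0) (fun i => toR (b i : Fin n → ℤ)) : Fin (Module.finrank ℤ W + 1) → Fin n → ℝ) := by
    convert hR using 1
    funext i
    refine Fin.cases ?_ (fun i => ?_) i <;> simp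
  rw [linearIndependent_finCons] at hR2
  intro hmemb
  apply hR2.2
  refine (Submodule.span_le.2 ?_) hmemb
  rintro _ ⟨w, hw, rfl⟩
  obtain ⟨c, hc⟩ := hmem w hw
  have : toR w = ∑ i, (c i : ℝ) • toR (b i : Fin n → ℤ) := by
    funext j
    rw [hc]
    simp [toR, Finset.sum_apply]
  rw [this]
  exact sum_mem fun i _ => Submodule.smul_mem _ _ (Submodule.subset_span ⟨i, rfl⟩)

lemma orth_dec {n : ℕ} (V : Submodule ℝ (Fin n → ℝ)) (a : Fin n → ℝ) (ha : a ∉ V) :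
    ∃ b : Fin n → ℝ, b ≠ 0 ∧ a - b ∈ V ∧ ∀ w ∈ V, ∑ j, w j * b j = 0 := by
  let e := (WithLp.linearEquiv 2 ℝ (Fin n → ℝ)).symm
  let V' : Submodule ℝ (EuclideanSpace ℝ (Fin n)) := V.map e.toLinearMap
  let p : EuclideanSpace ℝ (Fin n) := V'.starProjection (e a)
  have hp : p ∈ V' := Submodule.starProjection_apply_mem _ _
  obtain ⟨v, hv, hvp⟩ := hp
  have hvp' : e v = p := hvp
  refine ⟨a - v, ?_, by simpa using hv, ?_⟩
  · intro h
    exact ha (by rw [sub_eq_zero.1 h]; exact hv)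
  · intro w hw
    have h1 : e w ∈ V' := ⟨w, hw, rfl⟩
    have h2 := (Submodule.sub_starProjection_mem_orthogonal (K := V') (e a)) (e w) h1
    have h3 : e a - V'.starProjection (e a) = e (a - v) := by
      rw [map_sub, hvp']
    rw [h3, PiLp.inner_apply] at h2
    simpa [e, mul_comm] using h2

lemma dirichlet_sim {n : ℕ} (v : Fin n → ℝ) (K : ℕ) (hK : 1 ≤ K) :
    ∃ (q : ℕ) (a : Fin n → ℤ), 1 ≤ q ∧ q ≤ K ^ n ∧ ∀ j, |(a j : ℝ) - q * v j| ≤ 1 / K := by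
  have hK0 : (0 : ℝ) < K := by exact_mod_cast hK
  let g : Fin (K ^ n + 1) → (Fin n → Fin K) := fun q j =>
    ⟨⌊(K : ℝ) * Int.fract ((q : ℝ) * v j)⌋₊, by
      rw [Nat.floor_lt (mul_nonneg hK0.le (Int.fract_nonneg _))]
      nlinarith [Int.fract_lt_one ((q : ℝ) * v j)]⟩
  have hcard : Fintype.card (Fin n → Fin K) < Fintype.card (Fin (K ^ n + 1)) := by simp
  obtain ⟨q1, q2, hne, hg⟩ := Fintype.exists_ne_map_eq_of_card_lt g hcard
  have main : ∀ q1 q2 : Fin (K ^ n + 1), q1 < q2 → g q1 = g q2 →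
      ∃ (q : ℕ) (a : Fin n → ℤ), 1 ≤ q ∧ q ≤ K ^ n ∧ ∀ j, |(a j : ℝ) - q * v j| ≤ 1 / K := by
    intro q1 q2 hlt hg
    have hlt' : (q1 : ℕ) < q2 := hlt
    refine ⟨q2 - q1, fun j => ⌊(q2 : ℝ) * v j⌋ - ⌊(q1 : ℝ) * v j⌋, by omega, by have := q2.2; omega, ?_⟩
    intro j
    have h1 : ⌊(K : ℝ) * Int.fract ((q1 : ℝ) * v j)⌋₊ = ⌊(K : ℝ) * Int.fract ((q2 : ℝ) * v j)⌋₊ :=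
      congrArg Fin.val (congrFun hg j)
    have a1 := Nat.floor_le (mul_nonneg hK0.le (Int.fract_nonneg ((q1 : ℝ) * v j)))
    have a2 := Nat.floor_le (mul_nonneg hK0.le (Int.fract_nonneg ((q2 : ℝ) * v j)))
    have b1 := Nat.lt_floor_add_one ((K : ℝ) * Int.fract ((q1 : ℝ) * v j))
    have b2 := Nat.lt_floor_add_one ((K : ℝ) * Int.fract ((q2 : ℝ) * v j))
    rw [h1] at a1 b1
    have c1 := Int.floor_add_fract ((q1 : ℝ) * v j)
    have c2 := Int.floor_add_fract ((q2 : ℝ) * v j)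
    rw [Nat.cast_sub hlt'.le]
    push_cast
    have : ((⌊(q2 : ℝ) * v j⌋ : ℝ) - ⌊(q1 : ℝ) * v j⌋ - ((q2 : ℝ) - q1) * v j)
      = Int.fract ((q1 : ℝ) * v j) - Int.fract ((q2 : ℝ) * v j) := by linarith
    rw [this, le_div_iff₀ hK0]
    have : |Int.fract ((q1 : ℝ) * v j) - Int.fract ((q2 : ℝ) * v j)| * K =
        |(K : ℝ) * Int.fract ((q1 : ℝ) * v j) - (K : ℝ) * Int.fract ((q2 : ℝ) * v j)| := by
      rw [← mul_sub, abs_mul, abs_of_pos hK0, mul_comm]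
    rw [this, abs_le]
    constructor <;> linarith
  rcases lt_or_gt_of_ne hne with h | h
  · exact main _ _ h hg
  · exact main _ _ h hg.symm

end

noncomputable section

lemma finite_Rt_aux (n : ℕ) (B C : ℝ) (hC : 0 < C) : ∃ M : ℕ, ∀ P : TorusPt n, ∑ j, Hc (P j) ≤ B →
    (∀ a, a ∉ Rt P → C ≤ weilHeight (lmon P a : QBˣ)) →
    Rt P = satsp (Submodule.span ℤ {a | a ∈ Rt P ∧ ∀ j, |a j| ≤ (M : ℤ)}) := by
  obtain ⟨K1, hK1⟩ := exists_nat_gt (2 * B / C)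
  set K : ℕ := K1 + n + 1 with hK
  have hK0 : (0 : ℝ) < K := by rw [hK]; positivity
  refine ⟨K ^ n + 1, fun P hB hbog => ?_⟩
  set W := Submodule.span ℤ {a | a ∈ Rt P ∧ ∀ j, |a j| ≤ ((K ^ n + 1 : ℕ) : ℤ)} with hW
  have hWR : W ≤ Rt P := Submodule.span_le.2 fun a ha => ha.1
  refine le_antisymm ?_ ?_
  swap
  · rintro a ⟨m, hm, h⟩
    exact Rt_sat P m hm a (hWR h)
  intro a0 ha0
  by_contra hnot
  obtain ⟨b, hb0, hab, horth⟩ := orth_dec _ _ (real_span W a0 hnot)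
  obtain ⟨ι, _, w, u, hw, hu1, hu2, hu3⟩ := height_seminorm2 P
  -- normalise b
  have hne : (Finset.univ : Finset (Fin n)).Nonempty := by
    rw [Finset.univ_nonempty_iff]
    by_contra h
    rw [not_nonempty_iff] at h
    exact hb0 (Subsingleton.elim _ _)
  obtain ⟨j0, _, hj0⟩ := Finset.exists_max_image Finset.univ (fun j => |b j|) hne
  have hbj : 0 < |b j0| := by
    by_contra h
    apply hb0
    funext j
    have h1 := hj0 j (Finset.mem_univ j)
    have h2 := abs_nonneg (b j)
    exact abs_eq_zero.1 (le_antisymm (h1.trans (not_lt.1 h)) h2)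
  have hbu : ∀ i, ∑ j, b j * u i j = 0 := by
    intro i
    let φ : (Fin n → ℝ) →ₗ[ℝ] ℝ := ∑ j, (u i j) • LinearMap.proj j
    have hφ : ∀ z, φ z = ∑ j, z j * u i j := by
      intro z
      simp [φ, LinearMap.sum_apply, mul_comm]
    have hker : Submodule.span ℝ (toR '' (W : Set (Fin n → ℤ))) ≤ LinearMap.ker φ := by
      refine Submodule.span_le.2 ?_
      rintro _ ⟨z, hz, rfl⟩
      have : φ (toR z) = 0 := by rw [hφ]; exact hu3 z (hWR hz) i
      exact this
    have h1 : φ (toR a0 - b) = 0 := hker hab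
    rw [map_sub] at h1
    have h2 : φ (toR a0) = 0 := by rw [hφ]; exact hu3 a0 ha0 i
    rw [h2, zero_sub, neg_eq_zero, hφ] at h1
    exact h1
  obtain ⟨q, a, hq1, hq2, hqa⟩ := dirichlet_sim (fun j => b j / |b j0|) K (by omega)
  have hv1 : ∀ j, |(b j / |b j0| : ℝ)| ≤ 1 := by
    intro j
    rw [abs_div, abs_abs, div_le_one hbj]
    exact hj0 j (Finset.mem_univ j)
  have haW : a ∈ W := by
    refine Submodule.subset_span ⟨?_, ?_⟩
    · by_contra hna
      have h1 := hbog a hna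
      have h2 := hu1 a
      have h3 : w * ∑ i, |∑ j, (a j : ℝ) * u i j| ≤ 1 / K * (w * ∑ i, ∑ j, |u i j|) := by
        rw [mul_left_comm]
        refine mul_le_mul_of_nonneg_left ?_ hw.le
        rw [Finset.mul_sum]
        refine Finset.sum_le_sum fun i _ => ?_
        have h4 : ∑ j, (a j : ℝ) * u i j = ∑ j, ((a j : ℝ) - q * (b j / |b j0|)) * u i j := by
          have : ∑ j, (q * (b j / |b j0|)) * u i j = (q / |b j0|) * ∑ j, b j * u i j := by
            rw [Finset.mul_sum]
            refine Finset.sum_congr rfl fun j _ => ?_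
            ring
          simp only [sub_mul]
          rw [Finset.sum_sub_distrib, this, hbu, mul_zero, sub_zero]
        rw [h4, Finset.mul_sum]
        refine (Finset.abs_sum_le_sum_abs _ _).trans (Finset.sum_le_sum fun j _ => ?_)
        rw [abs_mul]
        exact mul_le_mul_of_nonneg_right (hqa j) (abs_nonneg _)
      rw [hu2] at h3
      have h5 : 1 / (K : ℝ) * (2 * ∑ j, Hc (P j)) < C := by
        rw [one_div, inv_mul_lt_iff₀ hK0]
        rw [div_lt_iff₀ hC] at hK1
        have : (K1 : ℝ) ≤ K := by rw [hK]; push_cast; linarith [Nat.cast_nonneg (α := ℝ) n]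
        nlinarith
      linarith
    · intro j
      have h1 := hqa j
      have h2 : (1 : ℝ) / K ≤ 1 := by
        rw [div_le_one hK0, hK]
        push_cast
        have := Nat.cast_nonneg (α := ℝ) n
        have := Nat.cast_nonneg (α := ℝ) K1
        linarith
      have h3 : |(q : ℝ) * (b j / |b j0|)| ≤ K ^ n := by
        rw [abs_mul, Nat.abs_cast]
        have : (q : ℝ) ≤ K ^ n := by exact_mod_cast hq2
        calc (q : ℝ) * _ ≤ q * 1 := mul_le_mul_of_nonneg_left (hv1 j) (Nat.cast_nonneg _)
          _ ≤ _ := by linarith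
      have h4 : |(a j : ℝ)| ≤ K ^ n + 1 := by
        have := abs_add_le ((a j : ℝ) - q * (b j / |b j0|)) (q * (b j / |b j0|))
        rw [sub_add_cancel] at this
        linarith
      exact_mod_cast h4
  have h1 := horth (toR a) (Submodule.subset_span ⟨a, haW, rfl⟩)
  have h2 : ∑ j, (a j : ℝ) * (b j / |b j0|) = 0 := by
    have : ∑ j, (a j : ℝ) * (b j / |b j0|) = (∑ j, toR a j * b j) / |b j0| := by
      rw [Finset.sum_div]
      refine Finset.sum_congr rfl fun j _ => ?_
      rw [toR, mul_div_assoc]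
    rw [this, h1, zero_div]
  have h3 : (1 : ℝ) ≤ ∑ j, (b j / |b j0|) ^ 2 := by
    have : (b j0 / |b j0|) ^ 2 = 1 := by
      rw [div_pow, sq_abs, div_self]
      intro h
      rw [sq_eq_zero_iff] at h
      rw [h] at hbj
      simp at hbj
    rw [← this]
    exact Finset.single_le_sum (f := fun j => (b j / |b j0|) ^ 2) (fun j _ => sq_nonneg _) (Finset.mem_univ j0)
  have h4 : ∑ j, (q * (b j / |b j0|) - a j) * (b j / |b j0|) ≤ n * (1 / K) := by
    have : ∑ j : Fin n, (1 : ℝ) / K = n * (1 / K) := by simp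
    rw [← this]
    refine Finset.sum_le_sum fun j _ => ?_
    refine (le_abs_self _).trans ?_
    rw [abs_mul, abs_sub_comm]
    calc _ ≤ (1 / (K : ℝ)) * 1 := mul_le_mul (hqa j) (hv1 j) (abs_nonneg _) (by positivity)
      _ = _ := mul_one _
  have h5 : ∑ j, (q * (b j / |b j0|) - a j) * (b j / |b j0|) = q * ∑ j, (b j / |b j0|) ^ 2 := by
    simp only [sub_mul]
    rw [Finset.sum_sub_distrib, h2, sub_zero, Finset.mul_sum]
    refine Finset.sum_congr rfl fun j _ => ?_
    ring
  have h6 : (n : ℝ) * (1 / K) < 1 := by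
    rw [mul_one_div, div_lt_one hK0, hK]
    push_cast
    have := Nat.cast_nonneg (α := ℝ) K1
    linarith
  have h7 : (1 : ℝ) ≤ q := by exact_mod_cast hq1
  rw [h5] at h4
  nlinarith

theorem finite_Rt (n : ℕ) (B C : ℝ) (hC : 0 < C) : ∃ F : Set (Submodule ℤ (Fin n → ℤ)), F.Finite ∧
    ∀ P : TorusPt n, ∑ j, Hc (P j) ≤ B →
    (∀ a, a ∉ Rt P → C ≤ weilHeight (lmon P a : QBˣ)) → Rt P ∈ F := by
  obtain ⟨M, hM⟩ := finite_Rt_aux n B C hC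
  let box : Set (Fin n → ℤ) := {a | ∀ j, |a j| ≤ (M : ℤ)}
  have hbox : box.Finite := by
    refine (Set.finite_Icc (fun _ => -(M : ℤ)) (fun _ : Fin n => (M : ℤ))).subset ?_
    intro a ha
    exact ⟨fun j => (abs_le.1 (ha j)).1, fun j => (abs_le.1 (ha j)).2⟩
  refine ⟨(fun s => satsp (Submodule.span ℤ s)) '' (𝒫 box), hbox.finite_subsets.image _, ?_⟩
  intro P h1 h2
  exact ⟨_, fun a ha => ha.2, (hM P h1 h2).symm⟩

end

noncomputable section

lemma gal_pow (N m : ℕ) (hN : 1 ≤ N) (hm : m.Coprime N) :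
    ∃ τ : QB →ₐ[ℚ] QB, ∀ η : QB, η ^ N = 1 → τ η = η ^ m := by
  have : NeZero N := ⟨by omega⟩
  obtain ⟨ω, hω⟩ := HasEnoughRootsOfUnity.exists_primitiveRoot QB N
  have h2 := hω.pow_of_coprime m hm
  have hc : ω ^ m ∈ cj ω := by
    rw [cj, Polynomial.mem_aroots]
    refine ⟨minpoly.ne_zero (Algebra.IsIntegral.isIntegral ω), ?_⟩
    rw [← Polynomial.cyclotomic_eq_minpoly_rat hω hN, Polynomial.cyclotomic_eq_minpoly_rat h2 hN]
    exact minpoly.aeval _ _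
  obtain ⟨τ, hτ⟩ := cj_exists_aut _ _ hc
  refine ⟨τ, fun η hη => ?_⟩
  obtain ⟨i, _, rfl⟩ := hω.eq_pow_of_pow_eq_one hη
  rw [map_pow, hτ, ← pow_mul, ← pow_mul, mul_comm]

open Classical in
/-- Vandermonde elimination. -/
lemma vand_elim {ι : Type} (s : Finset ι) (c θ : ι → QB) (T : ℕ) (U : Finset QB) (hU1 : (1 : QB) ∉ U)
    (hU : ∀ i ∈ s, θ i ≠ 1 → θ i ∈ U) (hT : U.card < T)
    (hs : ∀ j < T, ∑ i ∈ s, c i * θ i ^ j = 0) : ∑ i ∈ s with θ i = 1, c i = 0 := by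
  classical
  let g : Polynomial QB := ∏ u ∈ U, (Polynomial.X - Polynomial.C u)
  have hdeg : g.natDegree < T := by
    have : g.natDegree = U.card := Polynomial.natDegree_prod_of_monic _ _ (fun u _ => Polynomial.monic_X_sub_C u) |>.trans (by simp)
    omega
  have hev : ∀ x, g.eval x = ∏ u ∈ U, (x - u) := by
    intro x
    simp [g, Polynomial.eval_prod]
  have h1 : ∑ i ∈ s, c i * g.eval (θ i) = 0 := by
    have : ∀ i, c i * g.eval (θ i) = ∑ j ∈ Finset.range T, g.coeff j * (c i * θ i ^ j) := by
      intro i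
      rw [Polynomial.eval_eq_sum_range' hdeg, Finset.mul_sum]
      exact Finset.sum_congr rfl fun j _ => by ring
    simp only [this]
    rw [Finset.sum_comm]
    refine Finset.sum_eq_zero fun j hj => ?_
    rw [← Finset.mul_sum, hs j (Finset.mem_range.1 hj), mul_zero]
  have hg1 : g.eval 1 ≠ 0 := by
    rw [hev, Finset.prod_ne_zero_iff]
    intro u hu h
    rw [sub_eq_zero] at h
    exact hU1 (h ▸ hu)
  have h2 : ∑ i ∈ s, c i * g.eval (θ i) = (∑ i ∈ s with θ i = 1, c i) * g.eval 1 := by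
    rw [Finset.sum_filter, Finset.sum_mul]
    refine Finset.sum_congr rfl fun i hi => ?_
    by_cases h : θ i = 1
    · rw [if_pos h, h]
    · rw [if_neg h, zero_mul, hev, Finset.prod_eq_zero (hU i hi h) (sub_self _), mul_zero]
  rw [h1] at h2
  exact (mul_eq_zero.1 h2.symm).resolve_right hg1

open Classical in
lemma mann_step {ι : Type} (s : Finset ι) (c : ι → ℚ) (η : ι → QB) (M p : ℕ) (hp : p.Prime)
    (hM : 1 ≤ M) (hη : ∀ i ∈ s, η i ^ (p * M) = 1) (hsum : ∑ i ∈ s, (c i : QB) * η i = 0)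
    (hbig : p ∣ M ∨ s.card < p) (i0 : ι) (hi0 : i0 ∈ s) (h0 : η i0 = 1) :
    ∑ i ∈ s with η i ^ M = 1, (c i : QB) * η i = 0 := by
  classical
  have key : ∀ j, (1 + j * M).Coprime (p * M) → ∑ i ∈ s, ((c i : QB) * η i) * (η i ^ M) ^ j = 0 := by
    intro j hj
    obtain ⟨τ, hτ⟩ := gal_pow (p * M) (1 + j * M) (Nat.mul_pos hp.pos hM) hj
    have := congrArg τ hsum
    rw [map_zero, map_sum] at this
    rw [← this]
    refine Finset.sum_congr rfl fun i hi => ?_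
    rw [map_mul, hτ _ (hη i hi), map_ratCast]
    ring
  have hcopM : ∀ j, (1 + j * M).Coprime M := by
    intro j
    simp
  by_cases hpM : p ∣ M
  · let U : Finset QB := (Polynomial.nthRootsFinset p (1 : QB)).erase 1
    have hUc : U.card < p := by
      have h1 : (Polynomial.nthRootsFinset p (1 : QB)).card ≤ p := by
        rw [Polynomial.nthRootsFinset]
        exact (Multiset.toFinset_card_le _).trans (Polynomial.card_nthRoots _ _)
      have h2 : (1 : QB) ∈ Polynomial.nthRootsFinset p (1 : QB) := by
        rw [Polynomial.mem_nthRootsFinset hp.pos, one_pow]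
      have h3 := Finset.card_erase_lt_of_mem h2
      exact lt_of_lt_of_le h3 h1
    refine vand_elim s _ (fun i => η i ^ M) p U (by simp [U]) ?_ hUc ?_
    · intro i hi h
      refine Finset.mem_erase.2 ⟨h, ?_⟩
      rw [Polynomial.mem_nthRootsFinset hp.pos, ← pow_mul, mul_comm, hη i hi]
    · intro j _
      refine key j (Nat.Coprime.mul_right ?_ (hcopM j))
      rw [Nat.coprime_comm, hp.coprime_iff_not_dvd]
      intro h
      have := (Nat.dvd_add_left (hpM.mul_left j)).1 h
      exact hp.one_lt.ne' (Nat.dvd_one.1 this)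
  · have hc := hbig.resolve_left hpM
    -- the exceptional residue
    have hcop : M.Coprime p := ((hp.coprime_iff_not_dvd).2 hpM).symm
    obtain ⟨j0, hj0⟩ : ∃ j0 : ℕ, p ∣ 1 + j0 * M := by
      have : Fact p.Prime := ⟨hp⟩
      have hM0 : (M : ZMod p) ≠ 0 := by
        rwa [Ne, ZMod.natCast_eq_zero_iff]
      refine ⟨(-(M : ZMod p)⁻¹).val, ?_⟩
      rw [← ZMod.natCast_eq_zero_iff]
      push_cast
      rw [ZMod.natCast_zmod_val, neg_mul, inv_mul_cancel₀ hM0, add_neg_cancel]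
    let U : Finset QB := ((s.erase i0).image (fun i => η i ^ M)).erase 1
    have hUc : U.card < p - 1 := by
      have h1 : U.card ≤ (s.erase i0).card := (Finset.card_le_card (Finset.erase_subset _ _)).trans Finset.card_image_le
      have h2 := Finset.card_erase_lt_of_mem hi0
      omega
    have h3 := vand_elim s (fun i => ((c i : QB) * η i) * (η i ^ M) ^ (j0 + 1)) (fun i => η i ^ M) (p - 1) U (by simp [U]) ?_ hUc ?_
    · rw [← h3]
      refine Finset.sum_congr rfl fun i hi => ?_
      rw [(Finset.mem_filter.1 hi).2, one_pow, mul_one]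
    · intro i hi h
      refine Finset.mem_erase.2 ⟨h, Finset.mem_image.2 ⟨i, Finset.mem_erase.2 ⟨?_, hi⟩, rfl⟩⟩
      rintro rfl
      exact h (by simp only [h0, one_pow])
    · intro j hj
      have h4 := key (j0 + 1 + j) (Nat.Coprime.mul_right ?_ (hcopM _))
      · rw [← h4]
        refine Finset.sum_congr rfl fun i _ => ?_
        rw [mul_assoc, ← pow_add]
      · rw [Nat.coprime_comm, hp.coprime_iff_not_dvd]
        intro h
        have h5 : 1 + (j0 + 1 + j) * M = (1 + j0 * M) + (j + 1) * M := by ring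
        rw [h5] at h
        have h6 := (Nat.dvd_add_right hj0).1 h
        have h7 := (hp.dvd_mul.1 h6).resolve_right hpM
        have := Nat.le_of_dvd (by omega) h7
        omega

lemma mann {ι : Type} (s : Finset ι) (c : ι → ℚ) (η : ι → QB)
    (hη : ∀ i ∈ s, ∃ k : ℕ, 1 ≤ k ∧ η i ^ k = 1) (hsum : ∑ i ∈ s, (c i : QB) * η i = 0)
    (hmin : ∀ t ⊆ s, t.Nonempty → ∑ i ∈ t, (c i : QB) * η i = 0 → t = s)
    (i0 : ι) (hi0 : i0 ∈ s) (h0 : η i0 = 1) :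
    ∀ i ∈ s, η i ^ primorial s.card = 1 := by
  classical
  have hex : ∃ N : ℕ, 1 ≤ N ∧ ∀ i ∈ s, η i ^ N = 1 := by
    choose! k hk1 hk2 using hη
    refine ⟨∏ i ∈ s, k i, Nat.one_le_iff_ne_zero.2 (Finset.prod_ne_zero_iff.2 fun i hi => by have := hk1 i hi; omega), fun i hi => ?_⟩
    obtain ⟨m, hm⟩ := Finset.dvd_prod_of_mem k hi
    rw [hm, pow_mul, hk2 i hi, one_pow]
  obtain ⟨hN1, hN2⟩ := Nat.find_spec hex
  have hNm := fun m hm => Nat.find_min hex (m := m) hm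
  generalize Nat.find hex = N at hN1 hN2 hNm
  have main : ∀ p M : ℕ, p.Prime → N = p * M → ¬ (p ∣ M ∨ s.card < p) := by
    intro p M hp hNM hbig
    have hM : 1 ≤ M := by
      rcases Nat.eq_zero_or_pos M with h | h
      · subst h; omega
      · exact h
    have h1 := mann_step s c η M p hp hM (fun i hi => hNM ▸ hN2 i hi) hsum hbig i0 hi0 h0
    have h2 := hmin _ (Finset.filter_subset _ _) ⟨i0, Finset.mem_filter.2 ⟨hi0, by rw [h0, one_pow]⟩⟩ h1
    refine hNm M ?_ ⟨hM, fun i hi => ?_⟩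
    · rw [hNM]
      have := hp.two_le
      nlinarith
    · rw [← h2] at hi
      exact (Finset.mem_filter.1 hi).2
  have hsq : Squarefree N := by
    rw [Nat.squarefree_iff_prime_squarefree]
    rintro p hp ⟨M, hM⟩
    exact main p (p * M) hp (by rw [hM, mul_assoc]) (Or.inl (dvd_mul_right _ _))
  have hdvd : N ∣ primorial s.card := by
    rw [← Nat.prod_primeFactors_of_squarefree hsq, primorial]
    refine Finset.prod_dvd_prod_of_subset _ _ _ fun p hp => ?_
    have hpp := Nat.prime_of_mem_primeFactors hp
    obtain ⟨M, hM⟩ := Nat.dvd_of_mem_primeFactors hp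
    have := main p M hpp hM
    simp only [Finset.mem_filter, Finset.mem_range]
    refine ⟨?_, hpp⟩
    by_contra h
    exact this (Or.inr (by omega))
  intro i hi
  obtain ⟨m, hm⟩ := hdvd
  rw [hm, pow_mul, hN2 i hi, one_pow]

lemma mann_cor {ι : Type} (s : Finset ι) (hs : s.Nonempty) (c : ι → ℚ) (hc : ∀ i ∈ s, c i ≠ 0) (ζ : ι → QB)
    (hζ : ∀ i ∈ s, ∃ k : ℕ, 1 ≤ k ∧ ζ i ^ k = 1) (hsum : ∑ i ∈ s, (c i : QB) * ζ i = 0) :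
    ∃ i ∈ s, ∃ j ∈ s, i ≠ j ∧ ζ i ^ primorial s.card = ζ j ^ primorial s.card := by
  classical
  have hne : ∀ i ∈ s, ζ i ≠ 0 := by
    intro i hi h
    obtain ⟨k, hk, h2⟩ := hζ i hi
    rw [h, zero_pow (by omega)] at h2
    exact zero_ne_one h2
  have hex : ∃ k : ℕ, ∃ t ⊆ s, t.Nonempty ∧ ∑ i ∈ t, (c i : QB) * ζ i = 0 ∧ t.card = k :=
    ⟨_, s, subset_rfl, hs, hsum, rfl⟩
  obtain ⟨t, hts, ⟨i0, hi0⟩, hsum', hcard⟩ := Nat.find_spec hex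
  have hmin := fun m hm => Nat.find_min hex (m := m) hm
  rw [← hcard] at hmin
  obtain ⟨i1, hi1, hne1⟩ : ∃ i1 ∈ t, i1 ≠ i0 := by
    by_contra h
    push Not at h
    have : t = {i0} := by
      ext i
      rw [Finset.mem_singleton]
      exact ⟨h i, fun h => h ▸ hi0⟩
    rw [this, Finset.sum_singleton] at hsum'
    rcases mul_eq_zero.1 hsum' with h | h
    · exact hc i0 (hts hi0) (by exact_mod_cast h)
    · exact hne i0 (hts hi0) h
  have hdiv : ∀ u : Finset ι, ∑ i ∈ u, (c i : QB) * (ζ i / ζ i0) = (∑ i ∈ u, (c i : QB) * ζ i) / ζ i0 := by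
    intro u
    rw [Finset.sum_div]
    exact Finset.sum_congr rfl fun i _ => by rw [mul_div_assoc]
  have := mann t c (fun i => ζ i / ζ i0) ?_ ?_ ?_ i0 hi0 (div_self (hne i0 (hts hi0))) i1 hi1
  · refine ⟨i1, hts hi1, i0, hts hi0, hne1, ?_⟩
    rw [div_pow, div_eq_one_iff_eq (pow_ne_zero _ (hne i0 (hts hi0)))] at this
    have hd : primorial t.card ∣ primorial s.card := by
      rw [primorial, primorial]
      refine Finset.prod_dvd_prod_of_subset _ _ _ fun p hp => ?_
      have := Finset.card_le_card hts
      simp only [Finset.mem_filter, Finset.mem_range] at hp ⊢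
      exact ⟨by omega, hp.2⟩
    obtain ⟨m, hm⟩ := hd
    rw [hm, pow_mul, pow_mul, this]
  · intro i hi
    obtain ⟨k, hk, h1⟩ := hζ i (hts hi)
    obtain ⟨k', hk', h1'⟩ := hζ i0 (hts hi0)
    refine ⟨k * k', Nat.mul_pos hk hk', ?_⟩
    rw [div_pow, pow_mul, h1, one_pow, mul_comm, pow_mul, h1', one_pow, div_one]
  · rw [hdiv, hsum', zero_div]
  · intro u hu hun hus
    rw [hdiv, div_eq_zero_iff] at hus
    have h1 := hus.resolve_right (hne i0 (hts hi0))
    by_contra hne'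
    exact hmin u.card (Finset.card_lt_card (hu.ssubset_of_ne hne')) ⟨u, hu.trans hts, hun, h1, rfl⟩

end

noncomputable section

lemma dense_cst {n : ℕ} {Y T : Set (TorusPt n)} (hY : Irr Y)
    (hT : ∀ f : RR n, (∀ y ∈ T, ev y f = 0) → f ∈ vI Y) (a : Fin n → ℤ) (ha : ∀ P ∈ T, lmon P a = 1) :
    a ∈ cst QB (xx Y) := by
  rw [mem_cst hY]
  refine ⟨1, fun y hy => ?_⟩
  have h1 : LM a - 1 ∈ vI Y := hT _ fun P hP => by
    rw [map_sub, map_one, ev_LM, ha P hP, Units.val_one, sub_self]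
  have h2 := mem_vI.1 h1 y hy
  rw [map_sub, map_one, ev_LM, sub_eq_zero] at h2
  exact Units.ext h2

lemma LamH_le_Rt {n : ℕ} {H : Set (TorusPt n)} {P : TorusPt n} (hP : P ∈ H) : LamH H ≤ Rt P := by
  intro a ha
  exact ⟨1, le_rfl, by rw [pow_one]; exact ha P hP⟩

/-- saturated submodule of the same rank. -/
lemma sat_eq {n : ℕ} (A R : Submodule ℤ (Fin n → ℤ)) (hAR : A ≤ R)
    (hsat : ∀ (m : ℤ), m ≠ 0 → ∀ a, m • a ∈ A → a ∈ A)
    (hr : Module.finrank ℤ R ≤ Module.finrank ℤ A) : R ≤ A := by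
  intro a ha
  obtain ⟨f, hf⟩ := exists_linearIndependent_of_le_finrank hr
  have hf' : LinearIndependent ℤ (fun i => (f i : Fin n → ℤ)) :=
    hf.map' A.subtype (Submodule.ker_subtype A)
  by_contra hna
  have h1 : LinearIndependent ℤ (Fin.cons (⟨a, ha⟩ : R) (fun i => (⟨f i, hAR (f i).2⟩ : R)) : Fin (Module.finrank ℤ R + 1) → R) := by
    have h2 : LinearIndependent ℤ (R.subtype ∘ (Fin.cons (⟨a, ha⟩ : R) (fun i => (⟨f i, hAR (f i).2⟩ : R)) : Fin (Module.finrank ℤ R + 1) → R)) := by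
      rw [Fintype.linearIndependent_iff]
      intro g hg
      rw [Fin.sum_univ_succ] at hg
      simp only [Function.comp_apply, Fin.cons_zero, Fin.cons_succ, Submodule.subtype_apply] at hg
      have hg0 : g 0 = 0 := by
        by_contra h0
        refine hna (hsat (g 0) h0 a ?_)
        rw [eq_neg_of_add_eq_zero_left hg]
        exact A.neg_mem (A.sum_mem fun i _ => A.smul_mem _ (f i).2)
      rw [hg0, zero_smul, zero_add] at hg
      have := (Fintype.linearIndependent_iff.1 hf') (fun i => g i.succ) hg
      intro i
      refine Fin.cases hg0 this i
    exact LinearIndependent.of_comp _ h2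
  have h3 := h1.fintype_card_le_finrank
  simp at h3

theorem torsion_end {n : ℕ} {X Y S : Set (TorusPt n)} (hY : Irr Y) (hYX : Y ⊆ X) {P0 : TorusPt n}
    (hP0 : P0 ∈ Y) (hoa : P0 ∈ openAnom X (zdim X)) (hd : 1 ≤ tdY Y) (hS : S.Infinite) (hSY : S ⊆ Y)
    (hdense : ∀ T ⊆ S, T.Infinite → ∀ f : RR n, (∀ y ∈ T, ev y f = 0) → f ∈ vI Y)
    (R : Submodule ℤ (Fin n → ℤ)) (hR : ∀ P ∈ S, Rt P = R)
    (hH : ∀ P ∈ S, ∃ H : Set (TorusPt n), IsAlgSubgroup H ∧ ZConnected H ∧ zdim X + zdim H ≤ n ∧ P ∈ H) :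
    False := by
  classical
  by_cases hrk : Module.finrank ℤ R ≤ zdim X
  · -- all relations are exact
    have hone : ∀ P ∈ S, ∀ a ∈ R, lmon P a = 1 := by
      intro P hP a ha
      obtain ⟨H, h1, h2, h3, h4⟩ := hH P hP
      have hle := LamH_le_Rt h4
      rw [hR P hP] at hle
      exact sat_eq (LamH H) R hle (LamH_sat h1 h2) (hrk.trans (subgroup_rels h1 h3)) ha P h4
    obtain ⟨P, hP⟩ := hS.nonempty
    obtain ⟨H, h1, h2, h3, h4⟩ := hH P hP
    have hle := LamH_le_Rt h4
    rw [hR P hP] at hle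
    obtain ⟨f, hf⟩ := exists_linearIndependent_of_le_finrank (subgroup_rels h1 h3)
    have hf' : LinearIndependent ℤ (fun i => (f i : Fin n → ℤ)) :=
      hf.map' (LamH H).subtype (Submodule.ker_subtype _)
    have := nonanom_cst hY hYX hP0 hoa hd _ hf' fun i =>
      dense_cst hY (hdense S subset_rfl hS) _ fun Q hQ => hone Q hQ _ (hle (f i).2)
    omega
  · push Not at hrk
    let Λ := (cst QB (xx Y)).comap R.subtype
    have hΛ : tdY Y + Module.finrank ℤ Λ ≤ zdim X := by
      obtain ⟨f, hf⟩ := exists_linearIndependent_of_le_finrank (le_refl (Module.finrank ℤ Λ))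
      have hf' : LinearIndependent ℤ (fun i => ((f i : R) : Fin n → ℤ)) :=
        (hf.map' Λ.subtype (Submodule.ker_subtype _)).map' R.subtype (Submodule.ker_subtype _)
      exact nonanom_cst hY hYX hP0 hoa hd _ hf' fun i => (f i).2
    have hq := Submodule.finrank_quotient_add_finrank Λ
    obtain ⟨g, hg⟩ := exists_linearIndependent_of_le_finrank
      (show tdY Y + 1 ≤ Module.finrank ℤ (R ⧸ Λ) by omega)
    choose b hb using fun i => Submodule.mkQ_surjective Λ (g i)
    have hind : ∀ w : Fin (tdY Y + 1) → ℤ, ∑ i, w i • (b i : Fin n → ℤ) ∈ cst QB (xx Y) → w = 0 := by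
      intro w hw
      have h1 : ∑ i, w i • b i ∈ Λ := by
        rw [Submodule.mem_comap]
        simpa using hw
      have h2 : Λ.mkQ (∑ i, w i • b i) = 0 := by
        rw [Submodule.mkQ_apply, Submodule.Quotient.mk_eq_zero]
        exact h1
      rw [map_sum] at h2
      simp only [map_smul, hb] at h2
      funext i
      exact Fintype.linearIndependent_iff.1 hg w h2 i
    have := hY.pr
    -- algebraic dependence
    have hdep : ¬ AlgebraicIndependent ℚ (fun i => ((lmon (xx Y) (b i) : (AA Y)ˣ) : AA Y)) := by
      intro h
      have h1 := (h.extendScalars QB)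
      have h2 := algInd_le_td h1
      rw [Fintype.card_fin] at h2
      change _ ≤ tdY Y at h2
      omega
    rw [algebraicIndependent_iff] at hdep
    push Not at hdep
    obtain ⟨F, hF0, hFne⟩ := hdep
    have hFP : ∀ P ∈ S, ∑ m ∈ F.support, ((F.coeff m : ℚ) : QB) * ∏ i, (lmon P (b i) : QB) ^ m i = 0 := by
      intro P hP
      have h1 := congrArg (evA (hSY hP)) hF0
      rw [map_zero, MvPolynomial.aeval_def, MvPolynomial.eval₂_eq', map_sum] at h1
      rw [← h1]
      refine Finset.sum_congr rfl fun m _ => ?_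
      rw [map_mul, map_prod]
      simp only [map_pow, evA_lmon]
      congr 1
      exact (eq_ratCast (((evA (hSY hP)) : AA Y →+* QB).comp (algebraMap ℚ (AA Y))) (F.coeff m)).symm
    set D := primorial F.support.card with hD
    have hD0 : D ≠ 0 := (primorial_pos _).ne'
    obtain ⟨PS, hPS⟩ : ∃ PS : Finset ((Fin (tdY Y + 1) →₀ ℕ) × (Fin (tdY Y + 1) →₀ ℕ)), ∀ mm, mm ∈ PS ↔ (mm.1 ∈ F.support ∧ mm.2 ∈ F.support) ∧ mm.1 ≠ mm.2 :=
      ⟨(F.support ×ˢ F.support).filter (fun mm : (Fin (tdY Y + 1) →₀ ℕ) × (Fin (tdY Y + 1) →₀ ℕ) => mm.1 ≠ mm.2), fun mm => by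
        rw [Finset.mem_filter, Finset.mem_product]⟩
    have hpair : ∀ P ∈ S, ∃ mm ∈ PS,
        lmon P (∑ i, ((D : ℤ) * ((mm.1 i : ℤ) - mm.2 i)) • (b i : Fin n → ℤ)) = 1 := by
      intro P hP
      have hbR : ∀ i, (b i : Fin n → ℤ) ∈ Rt P := fun i => by rw [hR P hP]; exact (b i).2
      choose k hk1 hk2 using hbR
      have hmon : ∀ m : Fin (tdY Y + 1) →₀ ℕ, ((∏ i, lmon P (b i) ^ m i : QBˣ) : QB) = ∏ i, (lmon P (b i) : QB) ^ m i := by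
        intro m
        simp
      have htor : ∀ m ∈ F.support, ∃ e : ℕ, 1 ≤ e ∧ (∏ i, (lmon P (b i) : QB) ^ m i) ^ e = 1 := by
        intro m _
        refine ⟨∏ i, k i, Nat.one_le_iff_ne_zero.2 (Finset.prod_ne_zero_iff.2 fun i _ => by have := hk1 i; omega), ?_⟩
        rw [← Finset.prod_pow]
        refine Finset.prod_eq_one fun i _ => ?_
        obtain ⟨l, hl⟩ := Finset.dvd_prod_of_mem k (Finset.mem_univ i)
        have h2 : (lmon P (b i) : QB) ^ k i = 1 := by
          rw [← Units.val_pow_eq_pow_val, hk2, Units.val_one]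
        rw [hl, ← pow_mul, mul_comm (m i), mul_assoc, pow_mul, h2, one_pow]
      obtain ⟨m, hm, m', hm', hne, heq⟩ := mann_cor F.support (MvPolynomial.support_nonempty.2 hFne) (fun m => F.coeff m)
        (fun m hm => MvPolynomial.mem_support_iff.1 hm) (fun m => ∏ i, (lmon P (b i) : QB) ^ m i) htor (hFP P hP)
      refine ⟨(m, m'), (hPS _).2 ⟨⟨hm, hm'⟩, hne⟩, ?_⟩
      rw [← hmon, ← hmon, ← Units.val_pow_eq_pow_val, ← Units.val_pow_eq_pow_val] at heq
      have heq := Units.ext heq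
      rw [lmon_sum]
      have h1 : ∀ i, lmon P (b i : Fin n → ℤ) ^ ((D : ℤ) * ((m i : ℤ) - m' i)) =
          (lmon P (b i) ^ m i) ^ D / (lmon P (b i) ^ m' i) ^ D := by
        intro i
        rw [mul_sub, zpow_sub, mul_comm (D : ℤ), mul_comm (D : ℤ), zpow_mul, zpow_mul, div_eq_mul_inv]
        simp only [zpow_natCast]
      simp only [h1]
      rw [Finset.prod_div_distrib, Finset.prod_pow, Finset.prod_pow, heq, div_self']
    -- pigeonhole
    choose! φ hφ1 hφ2 using hpair
    obtain ⟨mm, hmm, hinf⟩ : ∃ mm ∈ PS, (S ∩ φ ⁻¹' {mm}).Infinite := by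
      by_contra hcon
      push Not at hcon
      apply hS
      refine (Set.Finite.biUnion (Finset.finite_toSet PS) (t := fun mm => S ∩ φ ⁻¹' {mm}) ?_).subset ?_
      · intro mm hmm
        exact hcon mm hmm
      · intro P hP
        exact Set.mem_biUnion (hφ1 P hP) ⟨hP, rfl⟩
    have hc := dense_cst hY (hdense _ Set.inter_subset_left hinf)
      (∑ i, ((D : ℤ) * ((mm.1 i : ℤ) - mm.2 i)) • (b i : Fin n → ℤ)) (by
        rintro P ⟨hP, hPm⟩
        have h1 := hφ2 P hP
        rw [show φ P = mm from hPm] at h1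
        exact h1)
    have h0 := hind _ hc
    apply ((hPS _).1 hmm).2
    ext i
    have h1 := congrFun h0 i
    simp only [Pi.zero_apply, mul_eq_zero, Nat.cast_eq_zero, hD0, false_or, sub_eq_zero] at h1
    exact_mod_cast h1

end

lemma lmon_mem {n : ℕ} (L : IntermediateField ℚ Qbar) (P : TorusPt n) (hP : ∀ i, (P i : Qbar) ∈ L)
    (a : Fin n → ℤ) : ((lmon P a : Qbarˣ) : Qbar) ∈ L := by
  rw [lmon, Units.coe_prod]
  refine prod_mem fun i _ => ?_
  rw [Units.val_zpow_eq_zpow_val]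
  exact zpow_mem (hP i) _

/-- Finiteness of `L`-points of `X^{oa}` lying in some connected
algebraic subgroup of codimension at least `dim X`. -/
theorem abelian_points_on_nonanomalous_finite
    (n : ℕ) (K L : IntermediateField ℚ Qbar) [FiniteDimensional ℚ K] (hKL : K ≤ L)
    (hL : HasBogomolov L) (X : Set (TorusPt n)) (hXcl : ZClosed X) (hXirr : ZIrred X)
    (hXK : DefinedOver K X) :
    {P : TorusPt n | P ∈ openAnom X (zdim X) ∧ (∀ i, (P i : Qbar) ∈ L) ∧
      ∃ H : Set (TorusPt n), IsAlgSubgroup H ∧ ZConnected H ∧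
        zdim X + zdim H ≤ n ∧ P ∈ H}.Finite := by
  by_contra hfin
  let S0 : Set (TorusPt n) := {P : TorusPt n | P ∈ openAnom X (zdim X) ∧ (∀ i, (P i : Qbar) ∈ L) ∧
      ∃ H : Set (TorusPt n), IsAlgSubgroup H ∧ ZConnected H ∧ zdim X + zdim H ≤ n ∧ P ∈ H}
  have hinf : S0.Infinite := hfin
  obtain ⟨Y, hY, hYX, hSinf, hd, hdense⟩ := generic_set (irr_of hXcl hXirr) S0 (fun P hP => hP.1.1) hinf
  obtain ⟨P0, hP0S, hP0Y⟩ := hSinf.nonempty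
  obtain ⟨B, hB⟩ := bounded_height (r := zdim X) hY hSinf Set.inter_subset_right
    (fun e a ha => nonanom hY hYX hP0Y hP0S.1 a ha) hdense (by
      rintro P ⟨⟨_, _, H, h1, _, h3, h4⟩, _⟩
      obtain ⟨f, hf⟩ := exists_linearIndependent_of_le_finrank (subgroup_rels h1 h3)
      exact ⟨fun i => (f i : Fin n → ℤ), hf.map' (LamH H).subtype (Submodule.ker_subtype _),
        fun i => (f i).2 P h4⟩)
  obtain ⟨C, hC, hbog⟩ := hL
  obtain ⟨F, hF, hFR⟩ := finite_Rt n B C hC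
  let S1 : Set (TorusPt n) := {P | P ∈ S0 ∩ Y ∧ ∑ j, Hc (P j) ≤ B}
  have hR1 : ∀ P ∈ S1, Rt P ∈ F := by
    intro P hP
    refine hFR P hP.2 fun a ha => ?_
    refine hbog _ (lmon_mem L P hP.1.1.2.1 a) (Units.ne_zero _) ?_
    rintro ⟨k, hk, h⟩
    refine ha ⟨k, hk, Units.ext ?_⟩
    rw [Units.val_pow_eq_pow_val, h, Units.val_one]
  obtain ⟨R, hR, hRinf⟩ : ∃ R ∈ F, (S1 ∩ Rt ⁻¹' {R}).Infinite := by
    by_contra hcon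
    push Not at hcon
    apply hB
    refine (hF.biUnion (t := fun R => S1 ∩ Rt ⁻¹' {R}) hcon).subset ?_
    intro P hP
    exact Set.mem_biUnion (hR1 P hP) ⟨hP, rfl⟩
  exact torsion_end hY hYX hP0Y hP0S.1 hd hRinf (fun P hP => hP.1.1.2)
    (fun T hT => hdense T fun P hP => (hT hP).1.1) R (fun P hP => hP.2)
    (fun P hP => hP.1.1.1.2.2)

end
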